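/- arXiv:2405.11946 — 5 statements merged into one kernel-verified Lean document; each statement's English description precedes it below -/
import Mathlib

section
/- Let λ_1, λ_2, λ_3 be positive integers with λ_1 = max{λ_1, λ_2, λ_3} and λ_1 < λ_2 + λ_3. If λ_2 + λ_3 ≠ λ_1 + 1, then the coefficient of e_{(λ_2+λ_3+1, λ_1+2)} in X_{S(3; λ_1, λ_2, λ_3)} equals −2(λ_1 + λ_2 + λ_3 + 3); if λ_2 + λ_3 = λ_1 + 1, then this coefficient equals −(λ_1 + λ_2 + λ_3 + 3). -/
noncomputable section

open SimpleGraph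

/-- The chromatic symmetric function of a finite simple graph, as a formal power
series in countably many commuting variables `x_0, x_1, x_2, …`: the coefficient of the
monomial `∏ i, x_i ^ d i` is the number of proper colourings `κ : V → ℕ` in which colour `i`
is used exactly `d i` times. -/
def csf {V : Type} [Fintype V] (G : SimpleGraph V) : MvPowerSeries ℕ ℚ :=
  fun d => (Nat.card {κ : V → ℕ //
      (∀ u v : V, G.Adj u v → κ u ≠ κ v) ∧
      ∀ i : ℕ, Nat.card {v : V // κ v = i} = d i} : ℚ)

/-- The elementary symmetric function `e_k` as a formal power series. -/
def esym (k : ℕ) : MvPowerSeries ℕ ℚ :=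
  fun d => if (∀ i ∈ d.support, d i = 1) ∧ (d.sum fun _ v => v) = k then 1 else 0

/-- `e_λ` for a partition `λ` given as a multiset of parts. -/
def esymM (μ : Multiset ℕ) : MvPowerSeries ℕ ℚ :=
  (μ.map esym).prod

/-- A symmetric function is `e`-positive if it is a finite nonnegative linear combination
of the elementary symmetric functions `e_λ`, `λ` a partition (all parts positive). -/
def EPositive (f : MvPowerSeries ℕ ℚ) : Prop :=
  ∃ c : Multiset ℕ →₀ ℚ, (∀ μ, 0 ≤ c μ) ∧ (∀ μ ∈ c.support, 0 ∉ μ) ∧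
    f = c.sum fun μ a => a • esymM μ

/-- The path `P_k` on `k` vertices. -/
def pathG (k : ℕ) : SimpleGraph (Fin k) :=
  SimpleGraph.fromRel (fun i j => (j : ℕ) = (i : ℕ) + 1)

/-- The cycle `C_m` on `m` vertices (for `m = 2` this is a single edge, i.e. `P_2`). -/
def cycleG (m : ℕ) : SimpleGraph (Fin m) :=
  SimpleGraph.fromRel (fun i j => (j : ℕ) = ((i : ℕ) + 1) % m)

/-- Auxiliary relation for sun graphs: body relation on `Fin n`, plus rays
`P_{lam i}` attached at vertex `i`, the leaf `⟨i,0⟩` of ray `i` being joined to `i`. -/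
def sunRel (n : ℕ) (lam : Fin n → ℕ) (body : Fin n → Fin n → Prop) :
    (Fin n ⊕ ((i : Fin n) × Fin (lam i))) → (Fin n ⊕ ((i : Fin n) × Fin (lam i))) → Prop
  | Sum.inl i, Sum.inl i' => body i i'
  | Sum.inl i, Sum.inr p => p.1 = i ∧ (p.2 : ℕ) = 0
  | Sum.inr p, Sum.inr q => p.1 = q.1 ∧ (q.2 : ℕ) = (p.2 : ℕ) + 1
  | _, _ => False

/-- The sun graph `S(n; λ_1, …, λ_n)`: a cycle `C_n` with a path `P_{λ_i}` (a *ray*)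
joined by an edge to the `i`-th cycle vertex, for each `i`. -/
def sunGraph (n : ℕ) (lam : Fin n → ℕ) :
    SimpleGraph (Fin n ⊕ ((i : Fin n) × Fin (lam i))) :=
  SimpleGraph.fromRel (sunRel n lam (fun i i' => (i' : ℕ) = ((i : ℕ) + 1) % n))

/-- The complete sun graph `S̄(n; λ_1, …, λ_n)`: as `sunGraph`, but with complete body `K_n`. -/
def completeSunGraph (n : ℕ) (lam : Fin n → ℕ) :
    SimpleGraph (Fin n ⊕ ((i : Fin n) × Fin (lam i))) :=
  SimpleGraph.fromRel (sunRel n lam (fun i i' => i ≠ i'))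

/-- The spider `S(μ_1, …, μ_d)`: `d` paths (legs) `P_{μ_i}`, each joined at a leaf to a
common centre vertex. -/
def spiderGraph (d : ℕ) (mu : Fin d → ℕ) :
    SimpleGraph (Unit ⊕ ((i : Fin d) × Fin (mu i))) :=
  SimpleGraph.fromRel (fun a b => match a, b with
    | Sum.inl _, Sum.inr p => (p.2 : ℕ) = 0
    | Sum.inr p, Sum.inr q => p.1 = q.1 ∧ (q.2 : ℕ) = (p.2 : ℕ) + 1
    | _, _ => False)

/-- The graph obtained from a body graph `H` on `Fin n` by joining each body vertex `i`
by an edge to a chosen vertex `u i` of a graph `Gs i`. -/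
def attachGraph {n : ℕ} {Vs : Fin n → Type} (H : SimpleGraph (Fin n))
    (Gs : ∀ i, SimpleGraph (Vs i)) (u : ∀ i, Vs i) :
    SimpleGraph (Fin n ⊕ ((i : Fin n) × Vs i)) :=
  SimpleGraph.fromRel (fun a b => match a, b with
    | Sum.inl i, Sum.inl i' => H.Adj i i'
    | Sum.inl i, Sum.inr p => p.1 = i ∧ p.2 = u p.1
    | Sum.inr p, Sum.inr q => ∃ h : p.1 = q.1, (Gs q.1).Adj (h ▸ p.2) q.2
    | _, _ => False)

/-- `G` has a connected partition of type `μ`: a partition of the vertex set all of whose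
blocks induce connected subgraphs, the multiset of block sizes being `μ`. -/
def HasConnectedPartition {V : Type} [Fintype V] [DecidableEq V]
    (G : SimpleGraph V) (μ : Multiset ℕ) : Prop :=
  ∃ P : Finpartition (Finset.univ : Finset V),
    (∀ p ∈ P.parts, (G.induce (↑p : Set V)).Connected) ∧
      P.parts.val.map Finset.card = μ

/-- `G` has a perfect matching: a partition of `V(G)` into pairs of adjacent vertices. -/
def HasPerfectMatching {V : Type} (G : SimpleGraph V) : Prop :=
  ∃ M : G.Subgraph, M.IsPerfectMatching

/-- `G` has an almost perfect matching: a partition of `V(G)` into pairs of adjacent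
vertices together with one singleton. -/
def HasAlmostPerfectMatching {V : Type} (G : SimpleGraph V) : Prop :=
  ∃ M : G.Subgraph, M.IsMatching ∧ ∃ v : V, M.verts = {v}ᶜ

/-- The tadpole graph `T_{m,l}`: the cycle `C_m` (vertices `0, …, m-1`, consecutive edges
plus the chord `{0, m-1}`) with a path on `l` further vertices attached by an edge at
vertex `m-1`.  For `l = 0` this is just `C_m`. -/
def tadpole (m l : ℕ) : SimpleGraph (Fin (m + l)) :=
  SimpleGraph.fromRel (fun i j =>
    (j : ℕ) = (i : ℕ) + 1 ∨ ((i : ℕ) = 0 ∧ (j : ℕ) = m - 1))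

/-- Dumbbell with path-parameter `t = l + 1 ≥ 0`: vertices `0, …, m-1` form the cycle `C_m`
(consecutive edges plus chord `{0, m-1}`), vertices `m+t-1, …, m+n+t-2` form the cycle `C_n`
(consecutive edges plus chord `{m+t-1, m+n+t-2}`), and the vertices in between form the
connecting path; for `t = 0` (i.e. `l = -1`) the two cycles share the vertex `m-1`. -/
def dumbbellAux (m n t : ℕ) : SimpleGraph (Fin (m + n + t - 1)) :=
  SimpleGraph.fromRel (fun i j =>
    (j : ℕ) = (i : ℕ) + 1
      ∨ ((i : ℕ) = 0 ∧ (j : ℕ) = m - 1)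
      ∨ ((i : ℕ) = m + t - 1 ∧ (j : ℕ) = m + n + t - 2))

/-- The dumbbell graph `D(m, l, n)` for `l ≥ -1`: cycles `C_m` and `C_n` joined by a path
on `l` vertices (for `l = 1` a single joining vertex, for `l = 0` a joining edge, and for
`l = -1` the two cycles share a vertex). -/
def dumbbell (m n : ℕ) (l : ℤ) : SimpleGraph (Fin (m + n + (l + 1).toNat - 1)) :=
  dumbbellAux m n (l + 1).toNat

end
open Finset

/-- The total weight of the colourings of a path on `l` vertices joined by one of its leaves to a
vertex of colour `c`. -/
def rayWeight {C A : Type*} [Fintype C] [DecidableEq C] [CommRing A] (x : C → A) : ℕ → C → A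
  | 0, _ => 1
  | l + 1, c => ∑ d, if d ≠ c then x d * rayWeight x l d else 0

theorem sum_prod_ray {C A : Type*} [Fintype C] [DecidableEq C] [CommRing A] (x : C → A) (l : ℕ)
    (c : C) :
    (∑ g : Fin l → C, if ∀ j : Fin l, (Fin.cons c g : Fin (l + 1) → C) j.castSucc ≠ g j
      then ∏ j, x (g j) else 0) = rayWeight x l c := by
  induction l generalizing c with
  | zero => simp [rayWeight]
  | succ l ih =>
    rw [← (Fin.consEquiv fun _ : Fin (l + 1) ↦ C).sum_comp, Fintype.sum_prod_type, rayWeight]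
    refine sum_congr rfl fun d _ ↦ ?_
    rw [← ih d, Finset.mul_sum]
    by_cases h : d = c
    · subst h
      simp [Fin.consEquiv, Fin.forall_fin_succ]
    · simp only [Fin.consEquiv, Equiv.coe_fn_mk, Fin.forall_fin_succ, Fin.castSucc_zero,
        Fin.cons_zero, Fin.cons_succ, ← Fin.succ_castSucc, Fin.prod_univ_succ, ne_eq, Ne.symm h, h,
        not_false_eq_true, true_and, if_true, mul_ite, mul_zero]

theorem sunGraph_three (lam : Fin 3 → ℕ) : sunGraph 3 lam = completeSunGraph 3 lam := by
  ext u v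
  rcases u with i | p <;> rcases v with j | q <;>
    simp only [sunGraph, completeSunGraph, SimpleGraph.fromRel_adj, sunRel]
  fin_cases i <;> fin_cases j <;> simp

theorem completeSunGraph_proper_iff {C : Type*} {n : ℕ} {lam : Fin n → ℕ} (c : Fin n → C)
    (g : ∀ i, Fin (lam i) → C) :
    (∀ u v, (completeSunGraph n lam).Adj u v →
      Sum.elim c (fun p : (i : Fin n) × Fin (lam i) ↦ g p.1 p.2) u ≠
        Sum.elim c (fun p : (i : Fin n) × Fin (lam i) ↦ g p.1 p.2) v) ↔
    Function.Injective c ∧ ∀ i, ∀ j : Fin (lam i),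
      (Fin.cons (c i) (g i) : Fin (lam i + 1) → C) j.castSucc ≠ g i j := by
  constructor
  · intro h
    refine ⟨fun i j hij ↦ ?_, fun i j ↦ ?_⟩
    · by_contra hne
      exact h (.inl i) (.inl j) (by simp [completeSunGraph, sunRel, hne]) hij
    · obtain ⟨k, hk⟩ := j
      cases k with
      | zero =>
        exact h (.inl i) (.inr ⟨i, ⟨0, hk⟩⟩) (by simp [completeSunGraph, sunRel])
      | succ k =>
        exact h (.inr ⟨i, ⟨k, by omega⟩⟩) (.inr ⟨i, ⟨k + 1, hk⟩⟩)
          (by simp [completeSunGraph, sunRel])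
  · rintro ⟨hc, hg⟩
    have key : ∀ u v, sunRel n lam (fun i i' ↦ i ≠ i') u v →
        Sum.elim c (fun p : (i : Fin n) × Fin (lam i) ↦ g p.1 p.2) u ≠
          Sum.elim c (fun p : (i : Fin n) × Fin (lam i) ↦ g p.1 p.2) v := by
      rintro (i | ⟨i, p⟩) (j | ⟨j, ⟨k, hk⟩⟩) h <;> simp only [sunRel] at h
      · exact fun h' ↦ h (hc h')
      · obtain ⟨rfl, rfl⟩ := h
        exact hg j ⟨0, hk⟩
      · obtain ⟨rfl, rfl⟩ := h
        exact hg i ⟨p + 1, hk⟩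
    intro u v huv
    rw [completeSunGraph, SimpleGraph.fromRel_adj] at huv
    rcases huv.2 with h | h
    · exact key u v h
    · exact (key v u h).symm

open Classical in
theorem sum_prod_completeSunGraph {C A : Type*} [Fintype C] [CommRing A]
    (x : C → A) (n : ℕ) (lam : Fin n → ℕ) :
    (∑ κ : (Fin n ⊕ ((i : Fin n) × Fin (lam i))) → C,
      if ∀ u v, (completeSunGraph n lam).Adj u v → κ u ≠ κ v then ∏ v, x (κ v) else 0) =
    ∑ c : Fin n → C, if Function.Injective c then
      ∏ i, x (c i) * rayWeight x (lam i) (c i) else 0 := by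
  let e : (Fin n → C) × (∀ i, Fin (lam i) → C) ≃ ((Fin n ⊕ ((i : Fin n) × Fin (lam i))) → C) :=
    ((Equiv.refl _).prodCongr (Equiv.piCurry fun _ _ ↦ C).symm).trans
      (Equiv.sumArrowEquivProdArrow _ _ _).symm
  have he : ∀ c g, e (c, g) = Sum.elim c (fun p : (i : Fin n) × Fin (lam i) ↦ g p.1 p.2) :=
    fun _ _ ↦ rfl
  rw [← e.sum_comp, Fintype.sum_prod_type]
  refine sum_congr rfl fun c _ ↦ ?_
  simp only [he, completeSunGraph_proper_iff]
  by_cases hc : Function.Injective c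
  · simp only [hc, true_and, if_true, Fintype.prod_sum_type, Fintype.prod_sigma, Sum.elim_inl,
      Sum.elim_inr, ← sum_prod_ray, prod_mul_distrib]
    rw [Finset.prod_univ_sum, Fintype.piFinset_univ, Finset.mul_sum]
    refine sum_congr rfl fun g _ ↦ ?_
    rw [Finset.prod_ite_zero]
    simp
  · simp [hc]

open Classical in
theorem sum_injective_fin_three {C A : Type*} [Fintype C] [CommRing A] (u : Fin 3 → C → A) :
    (∑ c : Fin 3 → C, if Function.Injective c then ∏ i, u i (c i) else 0) =
      (∑ c, u 0 c) * (∑ c, u 1 c) * (∑ c, u 2 c) - (∑ c, u 0 c * u 1 c) * (∑ c, u 2 c)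
        - (∑ c, u 0 c * u 2 c) * (∑ c, u 1 c) - (∑ c, u 1 c * u 2 c) * (∑ c, u 0 c)
        + 2 * ∑ c, u 0 c * u 1 c * u 2 c := by
  let e : C × C × C ≃ (Fin 3 → C) :=
    { toFun := fun p ↦ ![p.1, p.2.1, p.2.2]
      invFun := fun c ↦ (c 0, c 1, c 2)
      left_inv := fun _ ↦ rfl
      right_inv := fun c ↦ by ext i; fin_cases i <;> rfl }
  have hv : ∀ a b d, e (a, b, d) = ![a, b, d] := fun _ _ _ ↦ rfl
  have he : ∀ a b d, (if Function.Injective (e (a, b, d)) then ∏ i, u i (e (a, b, d) i) else 0) =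
      u 0 a * u 1 b * u 2 d - (if a = b then u 0 a * u 1 b * u 2 d else 0)
        - (if a = d then u 0 a * u 1 b * u 2 d else 0)
        - (if b = d then u 0 a * u 1 b * u 2 d else 0)
        + (if a = b then if a = d then 2 * (u 0 a * u 1 b * u 2 d) else 0 else 0) := by
    intro a b d
    have hi : Function.Injective (e (a, b, d)) ↔ a ≠ b ∧ a ≠ d ∧ b ≠ d := by
      rw [hv]
      constructor
      · intro h
        exact ⟨fun h' ↦ by simpa using @h 0 1 h', fun h' ↦ by simpa using @h 0 2 h',
          fun h' ↦ by simpa using @h 1 2 h'⟩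
      · rintro ⟨h1, h2, h3⟩ i j hij
        fin_cases i <;> fin_cases j <;> simp at hij ⊢ <;> grind
    have hp : ∏ i, u i (e (a, b, d) i) = u 0 a * u 1 b * u 2 d := by
      simp [Fin.prod_univ_three, hv]
    rw [hp]
    simp only [hi]
    split_ifs <;> grind
  rw [← e.sum_comp]
  simp only [Fintype.sum_prod_type, he, sum_add_distrib, sum_sub_distrib]
  have h₀ : (∑ a, ∑ b, ∑ d, u 0 a * u 1 b * u 2 d) =
      (∑ c, u 0 c) * (∑ c, u 1 c) * (∑ c, u 2 c) := by
    simp only [← Finset.mul_sum, ← Finset.sum_mul]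
  have h₁ : (∑ a, ∑ b, ∑ d, if a = b then u 0 a * u 1 b * u 2 d else 0) =
      (∑ c, u 0 c * u 1 c) * (∑ c, u 2 c) := by
    rw [Finset.sum_mul_sum]
    refine sum_congr rfl fun a _ ↦ ?_
    rw [sum_comm]
    simp
  have h₂ : (∑ a, ∑ b, ∑ d, if a = d then u 0 a * u 1 b * u 2 d else 0) =
      (∑ c, u 0 c * u 2 c) * (∑ c, u 1 c) := by
    simp [Finset.sum_mul_sum, mul_right_comm]
  have h₃ : (∑ a, ∑ b, ∑ d, if b = d then u 0 a * u 1 b * u 2 d else 0) =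
      (∑ c, u 1 c * u 2 c) * (∑ c, u 0 c) := by
    rw [mul_comm, Finset.sum_mul_sum]
    simp [mul_assoc]
  have h₄ : (∑ a, ∑ b, ∑ d, if a = b then if a = d then 2 * (u 0 a * u 1 b * u 2 d) else 0
      else 0) = 2 * ∑ c, u 0 c * u 1 c * u 2 c := by
    rw [Finset.mul_sum]
    refine sum_congr rfl fun a _ ↦ ?_
    rw [sum_eq_single a (fun b _ hb ↦ by simp [hb.symm]) (by simp)]
    simp
  rw [h₀, h₁, h₂, h₃, h₄]

open Polynomial in
/-- The linear map sending `X ^ k` to `p k`. -/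
def powerSumEval {S : Type*} [CommRing S] (p : ℕ → S) : S[X] →ₗ[S] S :=
  Polynomial.lsum fun k ↦ LinearMap.mulRight S (p k)

section PowerSumEval

open Polynomial

variable {S A C : Type*} [CommRing S] [CommRing A] [Algebra S A] [Fintype C]

theorem powerSumEval_C_mul_X_pow (p : ℕ → S) (s : S) (k : ℕ) :
    powerSumEval p (Polynomial.C s * X ^ k) = s * p k := by
  rw [C_mul_X_pow_eq_monomial]
  simp [powerSumEval]

theorem algebraMap_powerSumEval {p : ℕ → S} {x : C → A}
    (hp : ∀ k, algebraMap S A (p k) = ∑ c, x c ^ k) (Q : S[X]) :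
    algebraMap S A (powerSumEval p Q) = ∑ c, aeval (x c) Q := by
  induction Q using Polynomial.induction_on' with
  | add P Q hP hQ => simp [hP, hQ, sum_add_distrib]
  | monomial k s =>
    rw [← C_mul_X_pow_eq_monomial, powerSumEval_C_mul_X_pow]
    simp [hp, Finset.mul_sum]

theorem map_powerSumEval {R : Type*} [CommRing R] (p : ℕ → S) (φ : S →+* R) (Q : S[X]) :
    φ (powerSumEval p Q) = powerSumEval (fun k ↦ φ (p k)) (Q.map φ) := by
  induction Q using Polynomial.induction_on' with
  | add P Q hP hQ => simp [hP, hQ]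
  | monomial k s =>
    rw [Polynomial.map_monomial, ← C_mul_X_pow_eq_monomial, ← C_mul_X_pow_eq_monomial,
      powerSumEval_C_mul_X_pow, powerSumEval_C_mul_X_pow, map_mul]

variable {R : Type*} [CommRing R]

/-- Modulo the first `L` power sums, a ray of length `l ≤ L` attached to a vertex of colour `c`
contributes `(-x c) ^ l`. -/
theorem exists_aeval_eq_rayWeight [DecidableEq C] {p : ℕ → S} {x : C → A}
    (hp : ∀ k, algebraMap S A (p k) = ∑ c, x c ^ k) (φ : S →+* R) {L : ℕ}
    (hφ : ∀ k, 0 < k → k ≤ L → φ (p k) = 0) (l : ℕ) (hl : l ≤ L) :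
    ∃ Q : S[X], Q.map φ = Polynomial.C ((-1) ^ l) * X ^ l ∧
      ∀ c, aeval (x c) Q = rayWeight x l c := by
  induction l with
  | zero => exact ⟨1, by simp, by simp [rayWeight]⟩
  | succ l ih =>
    obtain ⟨Q, hQ, hQx⟩ := ih (by omega)
    refine ⟨Polynomial.C (powerSumEval p (X * Q)) - X * Q, ?_, fun c ↦ ?_⟩
    · have h : X * (Polynomial.C ((-1) ^ l) * X ^ l) =
          Polynomial.C ((-1 : R) ^ l) * X ^ (l + 1) := by ring
      rw [Polynomial.map_sub, map_C, map_powerSumEval, Polynomial.map_mul, map_X, hQ, h,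
        powerSumEval_C_mul_X_pow, hφ _ l.succ_pos hl]
      simp [pow_succ]
    · rw [map_sub, aeval_C, algebraMap_powerSumEval hp, rayWeight]
      simp only [map_mul, aeval_X, hQx, ne_eq, ite_not]
      rw [sub_eq_iff_eq_add, ← Finset.sum_add_sum_compl {c}, add_comm]
      simp [Finset.sum_ite, Finset.filter_ne', Finset.compl_eq_univ_sdiff,
        Finset.sdiff_singleton_eq_erase, Finset.filter_eq']

open Classical in
theorem exists_algebraMap_eq_sum_sun {p : ℕ → S} {x : C → A}
    (hp : ∀ k, algebraMap S A (p k) = ∑ c, x c ^ k) (φ : S →+* R) {L : ℕ}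
    (hφ : ∀ k, 0 < k → k ≤ L + 1 → φ (p k) = 0) (lam : Fin 3 → ℕ) (hlam : ∀ i, lam i ≤ L) :
    ∃ s : S, algebraMap S A s = (∑ c : Fin 3 → C, if Function.Injective c then
        ∏ i, x (c i) * rayWeight x (lam i) (c i) else 0) ∧
      φ s = 2 * (-1) ^ (lam 0 + lam 1 + lam 2) * φ (p (lam 0 + lam 1 + lam 2 + 3)) := by
  choose Q hQ hQx using fun i ↦
    exists_aeval_eq_rayWeight hp φ hφ (lam i) ((hlam i).trans L.le_succ)
  have hU : ∀ i, (X * Q i).map φ = Polynomial.C ((-1) ^ lam i) * X ^ (lam i + 1) := fun i ↦ by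
    rw [Polynomial.map_mul, map_X, hQ]
    ring
  have h₀ : ∀ i, φ (powerSumEval p (X * Q i)) = 0 := fun i ↦ by
    rw [map_powerSumEval, hU, powerSumEval_C_mul_X_pow,
      hφ _ (Nat.succ_pos _) (Nat.succ_le_succ (hlam i)), mul_zero]
  let Ψ := powerSumEval p
  let U := fun i ↦ X * Q i
  refine ⟨Ψ (U 0) * Ψ (U 1) * Ψ (U 2) - Ψ (U 0 * U 1) * Ψ (U 2) - Ψ (U 0 * U 2) * Ψ (U 1)
    - Ψ (U 1 * U 2) * Ψ (U 0) + 2 * Ψ (U 0 * U 1 * U 2), ?_, ?_⟩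
  · rw [sum_injective_fin_three fun i c ↦ x c * rayWeight x (lam i) c]
    simp only [map_add, map_sub, map_mul, map_ofNat, Ψ, U, algebraMap_powerSumEval hp, aeval_X,
      hQx]
  · have h₃ : (U 0 * U 1 * U 2).map φ = Polynomial.C ((-1) ^ (lam 0 + lam 1 + lam 2)) *
        X ^ (lam 0 + lam 1 + lam 2 + 3) := by
      simp only [Polynomial.map_mul, U] at hU ⊢
      rw [hU, hU, hU]
      simp only [map_pow, map_neg, map_one]
      ring
    simp only [map_add, map_sub, map_mul, map_ofNat, Ψ, U, h₀]
    simp only [U] at h₃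
    rw [map_powerSumEval _ _ (X * Q 0 * _ * _), h₃, powerSumEval_C_mul_X_pow]
    ring

end PowerSumEval

theorem killCompl_esym (N k : ℕ) :
    MvPowerSeries.killCompl (R := ℚ) (Fin.valEmbedding (n := N)) (esym k) =
      (MvPolynomial.esymm (Fin N) ℚ k : MvPowerSeries (Fin N) ℚ) := by
  classical
  ext d
  rw [MvPowerSeries.coeff_killCompl, MvPolynomial.coeff_coe, MvPolynomial.esymm_eq_sum_monomial,
    MvPolynomial.coeff_sum]
  simp only [MvPolynomial.coeff_monomial]
  change (if _ then _ else _) = _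
  have hs : ∀ (t : Finset (Fin N)) i, (∑ j ∈ t, Finsupp.single j 1) i = if i ∈ t then 1 else 0 := by
    intro t i
    simp [Finsupp.finsetSum_apply, Finsupp.single_apply]
  have hd : ∀ t ∈ powersetCard k (univ : Finset (Fin N)),
      (∑ i ∈ t, Finsupp.single i 1 = d ↔ t = d.support ∧
        ((∀ i ∈ d.support, d i = 1) ∧ (d.sum fun _ v ↦ v) = k)) := by
    intro t ht
    have htk := (mem_powersetCard.1 ht).2
    constructor
    · rintro rfl
      have : (∑ j ∈ t, Finsupp.single j 1).support = t := by
        ext i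
        simp [hs]
      refine ⟨this.symm, fun i hi ↦ ?_, ?_⟩
      · rw [hs, if_pos (this ▸ hi)]
      · rw [Finsupp.sum, this, ← htk, card_eq_sum_ones]
        exact sum_congr rfl fun i hi ↦ by rw [hs, if_pos hi]
    · rintro ⟨rfl, h1, -⟩
      ext i
      rw [hs]
      split_ifs with hi
      · exact (h1 i hi).symm
      · exact (Finsupp.notMem_support_iff.1 hi).symm
  rw [sum_congr rfl fun t ht ↦ if_congr (hd t ht) rfl rfl]
  have he : ((∀ i ∈ (Finsupp.embDomain Fin.valEmbedding d).support,
      Finsupp.embDomain Fin.valEmbedding d i = 1) ∧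
      ((Finsupp.embDomain Fin.valEmbedding d).sum fun _ v ↦ v) = k) ↔
      ((∀ i ∈ d.support, d i = 1) ∧ (d.sum fun _ v ↦ v) = k) := by
    rw [Finsupp.sum_embDomain, Finsupp.support_embDomain]
    simp only [mem_map, forall_exists_index, and_imp, forall_apply_eq_imp_iff₂,
      Finsupp.embDomain_apply_self]
  by_cases h : (∀ i ∈ d.support, d i = 1) ∧ (d.sum fun _ v ↦ v) = k
  · rw [if_pos (he.2 h)]
    rw [sum_congr rfl fun t _ ↦ if_congr (and_iff_left h) rfl rfl, sum_ite_eq', if_pos]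
    refine mem_powersetCard.2 ⟨subset_univ _, ?_⟩
    rw [← h.2, Finsupp.sum, card_eq_sum_ones]
    exact sum_congr rfl fun i hi ↦ (h.1 i hi).symm
  · rw [if_neg (mt he.1 h), sum_eq_zero fun t _ ↦ if_neg fun ht ↦ h ht.2]

open Classical in
theorem killCompl_csf {V : Type} [Fintype V] (G : SimpleGraph V) (N : ℕ) :
    MvPowerSeries.killCompl (R := ℚ) (Fin.valEmbedding (n := N)) (csf G) =
      ((∑ κ : V → Fin N, if ∀ u v, G.Adj u v → κ u ≠ κ v then ∏ v, MvPolynomial.X (κ v) else 0 :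
        MvPolynomial (Fin N) ℚ) : MvPowerSeries (Fin N) ℚ) := by
  ext d
  rw [MvPowerSeries.coeff_killCompl, MvPolynomial.coeff_coe, MvPolynomial.coeff_sum]
  have hX : ∀ κ : V → Fin N, (∏ v, MvPolynomial.X (κ v) : MvPolynomial (Fin N) ℚ) =
      MvPolynomial.monomial (∑ v, Finsupp.single (κ v) 1) 1 := fun κ ↦ by
    rw [MvPolynomial.monomial_sum_one]
    rfl
  have hd : ∀ κ : V → Fin N, ∑ v, Finsupp.single (κ v) 1 = d ↔
      ∀ i, Nat.card {v : V // κ v = i} = d i := fun κ ↦ by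
    rw [Finsupp.ext_iff]
    refine forall_congr' fun i ↦ ?_
    rw [Finsupp.finsetSum_apply, Nat.card_eq_fintype_card, Fintype.card_subtype, card_filter]
    simp only [Finsupp.single_apply]
  simp only [hX, apply_ite (MvPolynomial.coeff d), MvPolynomial.coeff_monomial, hd,
    MvPolynomial.coeff_zero, ← ite_and]
  rw [sum_boole, ← Fintype.card_subtype, ← Nat.card_eq_fintype_card]
  change (Nat.card _ : ℚ) = _
  congr 1
  symm
  refine Nat.card_congr (Equiv.ofBijective (fun κ ↦ ⟨fun v ↦ (κ.1 v : ℕ), ?_, ?_⟩) ⟨?_, ?_⟩)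
  · exact fun u v huv h ↦ κ.2.1 u v huv (Fin.ext h)
  · intro i
    by_cases hi : i < N
    · have := κ.2.2 ⟨i, hi⟩
      have h2 := Finsupp.embDomain_apply_self (Fin.valEmbedding (n := N)) d ⟨i, hi⟩
      rw [Fin.valEmbedding_apply] at h2
      rw [h2, ← this]
      simp only [Fin.ext_iff]
    · rw [Finsupp.embDomain_of_notMem_range _ _ _ (by rintro ⟨j, rfl⟩; exact hi j.2)]
      refine Nat.card_eq_zero.2 (.inl ⟨fun v ↦ hi ?_⟩)
      rw [← v.2]
      exact (κ.1 v).2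
  · intro κ κ' h
    ext v
    exact congr_fun (Subtype.ext_iff.1 h) v
  · rintro ⟨κ, h1, h2⟩
    have hκ : ∀ v, κ v < N := by
      intro v
      by_contra hv
      have := h2 (κ v)
      rw [Finsupp.embDomain_of_notMem_range _ _ _ (by rintro ⟨j, hj⟩; exact hv (hj ▸ j.2)),
        Nat.card_eq_zero] at this
      rcases this with h | h
      · exact h.elim ⟨v, rfl⟩
      · exact h.not_finite inferInstance
    refine ⟨⟨fun v ↦ ⟨κ v, hκ v⟩, fun u v huv h ↦ h1 u v huv (Fin.ext_iff.1 h), fun i ↦ ?_⟩, rfl⟩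
    have := h2 i
    have h3 := Finsupp.embDomain_apply_self (Fin.valEmbedding (n := N)) d i
    rw [Fin.valEmbedding_apply] at h3
    rw [h3] at this
    rw [← this]
    simp only [Fin.ext_iff]

section SymmetricSubalgebra

variable (N : ℕ)

/-- The elementary symmetric polynomial, as an element of the ring of symmetric polynomials. -/
noncomputable def symEsymm (k : ℕ) : MvPolynomial.symmetricSubalgebra (Fin N) ℚ :=
  ⟨MvPolynomial.esymm (Fin N) ℚ k, MvPolynomial.esymm_isSymmetric _ _ _⟩

/-- The power sum, as an element of the ring of symmetric polynomials. -/
noncomputable def symPsum (k : ℕ) : MvPolynomial.symmetricSubalgebra (Fin N) ℚ :=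
  ⟨MvPolynomial.psum (Fin N) ℚ k, MvPolynomial.psum_isSymmetric _ _ _⟩

/-- The values of a homomorphism on symmetric polynomials in `N` variables can be prescribed on
`e_1, …, e_N`. -/
theorem exists_algHom_symEsymm {R : Type*} [CommRing R] [Algebra ℚ R] (E : ℕ → R) (h0 : E 0 = 1)
    (hN : ∀ k, N < k → E k = 0) :
    ∃ φ : MvPolynomial.symmetricSubalgebra (Fin N) ℚ →ₐ[ℚ] R, ∀ k, φ (symEsymm N k) = E k := by
  refine ⟨(MvPolynomial.aeval fun i : Fin N ↦ E (i + 1)).comp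
    (MvPolynomial.esymmAlgEquiv (Fin N) ℚ (Fintype.card_fin N)).symm.toAlgHom, fun k ↦ ?_⟩
  rcases k with _ | k
  · have : symEsymm N 0 = 1 := Subtype.ext (MvPolynomial.esymm_zero (Fin N) ℚ)
    rw [this, map_one, h0]
  · by_cases hk : k < N
    · have h := MvPolynomial.esymmAlgEquiv_symm_apply (R := ℚ) (Fintype.card_fin N) ⟨k, hk⟩
      change MvPolynomial.aeval _ ((MvPolynomial.esymmAlgEquiv (Fin N) ℚ (Fintype.card_fin N)).symm
        ⟨MvPolynomial.esymm (Fin N) ℚ ((⟨k, hk⟩ : Fin N) + 1), _⟩) = _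
      rw [h, MvPolynomial.aeval_X]
    · have : symEsymm N (k + 1) = 0 := by
        refine Subtype.ext ?_
        change MvPolynomial.esymm (Fin N) ℚ (k + 1) = 0
        rw [MvPolynomial.esymm,
          powersetCard_eq_empty.2 (by simpa using Nat.lt_succ_of_le (not_lt.1 hk)), sum_empty]
      rw [this, map_zero, hN _ (by omega)]

theorem symPsum_eq (k : ℕ) (hk : 0 < k) :
    symPsum N k = (-1) ^ (k + 1) * k * symEsymm N k -
      ∑ a ∈ antidiagonal k with a.1 ∈ Set.Ioo 0 k, (-1) ^ a.1 * symEsymm N a.1 * symPsum N a.2 := by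
  refine Subtype.ext ?_
  have := MvPolynomial.psum_eq_mul_esymm_sub_sum (Fin N) ℚ k hk
  simpa [symPsum, symEsymm] using this

theorem algebraMap_symPsum (k : ℕ) :
    algebraMap (MvPolynomial.symmetricSubalgebra (Fin N) ℚ) (MvPolynomial (Fin N) ℚ)
      (symPsum N k) = ∑ i, MvPolynomial.X i ^ k := rfl

end SymmetricSubalgebra

section Newton

variable {a b : ℕ}

/-- The generic values of the `e_k` once all of them but `e_0`, `e_a` and `e_b` vanish. -/
noncomputable def pairE (a b k : ℕ) : MvPolynomial ℕ ℚ :=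
  if k = 0 then 1 else if k = a ∨ k = b then MvPolynomial.X k else 0

/-- Newton's identities between `P` and `pairE a b`. -/
def NewtonPair (a b : ℕ) (P : ℕ → MvPolynomial ℕ ℚ) : Prop :=
  ∀ k, 0 < k → P k = (-1) ^ (k + 1) * k * pairE a b k -
    ∑ x ∈ antidiagonal k with x.1 ∈ Set.Ioo 0 k, (-1) ^ x.1 * pairE a b x.1 * P x.2

variable {P : ℕ → MvPolynomial ℕ ℚ}

theorem powerSum_eq_zero_of_lt (hP : NewtonPair a b P) {k : ℕ} (hk : 0 < k) (ha : k < a)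
    (hb : k < b) : P k = 0 := by
  rw [hP k hk, pairE, if_neg hk.ne', if_neg (by omega), mul_zero, zero_sub, neg_eq_zero]
  refine sum_eq_zero fun x hx ↦ ?_
  simp only [mem_filter, HasAntidiagonal.mem_antidiagonal, Set.mem_Ioo] at hx
  rw [pairE, if_neg hx.2.1.ne', if_neg (by omega), mul_zero, zero_mul]

theorem powerSum_eq_of_le (hP : NewtonPair a b P) (hb0 : 0 < b) (hba : b ≤ a) : 
    P b = (-1) ^ (b + 1) * (b : MvPolynomial ℕ ℚ) * MvPolynomial.X b := by
  rw [hP b hb0, pairE, if_neg hb0.ne', if_pos (.inr rfl), sub_eq_self]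
  refine sum_eq_zero fun x hx ↦ ?_
  simp only [mem_filter, HasAntidiagonal.mem_antidiagonal, Set.mem_Ioo] at hx
  rw [pairE, if_neg hx.2.1.ne', if_neg (by omega), mul_zero, zero_mul]

theorem powerSum_add_self (hP : NewtonPair a b P) (ha0 : 0 < a) (hab : a = b) :
    P (a + a) = (a : MvPolynomial ℕ ℚ) * (MvPolynomial.X a * MvPolynomial.X a) := by
  subst hab
  have ha := powerSum_eq_of_le hP ha0 le_rfl
  rw [hP _ (by omega), sum_eq_single (a, a)]
  · rw [ha, pairE, if_neg (by omega), if_neg (by omega), pairE, if_neg ha0.ne', if_pos (.inl rfl)]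
    have h : ((-1 : MvPolynomial ℕ ℚ) ^ a) * (-1) ^ a = 1 := by rw [← mul_pow]; simp
    linear_combination
      ((a : MvPolynomial ℕ ℚ) * (MvPolynomial.X a * MvPolynomial.X a)) * h
  · intro x hx hne
    simp only [mem_filter, HasAntidiagonal.mem_antidiagonal, Set.mem_Ioo] at hx
    rw [pairE, if_neg hx.2.1.ne', if_neg, mul_zero, zero_mul]
    intro h
    exact hne (Prod.ext (by simp; omega) (by simp; omega))
  · intro h
    simp only [mem_filter, HasAntidiagonal.mem_antidiagonal, Set.mem_Ioo, true_and] at h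
    omega

theorem powerSum_add_of_lt (hP : NewtonPair a b P) (hb0 : 0 < b) (hba : b < a) :
    P (a + b) = (-1) ^ (a + b) * ((a + b : ℕ) : MvPolynomial ℕ ℚ) *
      (MvPolynomial.X a * MvPolynomial.X b) +
      MvPolynomial.X b * (MvPolynomial.X b * P (a - b)) := by
  have ha : P a = (-1) ^ (a + 1) * (a : MvPolynomial ℕ ℚ) * MvPolynomial.X a -
      (-1) ^ b * MvPolynomial.X b * P (a - b) := by
    rw [hP a (by omega), sum_eq_single (b, a - b)]
    · simp only [pairE, if_neg (show a ≠ 0 by omega), if_neg hb0.ne', true_or, or_true, if_true]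
    · intro x hx hne
      simp only [mem_filter, HasAntidiagonal.mem_antidiagonal, Set.mem_Ioo] at hx
      rw [pairE, if_neg hx.2.1.ne', if_neg, mul_zero, zero_mul]
      intro h
      exact hne (Prod.ext (by simp; omega) (by simp; omega))
    · intro h
      simp only [mem_filter, HasAntidiagonal.mem_antidiagonal, Set.mem_Ioo] at h
      omega
  have hb := powerSum_eq_of_le hP hb0 hba.le
  rw [hP _ (by omega), sum_eq_add (a, b) (b, a) (by simp; omega)]
  · have h : ((-1 : MvPolynomial ℕ ℚ) ^ b) * (-1) ^ b = 1 := by rw [← mul_pow]; simp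
    simp only [pairE, if_neg (show a ≠ 0 by omega), if_neg hb0.ne', true_or, or_true, if_true,
      if_neg (show a + b ≠ 0 by omega), if_neg (show ¬ (a + b = a ∨ a + b = b) by omega)]
    rw [ha, hb]
    push_cast
    linear_combination (MvPolynomial.X b * (MvPolynomial.X b * P (a - b))) * h
  · intro x hx hne
    simp only [mem_filter, HasAntidiagonal.mem_antidiagonal, Set.mem_Ioo] at hx
    rw [pairE, if_neg hx.2.1.ne', if_neg, mul_zero, zero_mul]
    rintro (h | h)
    · exact hne.1 (Prod.ext h (by simp; omega))
    · exact hne.2 (Prod.ext h (by simp; omega))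
  · intro h
    simp only [mem_filter, HasAntidiagonal.mem_antidiagonal, Set.mem_Ioo, true_and] at h
    omega
  · intro h
    simp only [mem_filter, HasAntidiagonal.mem_antidiagonal, Set.mem_Ioo] at h
    omega

theorem coeff_powerSum_add (hP : NewtonPair a b P) (hb0 : 0 < b) (hba : b ≤ a) :
    MvPolynomial.coeff (Finsupp.single a 1 + Finsupp.single b 1) (P (a + b)) =
      if a = b then (a : ℚ) else (-1) ^ (a + b) * (a + b : ℕ) := by
  have hXX : MvPolynomial.coeff (Finsupp.single a 1 + Finsupp.single b 1)
      (MvPolynomial.X a * MvPolynomial.X b : MvPolynomial ℕ ℚ) = 1 := by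
    rw [MvPolynomial.coeff_mul_X, MvPolynomial.coeff_X, if_pos rfl]
  split_ifs with hab
  · subst hab
    rw [powerSum_add_self hP hb0 rfl, ← map_natCast MvPolynomial.C, MvPolynomial.coeff_C_mul, hXX,
      mul_one]
  · have hc : ((-1) ^ (a + b) * ((a + b : ℕ) : MvPolynomial ℕ ℚ)) =
        MvPolynomial.C ((-1) ^ (a + b) * ((a + b : ℕ) : ℚ)) := by
      simp
    rw [powerSum_add_of_lt hP hb0 (lt_of_le_of_ne hba (Ne.symm hab)), MvPolynomial.coeff_add, hc,
      MvPolynomial.coeff_C_mul, hXX, mul_one, add_comm (Finsupp.single a 1),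
      MvPolynomial.coeff_X_mul, MvPolynomial.coeff_X_mul',
      if_neg (by simp [Ne.symm hab]), add_zero]

end Newton

theorem coeff_prod_pairE {a b : ℕ} (μ : Multiset ℕ) (hμ : 0 ∉ μ) :
    MvPolynomial.coeff (Finsupp.single a 1 + Finsupp.single b 1) (μ.map (pairE a b)).prod =
      if μ = {a, b} then 1 else 0 := by
  by_cases h : ∀ k ∈ μ, k = a ∨ k = b
  · have h1 : μ.map (pairE a b) = μ.map MvPolynomial.X := by
      refine Multiset.map_congr rfl fun k hk ↦ ?_
      rw [pairE, if_neg (ne_of_mem_of_not_mem hk hμ), if_pos (h k hk)]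
    have h2 : ∀ ν : Multiset ℕ, (ν.map MvPolynomial.X).prod =
        MvPolynomial.monomial (Multiset.toFinsupp ν) (1 : ℚ) := by
      intro ν
      induction ν using Multiset.induction_on with
      | empty => simp
      | cons k ν ih =>
        rw [Multiset.map_cons, Multiset.prod_cons, ih, ← Multiset.singleton_add, map_add,
          Multiset.toFinsupp_singleton, MvPolynomial.X, MvPolynomial.monomial_mul, one_mul]
    have h3 : Finsupp.single a 1 + Finsupp.single b 1 = Multiset.toFinsupp {a, b} := by
      rw [Multiset.insert_eq_cons, ← Multiset.singleton_add, map_add,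
        Multiset.toFinsupp_singleton, Multiset.toFinsupp_singleton]
    rw [h1, h2, h3, MvPolynomial.coeff_monomial]
    simp only [EmbeddingLike.apply_eq_iff_eq]
  · push Not at h
    obtain ⟨k, hk, hka, hkb⟩ := h
    rw [Multiset.prod_eq_zero, MvPolynomial.coeff_zero, if_neg]
    · rintro rfl
      simp at hk
      omega
    · refine Multiset.mem_map.2 ⟨k, hk, ?_⟩
      rw [pairE, if_neg (ne_of_mem_of_not_mem hk hμ), if_neg (by simp [hka, hkb])]

/-- A homomorphism on symmetric polynomials turns an `e`-expansion of a power series into an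
identity in its target. -/
theorem map_eq_sum_of_killCompl {N : ℕ} {R : Type*} [CommRing R] [Algebra ℚ R]
    (φ : MvPolynomial.symmetricSubalgebra (Fin N) ℚ →ₐ[ℚ] R) {f : MvPowerSeries ℕ ℚ}
    {c : Multiset ℕ →₀ ℚ} (hf : f = c.sum fun μ r ↦ r • esymM μ)
    {s : MvPolynomial.symmetricSubalgebra (Fin N) ℚ}
    (hs : MvPowerSeries.killCompl (R := ℚ) (Fin.valEmbedding (n := N)) f =
      ((s : MvPolynomial (Fin N) ℚ) : MvPowerSeries (Fin N) ℚ)) :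
    φ s = c.sum fun μ r ↦ r • (μ.map fun k ↦ φ (symEsymm N k)).prod := by
  have hμ : ∀ μ, MvPowerSeries.killCompl (R := ℚ) (Fin.valEmbedding (n := N)) (esymM μ) =
      (((μ.map (symEsymm N)).prod : MvPolynomial.symmetricSubalgebra (Fin N) ℚ) :
        MvPolynomial (Fin N) ℚ) := fun μ ↦ by
    induction μ using Multiset.induction_on with
    | empty => simp [esymM]
    | cons k μ ih =>
      have : esymM (k ::ₘ μ) = esym k * esymM μ := by simp [esymM]
      rw [this, map_mul, ih, killCompl_esym, Multiset.map_cons, Multiset.prod_cons]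
      simp [symEsymm]
  have h : s = c.sum fun μ r ↦ r • (μ.map (symEsymm N)).prod := by
    refine Subtype.ext (MvPolynomial.coe_injective (Fin N) ℚ ?_)
    rw [← hs, hf, Finsupp.sum, Finsupp.sum, map_sum, AddSubmonoidClass.coe_finsetSum]
    change _ = MvPolynomial.coeToMvPowerSeries.ringHom _
    rw [map_sum]
    refine sum_congr rfl fun μ _ ↦ ?_
    rw [map_smul, hμ]
    exact (MvPolynomial.coe_smul _ _).symm
  rw [h, Finsupp.sum, Finsupp.sum, map_sum]
  refine sum_congr rfl fun μ _ ↦ ?_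
  rw [map_smul, map_multiset_prod, Multiset.map_map]
  rfl

/-- If `λ_1 = max{λ_1, λ_2, λ_3}` and `λ_1 < λ_2 + λ_3`, then
`[e_{(λ_2+λ_3+1, λ_1+2)}] X_{S(3; λ_1, λ_2, λ_3)}` equals `-2(λ_1+λ_2+λ_3+3)` when
`λ_2 + λ_3 ≠ λ_1 + 1`, and `-(λ_1+λ_2+λ_3+3)` when `λ_2 + λ_3 = λ_1 + 1`. -/
theorem sun3_eCoeff (l₁ l₂ l₃ : ℕ) (h₁ : 0 < l₁) (h₂ : 0 < l₂) (h₃ : 0 < l₃)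
    (hmax₂ : l₂ ≤ l₁) (hmax₃ : l₃ ≤ l₁) (hlt : l₁ < l₂ + l₃) :
    ∀ c : Multiset ℕ →₀ ℚ, (∀ μ ∈ c.support, 0 ∉ μ) →
      csf (sunGraph 3 ![l₁, l₂, l₃]) = (c.sum fun μ a => a • esymM μ) →
      (l₂ + l₃ ≠ l₁ + 1 →
        c {l₂ + l₃ + 1, l₁ + 2} = -2 * (l₁ + l₂ + l₃ + 3)) ∧
      (l₂ + l₃ = l₁ + 1 →
        c {l₂ + l₃ + 1, l₁ + 2} = -(l₁ + l₂ + l₃ + 3)) := by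
  classical
  intro c hc hcsf
  let a := l₂ + l₃ + 1
  let b := l₁ + 2
  have hb0 : 0 < b := by omega
  have hba : b ≤ a := by omega
  obtain ⟨φ, hφ⟩ := exists_algHom_symEsymm (a + b) (pairE a b) (if_pos rfl) fun k hk ↦ by
    rw [pairE, if_neg (by omega), if_neg (by omega)]
  have hP : NewtonPair a b fun k ↦ φ (symPsum (a + b) k) := fun k hk ↦ by
    dsimp only
    rw [symPsum_eq _ k hk]
    simp only [map_sub, map_mul, map_pow, map_neg, map_one, map_natCast, map_sum, hφ]
  obtain ⟨s, hs, hφs⟩ := exists_algebraMap_eq_sum_sun (algebraMap_symPsum (a + b))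
    (φ : _ →+* MvPolynomial ℕ ℚ) (L := l₁)
    (fun k hk hkL ↦ powerSum_eq_zero_of_lt hP hk (by omega) (by omega)) ![l₁, l₂, l₃]
    (fun i ↦ by fin_cases i <;> simp [hmax₂, hmax₃])
  have hkill : MvPowerSeries.killCompl (R := ℚ) (Fin.valEmbedding (n := a + b))
      (csf (sunGraph 3 ![l₁, l₂, l₃])) =
      ((s : MvPolynomial (Fin (a + b)) ℚ) : MvPowerSeries (Fin (a + b)) ℚ) := by
    rw [killCompl_csf, sunGraph_three]
    congr 1
    refine Eq.trans ?_ ((sum_prod_completeSunGraph MvPolynomial.X 3 ![l₁, l₂, l₃]).trans hs.symm)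
    convert rfl
  have key := congr_arg (MvPolynomial.coeff (Finsupp.single a 1 + Finsupp.single b 1))
    (map_eq_sum_of_killCompl φ hcsf hkill)
  have hsum : MvPolynomial.coeff (Finsupp.single a 1 + Finsupp.single b 1)
      (c.sum fun μ r ↦ r • (μ.map fun k ↦ φ (symEsymm (a + b) k)).prod) = c {a, b} := by
    rw [Finsupp.sum, MvPolynomial.coeff_sum]
    have : ∀ μ ∈ c.support, MvPolynomial.coeff (Finsupp.single a 1 + Finsupp.single b 1)
        (c μ • (μ.map fun k ↦ φ (symEsymm (a + b) k)).prod) =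
        if μ = {a, b} then c μ else 0 := fun μ hμ ↦ by
      simp only [hφ, MvPolynomial.coeff_smul]
      rw [coeff_prod_pairE μ (hc μ hμ)]
      simp
    rw [sum_congr rfl this, sum_ite_eq']
    simp +contextual [eq_comm]
  have hN : l₁ + l₂ + l₃ + 3 = a + b := by omega
  have hφs' : φ s = MvPolynomial.C (2 * (-1) ^ (l₁ + l₂ + l₃)) * φ (symPsum (a + b) (a + b)) := by
    have h2 : (MvPolynomial.C 2 : MvPolynomial ℕ ℚ) = 2 := map_ofNat _ 2
    simpa [hN, h2] using hφs
  rw [hsum, hφs', MvPolynomial.coeff_C_mul, coeff_powerSum_add hP hb0 hba] at key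
  have hcast : (l₁ + l₂ + l₃ + 3 : ℚ) = (a + b : ℕ) := by rw [← hN]; push_cast; ring
  have hsign : (-1 : ℚ) ^ (l₁ + l₂ + l₃) * (-1) ^ (a + b) = -1 := by
    rw [← hN, ← pow_add]
    exact Odd.neg_one_pow ⟨l₁ + l₂ + l₃ + 1, by ring⟩
  refine ⟨fun h ↦ ?_, fun h ↦ ?_⟩
  · rw [hcast, ← key, if_neg (by omega)]
    linear_combination (2 * ((a + b : ℕ) : ℚ)) * hsign
  · have hab : a = b := by omega
    have hodd : (-1 : ℚ) ^ (l₁ + l₂ + l₃) = -1 :=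
      Odd.neg_one_pow ⟨l₁, by omega⟩
    rw [hcast, ← key, if_pos hab, hodd, ← hab]
    push_cast
    ring
end

section
/- For all positive integers a and b, the chromatic symmetric functions satisfy X_{S(3; a, b, b)} = 2·X_{S(a+1, b+1, b)} − X_{P_{2b+2}}·X_{P_{a+1}}, where S(3; a, b, b) is the sun graph, S(a+1, b+1, b) is the spider with three legs of lengths a+1, b+1, b, and P_k is the path on k vertices. In particular, if S(3; a, b, b) is e-positive, then the spider S(a+1, b+1, b) is also e-positive. -/
noncomputable section

/-- The content of a colouring: the exponent vector of its monomial. -/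
def colourContent {V : Type} [Fintype V] (κ : V → ℕ) : ℕ →₀ ℕ :=
  ∑ v, Finsupp.single (κ v) 1

/-- The generating function of the colourings that satisfy a predicate. -/
def colourGF {V : Type} [Fintype V] (Q : (V → ℕ) → Prop) : MvPowerSeries ℕ ℚ :=
  fun d => (Nat.card {κ : V → ℕ // Q κ ∧ colourContent κ = d} : ℚ)

section ColourGF

variable {V W : Type} [Fintype V] [Fintype W]

theorem colourContent_apply (κ : V → ℕ) (i : ℕ) :
    colourContent κ i = Nat.card {v : V // κ v = i} := by
  classical
  simp [colourContent, Finsupp.finsetSum_apply, Finsupp.single_apply, Fintype.card_subtype]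

theorem colourContent_comp_equiv (e : W ≃ V) (κ : V → ℕ) :
    colourContent (κ ∘ e) = colourContent κ :=
  e.sum_comp fun v => Finsupp.single (κ v) 1

theorem colourContent_sum (κ : V ⊕ W → ℕ) :
    colourContent κ = colourContent (κ ∘ Sum.inl) + colourContent (κ ∘ Sum.inr) := by
  simp [colourContent]

theorem finite_colourContent_eq (d : ℕ →₀ ℕ) :
    {κ : V → ℕ | colourContent κ = d}.Finite := by
  refine (Set.Finite.pi' fun _ : V => d.support.finite_toSet).subset ?_
  rintro κ rfl v
  simp [colourContent_apply]

instance finite_colourings (Q : (V → ℕ) → Prop) (d : ℕ →₀ ℕ) :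
    Finite {κ : V → ℕ // Q κ ∧ colourContent κ = d} :=
  ((finite_colourContent_eq d).subset fun _ h => h.2).to_subtype

theorem csf_eq_colourGF (G : SimpleGraph V) :
    csf G = colourGF fun κ : V → ℕ => ∀ u v, G.Adj u v → κ u ≠ κ v := by
  funext d
  simp only [csf, colourGF, DFunLike.ext_iff, colourContent_apply]

theorem csf_fromRel (r : V → V → Prop) (hr : ∀ v, ¬ r v v) :
    csf (SimpleGraph.fromRel r) = colourGF fun κ : V → ℕ => ∀ u v, r u v → κ u ≠ κ v := by
  rw [csf_eq_colourGF]
  congr 1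
  ext κ
  refine ⟨fun h u v huv => h u v ⟨?_, Or.inl huv⟩, ?_⟩
  · rintro rfl
    exact hr _ huv
  · rintro h u v ⟨-, huv | hvu⟩
    exacts [h u v huv, (h v u hvu).symm]

theorem colourGF_of_bijective {Q : (V → ℕ) → Prop} {R : (W → ℕ) → Prop} (g : W → V)
    (hg : g.Bijective) (h : ∀ κ, Q κ ↔ R (κ ∘ g)) : colourGF Q = colourGF R := by
  funext d
  let e := Equiv.ofBijective g hg
  refine congrArg Nat.cast (Nat.card_congr
    ((e.symm.arrowCongr (Equiv.refl ℕ)).subtypeEquiv fun κ => ?_))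
  have : e.symm.arrowCongr (Equiv.refl ℕ) κ = κ ∘ g := rfl
  rw [this, ← h, show κ ∘ g = κ ∘ e from rfl, colourContent_comp_equiv]

theorem colourGF_split (Q R : (V → ℕ) → Prop) :
    colourGF Q = colourGF (fun κ => Q κ ∧ R κ) + colourGF fun κ => Q κ ∧ ¬ R κ := by
  classical
  funext d
  change (_ : ℚ) = Nat.cast _ + Nat.cast _
  rw [← Nat.cast_add, ← Nat.card_sum]
  refine congrArg Nat.cast (Nat.card_congr ?_)
  refine (Equiv.sumCompl fun κ : {κ : V → ℕ // Q κ ∧ colourContent κ = d} => R κ).symm.trans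
    (Equiv.sumCongr ?_ ?_)
  · exact (Equiv.subtypeSubtypeEquivSubtypeInter _ R).trans
      (Equiv.subtypeEquivRight fun κ => and_right_comm)
  · exact (Equiv.subtypeSubtypeEquivSubtypeInter _ fun κ => ¬ R κ).trans
      (Equiv.subtypeEquivRight fun κ => and_right_comm)

theorem colourGF_false {Q : (V → ℕ) → Prop} (h : ∀ κ, ¬ Q κ) : colourGF Q = 0 := by
  funext d
  change Nat.cast _ = (0 : ℚ)
  simp [h]

theorem colourGF_mul (Q : (V → ℕ) → Prop) (R : (W → ℕ) → Prop) :
    colourGF Q * colourGF R =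
      colourGF fun κ : V ⊕ W → ℕ => Q (κ ∘ Sum.inl) ∧ R (κ ∘ Sum.inr) := by
  classical
  ext d
  rw [MvPowerSeries.coeff_mul]
  change ∑ p ∈ _, (Nat.cast _ * Nat.cast _ : ℚ) = Nat.cast _
  simp only [← Nat.cast_mul, ← Nat.cast_sum, ← Nat.card_prod]
  rw [← Finset.sum_coe_sort, ← Nat.card_sigma]
  refine congrArg Nat.cast (Nat.card_congr ?_)
  exact
    { toFun := fun x => ⟨Sum.elim x.2.1.1 x.2.2.1, ⟨x.2.1.2.1, x.2.2.2.1⟩, by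
        rw [colourContent_sum, Sum.elim_comp_inl, Sum.elim_comp_inr, x.2.1.2.2, x.2.2.2.2]
        exact Finset.HasAntidiagonal.mem_antidiagonal.1 x.1.2⟩
      invFun := fun κ => ⟨⟨(colourContent (κ.1 ∘ Sum.inl), colourContent (κ.1 ∘ Sum.inr)), by
        rw [Finset.HasAntidiagonal.mem_antidiagonal, ← colourContent_sum, κ.2.2]⟩,
        ⟨κ.1 ∘ Sum.inl, κ.2.1.1, rfl⟩, ⟨κ.1 ∘ Sum.inr, κ.2.1.2, rfl⟩⟩
      left_inv := by
        rintro ⟨⟨⟨p, q⟩, hpq⟩, ⟨f, hf, hfp⟩, ⟨g, hg, hgq⟩⟩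
        dsimp only at hfp hgq
        subst hfp hgq
        rfl
      right_inv := fun κ => Subtype.ext (Sum.elim_comp_inl_inr κ.1) }

end ColourGF

section EPositive

theorem ePositive_smul_esymM {a : ℚ} (ha : 0 ≤ a) {μ : Multiset ℕ} (hμ : 0 ∉ μ) :
    EPositive (a • esymM μ) := by
  classical
  refine ⟨Finsupp.single μ a, fun ν => ?_, fun ν hν => ?_, ?_⟩
  · rw [Finsupp.single_apply]
    split_ifs <;> simp [ha]
  · rwa [Finset.mem_singleton.1 (Finsupp.support_single_subset hν)]
  · simp

theorem ePositive_esym_succ (k : ℕ) : EPositive (esym (k + 1)) := by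
  simpa [esymM] using ePositive_smul_esymM (zero_le_one (α := ℚ)) (μ := {k + 1}) (by simp)

theorem EPositive.add {f g : MvPowerSeries ℕ ℚ} (hf : EPositive f) (hg : EPositive g) :
    EPositive (f + g) := by
  classical
  obtain ⟨c, hc, hc0, rfl⟩ := hf
  obtain ⟨c', hc', hc0', rfl⟩ := hg
  refine ⟨c + c', fun μ => add_nonneg (hc μ) (hc' μ), fun μ hμ => ?_, ?_⟩
  · exact (Finset.mem_union.1 (Finsupp.support_add hμ)).elim (hc0 μ) (hc0' μ)
  · rw [Finsupp.sum_add_index'] <;> simp [add_smul]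

theorem EPositive.sum {ι : Type*} (s : Finset ι) (f : ι → MvPowerSeries ℕ ℚ)
    (h : ∀ i ∈ s, EPositive (f i)) : EPositive (∑ i ∈ s, f i) :=
  Finset.sum_induction f EPositive (fun _ _ => EPositive.add)
    ⟨0, by simp⟩ h

theorem EPositive.mul {f g : MvPowerSeries ℕ ℚ} (hf : EPositive f) (hg : EPositive g) :
    EPositive (f * g) := by
  obtain ⟨c, hc, hc0, rfl⟩ := hf
  obtain ⟨c', hc', hc0', rfl⟩ := hg
  rw [Finsupp.sum, Finsupp.sum, Finset.sum_mul_sum]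
  refine EPositive.sum _ _ fun μ hμ => EPositive.sum _ _ fun ν hν => ?_
  rw [smul_mul_smul_comm, esymM, esymM, ← Multiset.prod_add, ← Multiset.map_add]
  exact ePositive_smul_esymM (mul_nonneg (hc μ) (hc' ν))
    fun h => (Multiset.mem_add.1 h).elim (hc0 μ hμ) (hc0' ν hν)

theorem EPositive.smul {f : MvPowerSeries ℕ ℚ} {a : ℚ} (ha : 0 ≤ a) (hf : EPositive f) :
    EPositive (a • f) := by
  obtain ⟨c, hc, hc0, rfl⟩ := hf
  rw [Finsupp.sum, Finset.smul_sum]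
  refine EPositive.sum _ _ fun μ hμ => ?_
  rw [smul_smul]
  exact ePositive_smul_esymM (mul_nonneg ha (hc μ)) (hc0 μ hμ)

end EPositive

/-- Consecutive letters of the word `f` are distinct, i.e. `f` properly colours a path. -/
def IsSmirnov {n : ℕ} (f : Fin n → ℕ) : Prop :=
  ∀ i j : Fin n, (j : ℕ) = i + 1 → f i ≠ f j

section Smirnov

theorem isSmirnov_succ {n : ℕ} (f : Fin (n + 1) → ℕ) :
    IsSmirnov f ↔ (∀ j : Fin n, (j : ℕ) = 0 → f 0 ≠ f j.succ) ∧ IsSmirnov (f ∘ Fin.succ) := by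
  simp [IsSmirnov, Fin.forall_fin_succ]

theorem isSmirnov_add_two {n : ℕ} (f : Fin (n + 2) → ℕ) :
    IsSmirnov f ↔ f 0 ≠ f 1 ∧ IsSmirnov (f ∘ Fin.succ) := by
  rw [isSmirnov_succ]
  simp

theorem isSmirnov_append_iff {m n : ℕ} (f : Fin ((m + 1) + (n + 1)) → ℕ) :
    IsSmirnov f ↔ IsSmirnov (fun i => f (Fin.castAdd (n + 1) (Fin.rev i))) ∧
      IsSmirnov (fun i => f (Fin.natAdd (m + 1) i)) ∧
      f (Fin.castAdd (n + 1) (Fin.rev 0)) ≠ f (Fin.natAdd (m + 1) 0) := by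
  refine ⟨fun h => ⟨fun i j hij => (h _ _ ?_).symm, fun i j hij => h _ _ ?_, h _ _ ?_⟩, ?_⟩
  · simp only [Fin.val_castAdd, Fin.val_rev]
    omega
  · simp only [Fin.val_natAdd]
    omega
  · simp
  · rintro ⟨h₁, h₂, h₃⟩ i j
    induction i using Fin.addCases with
    | left i =>
      induction j using Fin.addCases with
      | left j =>
        intro hij
        simp only [Fin.val_castAdd] at hij
        have := h₁ j.rev i.rev (by simp only [Fin.val_rev]; omega)
        simpa using this.symm
      | right j =>
        intro hij
        simp only [Fin.val_castAdd, Fin.val_natAdd] at hij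
        obtain rfl : i = Fin.rev 0 := Fin.ext (by rw [Fin.val_rev, Fin.val_zero]; omega)
        obtain rfl : j = 0 := Fin.ext (by rw [Fin.val_zero]; omega)
        exact h₃
    | right i =>
      induction j using Fin.addCases with
      | left j =>
        intro hij
        simp only [Fin.val_castAdd, Fin.val_natAdd] at hij
        omega
      | right j =>
        intro hij
        simp only [Fin.val_natAdd] at hij
        exact h₂ i j (by omega)

theorem csf_pathG (k : ℕ) : csf (pathG k) = colourGF fun f : Fin k → ℕ => IsSmirnov f :=
  csf_fromRel _ fun v => by simp

end Smirnov

/-- The generating function of the proper colourings of a lollipop: a clique on `k` vertices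
all of which are joined to the first vertex of a path on `m + 1` vertices. -/
def lollipopGF (k m : ℕ) : MvPowerSeries ℕ ℚ :=
  colourGF fun κ : Fin k ⊕ Fin (m + 1) → ℕ =>
    (κ ∘ Sum.inl).Injective ∧ IsSmirnov (κ ∘ Sum.inr) ∧ ∀ i, κ (Sum.inl i) ≠ κ (Sum.inr 0)

section Lollipop

theorem colourContent_eq_indicator_iff {V : Type} [Fintype V] {κ : V → ℕ} (s : Finset ℕ)
    (hκ : κ.Injective) :
    (∀ i, colourContent κ i = if i ∈ s then 1 else 0) ↔ ∀ i, i ∈ s ↔ ∃ v, κ v = i := by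
  refine forall_congr' fun i => ?_
  rw [colourContent_apply]
  have : Subsingleton {v : V // κ v = i} := ⟨fun v w => Subtype.ext (hκ (v.2.trans w.2.symm))⟩
  by_cases h : ∃ v, κ v = i
  · have : Nonempty {v : V // κ v = i} := ⟨⟨_, h.choose_spec⟩⟩
    have : Nat.card {v : V // κ v = i} = 1 := Nat.card_eq_one_iff_unique.2 ⟨inferInstance, this⟩
    rw [this]
    simp [h]
  · have : IsEmpty {v : V // κ v = i} := ⟨fun v => h ⟨v, v.2⟩⟩
    simp [h]

theorem colourGF_injective (k : ℕ) :
    (colourGF fun κ : Fin k → ℕ => κ.Injective) = (k.factorial : ℚ) • esym k := by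
  classical
  funext d
  change Nat.cast _ = (k.factorial : ℚ) * ite _ _ _
  split_ifs with h
  · obtain ⟨h₁, h₂⟩ := h
    have hd : ∀ i, d i = if i ∈ d.support then 1 else 0 := fun i => by
      split_ifs with hi
      exacts [h₁ i hi, Finsupp.notMem_support_iff.1 hi]
    have hcard : d.support.card = k := by
      rw [← h₂, Finsupp.sum, Finset.sum_congr rfl h₁, Finset.card_eq_sum_ones]
    have hfact : k.factorial = Nat.card (Fin k ≃ d.support) := by
      rw [Nat.card_eq_fintype_card, Fintype.card_equiv (d.support.equivFinOfCardEq hcard).symm,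
        Fintype.card_fin]
    rw [mul_one, hfact]
    refine congrArg Nat.cast (Nat.card_congr ?_)
    have key : ∀ κ : Fin k → ℕ, κ.Injective →
        (colourContent κ = d ↔ ∀ i, i ∈ d.support ↔ ∃ v, κ v = i) := fun κ hκ => by
      rw [← colourContent_eq_indicator_iff _ hκ, DFunLike.ext_iff]
      exact forall_congr' fun i => by rw [← hd]
    exact
      { toFun := fun κ => Equiv.ofBijective
          (fun v => ⟨κ.1 v, ((key _ κ.2.1).1 κ.2.2 _).2 ⟨v, rfl⟩⟩)
          ⟨fun v w hvw => κ.2.1 (congrArg Subtype.val hvw), fun i => by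
            obtain ⟨v, hv⟩ := ((key _ κ.2.1).1 κ.2.2 i).1 i.2
            exact ⟨v, Subtype.ext hv⟩⟩
        invFun := fun e => ⟨fun v => e v, Subtype.val_injective.comp e.injective,
          (key _ (Subtype.val_injective.comp e.injective)).2 fun i =>
            ⟨fun hi => ⟨e.symm ⟨i, hi⟩, by simp⟩, by rintro ⟨v, rfl⟩; exact (e v).2⟩⟩
        left_inv := fun κ => rfl
        right_inv := fun e => Equiv.ext fun v => rfl }
  · rw [mul_zero, Nat.cast_eq_zero]
    refine @Nat.card_of_isEmpty _ ⟨?_⟩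
    rintro ⟨κ, hκ, rfl⟩
    refine h ⟨fun i hi => ?_, ?_⟩
    · have : Subsingleton {v : Fin k // κ v = i} :=
        ⟨fun v w => Subtype.ext (hκ (v.2.trans w.2.symm))⟩
      have h₁ : colourContent κ i ≠ 0 := Finsupp.mem_support_iff.1 hi
      have h₂ : colourContent κ i ≤ 1 := by
        rw [colourContent_apply]
        exact Finite.card_le_one_iff_subsingleton.2 this
      omega
    · have := map_sum (Finsupp.degree (σ := ℕ) (R := ℕ)) (fun v => Finsupp.single (κ v) 1) Finset.univ
      change (colourContent κ).degree = k
      simpa only [colourContent, Finsupp.degree_single, Finset.sum_const, Finset.card_univ, Fintype.card_fin,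
        smul_eq_mul, mul_one] using this

theorem injective_iff_succAbove {α : Type*} {k : ℕ} (f : Fin (k + 1) → α) (i : Fin (k + 1)) :
    f.Injective ↔ (f ∘ i.succAbove).Injective ∧ ∀ j, f (i.succAbove j) ≠ f i := by
  refine ⟨fun h => ⟨h.comp Fin.succAbove_right_injective, fun j => h.ne (i.succAbove_ne j)⟩, ?_⟩
  rintro ⟨h, hi⟩ u v
  induction u using i.succAboveCases <;> induction v using i.succAboveCases
  · simp
  · exact fun huv => (hi _ huv.symm).elim
  · exact fun huv => (hi _ huv).elim
  · exact fun huv => congrArg _ (h huv)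

theorem colourGF_injective_succ_eq_lollipopGF (k : ℕ) :
    (colourGF fun κ : Fin (k + 1) → ℕ => κ.Injective) = lollipopGF k 0 := by
  refine colourGF_of_bijective (Sum.elim Fin.succ fun _ => 0) ⟨?_, fun v => ?_⟩ fun κ => ?_
  · rintro (i | i) (j | j) h
    · simpa using h
    · simp at h
    · simp [eq_comm] at h
    · rw [Subsingleton.elim (α := Fin 1) i j]
  · cases v using Fin.cases with
    | zero => exact ⟨Sum.inr 0, rfl⟩
    | succ v => exact ⟨Sum.inl v, rfl⟩
  · have h : ∀ f : Fin (0 + 1) → ℕ, IsSmirnov f := fun f i j h => by omega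
    rw [injective_iff_succAbove κ 0]
    simp [h, Function.comp_def]

theorem lollipopGF_zero_left (m : ℕ) :
    lollipopGF 0 m = colourGF fun f : Fin (m + 1) → ℕ => IsSmirnov f :=
  colourGF_of_bijective Sum.inr
    ⟨Sum.inr_injective, fun v => by
      rcases v with i | i
      exacts [i.elim0, ⟨i, rfl⟩]⟩ fun κ => by
    simp [Function.injective_of_subsingleton]

theorem colourGF_ne_eq_lollipopGF (k m : ℕ) (i : Fin (k + 1)) :
    (colourGF fun κ : Fin (k + 1) ⊕ Fin (m + 1) → ℕ =>
      ((κ ∘ Sum.inl).Injective ∧ IsSmirnov (κ ∘ Sum.inr)) ∧ κ (Sum.inl i) ≠ κ (Sum.inr 0)) =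
      lollipopGF k (m + 1) := by
  refine colourGF_of_bijective
    (Sum.elim (fun j => Sum.inl (i.succAbove j)) (Fin.cons (Sum.inl i) Sum.inr))
    ⟨?_, ?_⟩ fun κ => ?_
  · refine Function.Injective.sumElim
      (Sum.inl_injective.comp Fin.succAbove_right_injective)
      (Fin.cons_injective_iff.2 ⟨by simp, Sum.inr_injective⟩) fun u v => ?_
    cases v using Fin.cases <;> simp
  · rintro (v | v)
    · induction v using i.succAboveCases with
      | x => exact ⟨Sum.inr 0, rfl⟩
      | p v => exact ⟨Sum.inl v, rfl⟩
    · exact ⟨Sum.inr v.succ, rfl⟩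
  · rw [isSmirnov_add_two, injective_iff_succAbove _ i]
    simp only [Function.comp_def, Sum.elim_inl, Sum.elim_inr, Fin.cons_zero, Fin.cons_one,
      Fin.cons_succ]
    tauto

theorem colourGF_eq_forall_ne_add_sum {V ι : Type} [Fintype V] (Q : (V → ℕ) → Prop) (p : ι → V) (w : V)
    (hQ : ∀ κ, Q κ → (κ ∘ p).Injective) (s : Finset ι) :
    colourGF Q = colourGF (fun κ => Q κ ∧ ∀ i ∈ s, κ (p i) ≠ κ w) +
      ∑ i ∈ s, colourGF fun κ => Q κ ∧ ¬ κ (p i) ≠ κ w := by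
  classical
  induction s using Finset.induction_on with
  | empty => simp
  | insert a s ha ih =>
    rw [ih, Finset.sum_insert ha, ← add_assoc, colourGF_split _ fun κ => κ (p a) ≠ κ w]
    congr 3 <;> ext κ
    · simp only [Finset.forall_mem_insert]
      tauto
    · rw [and_right_comm, and_iff_left_iff_imp]
      rintro ⟨hκ, ha'⟩ i hi hiw
      rw [not_not] at ha'
      exact ha (hQ κ hκ (hiw.trans ha'.symm) ▸ hi)

theorem lollipopGF_succ (k m : ℕ) :
    ((k : ℚ) + 1) • lollipopGF k (m + 1) = lollipopGF (k + 1) m +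
      (k : ℚ) • ((colourGF fun κ : Fin (k + 1) → ℕ => κ.Injective) *
        colourGF fun f : Fin (m + 1) → ℕ => IsSmirnov f) := by
  rw [colourGF_mul]
  set Q : (Fin (k + 1) ⊕ Fin (m + 1) → ℕ) → Prop :=
    fun κ => (κ ∘ Sum.inl).Injective ∧ IsSmirnov (κ ∘ Sum.inr) with hQ
  have h := colourGF_eq_forall_ne_add_sum Q Sum.inl (Sum.inr 0) (fun κ hκ => hκ.1) Finset.univ
  have h' (i : Fin (k + 1)) :
      (colourGF fun κ => Q κ ∧ ¬ κ (Sum.inl i) ≠ κ (Sum.inr 0)) =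
        colourGF Q - lollipopGF k (m + 1) := by
    rw [colourGF_split Q fun κ => κ (Sum.inl i) ≠ κ (Sum.inr 0), ← colourGF_ne_eq_lollipopGF k m i]
    simp [hQ]
  have h'' : (colourGF fun κ => Q κ ∧ ∀ i ∈ Finset.univ, κ (Sum.inl i) ≠ κ (Sum.inr 0)) =
      lollipopGF (k + 1) m := by
    simp only [hQ, and_assoc, Finset.mem_univ, true_imp_iff, lollipopGF]
  simp only [h', h'', Finset.sum_const, Finset.card_univ, Fintype.card_fin] at h
  rw [← Nat.cast_smul_eq_nsmul ℚ] at h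
  push_cast at h
  simp only [smul_sub, add_smul, one_smul] at h ⊢
  linear_combination h

theorem ePositive_lollipopGF (k m : ℕ) : EPositive (lollipopGF k m) := by
  have hK (k : ℕ) : EPositive (colourGF fun κ : Fin (k + 1) → ℕ => κ.Injective) := by
    rw [colourGF_injective]
    exact (ePositive_esym_succ k).smul (Nat.cast_nonneg _)
  induction m generalizing k with
  | zero =>
    rw [← colourGF_injective_succ_eq_lollipopGF]
    exact hK k
  | succ m ih =>
    have hk : (0 : ℚ) < (k : ℚ) + 1 := by positivity
    rw [← inv_smul_smul₀ hk.ne' (lollipopGF k (m + 1)), lollipopGF_succ, ← lollipopGF_zero_left]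
    exact ((ih _).add (((hK k).mul (ih 0)).smul (Nat.cast_nonneg _))).smul (by positivity)

theorem ePositive_csf_pathG_succ (m : ℕ) : EPositive (csf (pathG (m + 1))) := by
  rw [csf_pathG, ← lollipopGF_zero_left]
  exact ePositive_lollipopGF 0 m

end Lollipop

section SunSpider

theorem colourGF_triangle {V : Type} [Fintype V] (Q : (V → ℕ) → Prop) (x y z : V) :
    (colourGF fun κ => Q κ ∧ κ x ≠ κ y ∧ κ x ≠ κ z ∧ κ y ≠ κ z) =
      (colourGF fun κ => Q κ ∧ κ x ≠ κ y ∧ κ y ≠ κ z) +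
      (colourGF fun κ => Q κ ∧ κ x ≠ κ z ∧ κ y ≠ κ z) -
      colourGF fun κ => Q κ ∧ κ y ≠ κ z := by
  rw [colourGF_split (fun κ => Q κ ∧ κ y ≠ κ z) fun κ => κ x ≠ κ y,
    colourGF_split (fun κ => Q κ ∧ κ x ≠ κ z ∧ κ y ≠ κ z) fun κ => κ x ≠ κ y]
  have h₁ (κ : V → ℕ) : (Q κ ∧ κ x ≠ κ z ∧ κ y ≠ κ z) ∧ κ x ≠ κ y ↔
      Q κ ∧ κ x ≠ κ y ∧ κ x ≠ κ z ∧ κ y ≠ κ z := by tauto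
  have h₂ (κ : V → ℕ) : (Q κ ∧ κ x ≠ κ z ∧ κ y ≠ κ z) ∧ ¬ κ x ≠ κ y ↔
      (Q κ ∧ κ y ≠ κ z) ∧ ¬ κ x ≠ κ y := by
    rw [not_not]
    constructor <;> rintro ⟨h, h'⟩ <;> simp_all
  have h₃ (κ : V → ℕ) : (Q κ ∧ κ y ≠ κ z) ∧ κ x ≠ κ y ↔ Q κ ∧ κ x ≠ κ y ∧ κ y ≠ κ z := by tauto
  simp only [h₁, h₂, h₃]
  ring

/-- The colourings of three disjoint words by proper colourings of paths. -/
def IsSmirnovTriple {l m n : ℕ} (κ : Fin l ⊕ Fin m ⊕ Fin n → ℕ) : Prop :=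
  IsSmirnov (fun i => κ (.inl i)) ∧ IsSmirnov (fun i => κ (.inr (.inl i))) ∧
    IsSmirnov fun i => κ (.inr (.inr i))

theorem isSmirnov_rays_iff {n : ℕ} (l : Fin n → ℕ) (f : (Σ i, Fin (l i)) → ℕ) :
    (∀ p q, p.1 = q.1 ∧ (q.2 : ℕ) = p.2 + 1 → f p ≠ f q) ↔ ∀ i, IsSmirnov fun j => f ⟨i, j⟩ := by
  refine ⟨fun h i j k hjk => h ⟨i, j⟩ ⟨i, k⟩ ⟨rfl, hjk⟩, ?_⟩
  rintro h ⟨i, j⟩ ⟨i', k⟩ ⟨hi, hjk⟩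
  obtain rfl : i = i' := hi
  exact h i j k hjk

/-- The vertices of a sun graph on a triangle, arranged as three words: each ray is preceded by
the triangle vertex that it is attached to. -/
def sunVertex (l : Fin 3 → ℕ) :
    Fin (l 0 + 1) ⊕ Fin (l 1 + 1) ⊕ Fin (l 2 + 1) → Fin 3 ⊕ Σ i, Fin (l i) :=
  Sum.elim (Fin.cons (.inl 0) fun j => .inr ⟨0, j⟩)
    (Sum.elim (Fin.cons (.inl 1) fun j => .inr ⟨1, j⟩) (Fin.cons (.inl 2) fun j => .inr ⟨2, j⟩))

theorem sunVertex_bijective (l : Fin 3 → ℕ) : (sunVertex l).Bijective := by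
  constructor
  · rintro (i | i | i) (j | j | j) <;> cases i using Fin.cases <;> cases j using Fin.cases <;>
      simp [sunVertex]
  · rintro (i | ⟨i, j⟩) <;> fin_cases i
    · exact ⟨.inl 0, rfl⟩
    · exact ⟨.inr (.inl 0), rfl⟩
    · exact ⟨.inr (.inr 0), rfl⟩
    · exact ⟨.inl j.succ, rfl⟩
    · exact ⟨.inr (.inl j.succ), rfl⟩
    · exact ⟨.inr (.inr j.succ), rfl⟩

theorem csf_sunGraph_three (l : Fin 3 → ℕ) :
    csf (sunGraph 3 l) =
      colourGF fun κ : Fin (l 0 + 1) ⊕ Fin (l 1 + 1) ⊕ Fin (l 2 + 1) → ℕ =>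
        IsSmirnovTriple κ ∧ κ (.inl 0) ≠ κ (.inr (.inl 0)) ∧ κ (.inl 0) ≠ κ (.inr (.inr 0)) ∧
          κ (.inr (.inl 0)) ≠ κ (.inr (.inr 0)) := by
  rw [sunGraph, csf_fromRel]
  · refine colourGF_of_bijective _ (sunVertex_bijective l) fun κ => ?_
    have h := isSmirnov_rays_iff l fun p => κ (.inr p)
    simp only [Sum.forall, sunRel, false_imp_iff, implies_true, h, true_and]
    simp only [IsSmirnovTriple, isSmirnov_succ, sunVertex, Function.comp_def, Sum.elim_inl,
      Sum.elim_inr, Fin.cons_zero, Fin.cons_succ, Sigma.forall, Fin.forall_fin_succ (n := 2),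
      Fin.forall_fin_succ (n := 1), Fin.forall_fin_succ (n := 0)]
    simp
    rw [eq_comm (a := κ (.inl 2)) (b := κ (.inl 0))]
    tauto
  · rintro (i | ⟨i, j⟩)
    · fin_cases i <;> simp [sunRel]
    · simp [sunRel]

/-- The vertices of a spider with three legs, arranged as three words: the last leg is preceded
by the centre. -/
def spiderVertex (l : Fin 3 → ℕ) :
    Fin (l 0) ⊕ Fin (l 1) ⊕ Fin (l 2 + 1) → Unit ⊕ Σ i, Fin (l i) :=
  Sum.elim (fun j => .inr ⟨0, j⟩)
    (Sum.elim (fun j => .inr ⟨1, j⟩) (Fin.cons (.inl ()) fun j => .inr ⟨2, j⟩))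

theorem spiderVertex_bijective (l : Fin 3 → ℕ) : (spiderVertex l).Bijective := by
  constructor
  · rintro (i | i | i) (j | j | j) 
    any_goals cases j using Fin.cases
    any_goals cases i using Fin.cases
    all_goals simp [spiderVertex]
  · rintro (i | ⟨i, j⟩)
    · exact ⟨.inr (.inr 0), rfl⟩
    fin_cases i
    · exact ⟨.inl j, rfl⟩
    · exact ⟨.inr (.inl j), rfl⟩
    · exact ⟨.inr (.inr j.succ), rfl⟩

theorem csf_spiderGraph_three (a b c : ℕ) :
    csf (spiderGraph 3 ![a + 1, b + 1, c]) =
      colourGF fun κ : Fin (a + 1) ⊕ Fin (b + 1) ⊕ Fin (c + 1) → ℕ =>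
        IsSmirnovTriple κ ∧ κ (.inl 0) ≠ κ (.inr (.inr 0)) ∧
          κ (.inr (.inl 0)) ≠ κ (.inr (.inr 0)) := by
  rw [spiderGraph, csf_fromRel]
  · refine colourGF_of_bijective (spiderVertex ![a + 1, b + 1, c])
      (spiderVertex_bijective ![a + 1, b + 1, c]) fun κ => ?_
    have h := isSmirnov_rays_iff ![a + 1, b + 1, c] fun p => κ (.inr p)
    simp only [Sum.forall, false_imp_iff, implies_true, h, true_and]
    simp only [IsSmirnovTriple, isSmirnov_succ (n := c), spiderVertex, Function.comp_def,
      Sigma.forall, Fin.forall_fin_succ (n := 2), Fin.forall_fin_succ (n := 1),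
      Fin.forall_fin_succ (n := 0)]
    simp [eq_comm (b := κ (.inl ()))]
    constructor
    · rintro ⟨h₁, h₂, h₃, h₄⟩
      exact ⟨⟨h₂, h₃, (h₁ ()).2.2, h₄⟩, (h₁ ()).1, (h₁ ()).2.1⟩
    · rintro ⟨⟨h₂, h₃, h₅, h₄⟩, h₆, h₇⟩
      exact ⟨fun _ => ⟨h₆, h₇, h₅⟩, h₂, h₃, h₄⟩
  · rintro (i | ⟨i, j⟩) <;> simp

theorem csf_spiderGraph_three_comm (a b c : ℕ) :
    csf (spiderGraph 3 ![a + 1, b + 1, c]) =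
      colourGF fun κ : Fin (a + 1) ⊕ Fin (c + 1) ⊕ Fin (b + 1) → ℕ =>
        IsSmirnovTriple κ ∧ κ (.inl 0) ≠ κ (.inr (.inl 0)) ∧
          κ (.inr (.inl 0)) ≠ κ (.inr (.inr 0)) := by
  rw [csf_spiderGraph_three]
  refine colourGF_of_bijective (Sum.map id Sum.swap)
    (Function.bijective_id.sumMap (Equiv.sumComm _ _).bijective) fun κ => ?_
  simp only [IsSmirnovTriple, Function.comp_def, Sum.map_inl, Sum.map_inr, Sum.swap_inl,
    Sum.swap_inr, id]
  rw [ne_comm (a := κ (.inr (.inl 0)))]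
  tauto

theorem csf_pathG_mul_csf_pathG (a b c : ℕ) :
    csf (pathG (a + 1)) * csf (pathG ((b + 1) + (c + 1))) =
      colourGF fun κ : Fin (a + 1) ⊕ Fin (b + 1) ⊕ Fin (c + 1) → ℕ =>
        IsSmirnovTriple κ ∧ κ (.inr (.inl 0)) ≠ κ (.inr (.inr 0)) := by
  have h : csf (pathG ((b + 1) + (c + 1))) =
      colourGF fun κ : Fin (b + 1) ⊕ Fin (c + 1) → ℕ => IsSmirnov (fun i => κ (.inl i)) ∧
        IsSmirnov (fun i => κ (.inr i)) ∧ κ (.inl 0) ≠ κ (.inr 0) := by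
    rw [csf_pathG]
    refine colourGF_of_bijective (finSumFinEquiv ∘ Sum.map Fin.rev id)
      (finSumFinEquiv.bijective.comp (Fin.rev_bijective.sumMap Function.bijective_id)) fun κ => ?_
    simp [isSmirnov_append_iff]
  rw [h, csf_pathG, colourGF_mul]
  simp only [IsSmirnovTriple, and_assoc, Function.comp_def]

end SunSpider

end

/-- `X_{S(3; a, b, b)} = 2·X_{S(a+1, b+1, b)} - X_{P_{2b+2}}·X_{P_{a+1}}`,
where `S(a+1, b+1, b)` is the spider with legs `a+1, b+1, b`; in particular if
`S(3; a, b, b)` is `e`-positive then so is the spider `S(a+1, b+1, b)`. -/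
theorem sun3_spider_relation (a b : ℕ) (ha : 0 < a) (hb : 0 < b) :
    csf (sunGraph 3 ![a, b, b]) =
      2 * csf (spiderGraph 3 ![a + 1, b + 1, b])
        - csf (pathG (2 * b + 2)) * csf (pathG (a + 1)) ∧
    (EPositive (csf (sunGraph 3 ![a, b, b])) →
      EPositive (csf (spiderGraph 3 ![a + 1, b + 1, b]))) := by
  have hsun : csf (sunGraph 3 ![a, b, b]) =
      2 * csf (spiderGraph 3 ![a + 1, b + 1, b])
        - csf (pathG (2 * b + 2)) * csf (pathG (a + 1)) := by
    rw [show 2 * b + 2 = (b + 1) + (b + 1) by ring, mul_comm (csf (pathG _)),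
      csf_pathG_mul_csf_pathG, two_mul]
    nth_rw 1 [csf_spiderGraph_three_comm]
    rw [csf_spiderGraph_three, csf_sunGraph_three]
    exact colourGF_triangle _ _ _ _
  refine ⟨hsun, fun h => ?_⟩
  have hspider : csf (spiderGraph 3 ![a + 1, b + 1, b]) = (2⁻¹ : ℚ) •
      (csf (sunGraph 3 ![a, b, b]) + csf (pathG (2 * b + 2)) * csf (pathG (a + 1))) := by
    rw [hsun, sub_add_cancel, two_mul, ← two_smul ℚ, inv_smul_smul₀ two_ne_zero]
  rw [hspider]
  exact (h.add ((ePositive_csf_pathG_succ _).mul (ePositive_csf_pathG_succ _))).smul (by norm_num)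
end

section
/- For positive integers a and b, the sun graph S(3; a, b, b) is e-positive if and only if a = 4 and b = 2. -/
namespace ChromaticSun

open Finset

section Algebra

variable {R S : Type*} [CommRing R] [CommRing S]

/-- The sequence `t` determined by Newton's identities `n v_n = ∑_{j=1}^n t_j v_{n-j}`
(with `v_0 = 1`): if `v` lists elementary symmetric functions, then
`t_j = (-1)^(j-1) p_j` lists the signed power sums. -/
def newtonSum (v : ℕ → R) : ℕ → R
  | 0 => 0
  | n + 1 => (n + 1) * v (n + 1) - ∑ i : Fin n, newtonSum v (i + 1) * v (n - i)

/-- The chromatic symmetric functions of paths, in terms of signed power sums. -/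
def pathVal (t : ℕ → R) : ℕ → R
  | 0 => 1
  | n + 1 => ∑ i : Fin (n + 1), t (i + 1) * pathVal t (n - i)

/-- For signed power sums `t_j = (-1)^(j-1) ∑_x x^j`, this is `∑_x (-x)^m Q_A(x)`, where
`Q_A(x)` enumerates the colourings of `P_A` whose first vertex has colour `x`. -/
def tailVal (t : ℕ → R) (m A : ℕ) : R :=
  ∑ i ∈ range A, t (i + 1 + m) * pathVal t (A - 1 - i)

/-- For signed power sums, this is `-∑_x Q_A(x) Q_B(x)`. -/
def pairVal (t : ℕ → R) (A B : ℕ) : R :=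
  ∑ j ∈ range B, tailVal t (j + 1) A * pathVal t (B - 1 - j)

/-- For signed power sums, this is `∑_x Q_A(x) Q_B(x) Q_C(x)`. -/
def tripleVal (t : ℕ → R) (A B C : ℕ) : R :=
  ∑ k ∈ range C, (∑ j ∈ range B, tailVal t (j + 1 + (k + 1)) A * pathVal t (B - 1 - j)) *
    pathVal t (C - 1 - k)

/-- The chromatic symmetric function of the sun `S(3; A - 1, B - 1, C - 1)` in terms of
signed power sums. -/
def sunVal (t : ℕ → R) (A B C : ℕ) : R :=
  pathVal t A * pathVal t B * pathVal t C + pairVal t A B * pathVal t C +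
    pairVal t A C * pathVal t B + pairVal t B C * pathVal t A + 2 * tripleVal t A B C

theorem newtonSum_succ (v : ℕ → R) (n : ℕ) :
    newtonSum v (n + 1) =
      (n + 1) * v (n + 1) - ∑ i ∈ range n, newtonSum v (i + 1) * v (n - i) := by
  rw [newtonSum, Fin.sum_univ_eq_sum_range (fun i => newtonSum v (i + 1) * v (n - i))]

theorem newton_identity {v : ℕ → R} (hv : v 0 = 1) (n : ℕ) :
    ∑ i ∈ range (n + 1), newtonSum v (i + 1) * v (n - i) = (n + 1) * v (n + 1) := by
  rw [sum_range_succ, newtonSum_succ]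
  simp [hv]

theorem eq_newtonSum {v t : ℕ → R} (hv : v 0 = 1) {N : ℕ}
    (h : ∀ n < N, ∑ i ∈ range (n + 1), t (i + 1) * v (n - i) = (n + 1) * v (n + 1)) :
    ∀ n < N, t (n + 1) = newtonSum v (n + 1) := by
  intro n
  induction n using Nat.strong_induction_on with
  | _ n ih =>
    intro hn
    have := h n hn
    rw [sum_range_succ, sum_congr rfl fun i hi => by
      rw [ih i (mem_range.1 hi) ((mem_range.1 hi).trans hn)]] at this
    rw [newtonSum_succ, ← this]
    simp [hv]

theorem pathVal_succ (t : ℕ → R) (n : ℕ) :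
    pathVal t (n + 1) = ∑ i ∈ range (n + 1), t (i + 1) * pathVal t (n - i) := by
  rw [pathVal, Fin.sum_univ_eq_sum_range (fun i => t (i + 1) * pathVal t (n - i))]

@[simp] theorem pathVal_zero (t : ℕ → R) : pathVal t 0 = 1 := by rw [pathVal]

theorem map_newtonSum {F : Type*} [FunLike F R S] [RingHomClass F R S] (f : F)
    (v : ℕ → R) (n : ℕ) :
    f (newtonSum v n) = newtonSum (fun i => f (v i)) n := by
  induction n using Nat.strong_induction_on with
  | _ n ih =>
    cases n with
    | zero => simp [newtonSum]
    | succ n =>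
      rw [newtonSum_succ, newtonSum_succ]
      simp only [map_sub, map_mul, map_add, map_natCast, map_one, map_sum]
      congr 1
      exact sum_congr rfl fun i hi => by rw [ih _ (by simpa using hi)]

theorem map_pathVal {F : Type*} [FunLike F R S] [RingHomClass F R S] (f : F)
    (t : ℕ → R) (n : ℕ) :
    f (pathVal t n) = pathVal (fun i => f (t i)) n := by
  induction n using Nat.strong_induction_on with
  | _ n ih =>
    cases n with
    | zero => simp
    | succ n =>
      rw [pathVal_succ, pathVal_succ]
      simp only [map_mul, map_sum]
      exact sum_congr rfl fun i hi => by rw [ih _ (by omega)]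

theorem map_sunVal {F : Type*} [FunLike F R S] [RingHomClass F R S] (f : F)
    (t : ℕ → R) (A B C : ℕ) :
    f (sunVal t A B C) = sunVal (fun i => f (t i)) A B C := by
  have h2 : f 2 = 2 := map_ofNat f 2
  simp [sunVal, pairVal, tripleVal, tailVal, map_pathVal, h2]

theorem map_sunVal_newtonSum {F : Type*} [FunLike F R S] [RingHomClass F R S] (f : F)
    (v : ℕ → R) (A B C : ℕ) :
    f (sunVal (newtonSum v) A B C) = sunVal (newtonSum fun i => f (v i)) A B C := by
  rw [map_sunVal]
  simp only [map_newtonSum]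

theorem tailVal_zero_succ (t : ℕ → R) (A : ℕ) : tailVal t 0 (A + 1) = pathVal t (A + 1) := by
  simp [tailVal, pathVal_succ]

theorem tailVal_succ (t : ℕ → R) (m A : ℕ) :
    tailVal t m (A + 1) = tailVal t (m + 1) A + t (m + 1) * pathVal t A := by
  rw [tailVal, sum_range_succ', tailVal]
  congr 1
  · refine sum_congr rfl fun i hi => ?_
    congr 2 <;> omega
  · simp [add_comm]

/-- The chromatic symmetric functions of paths in terms of elementary symmetric functions. -/
theorem pathVal_newtonSum_succ {v : ℕ → R} (hv : v 0 = 1) (n : ℕ) :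
    pathVal (newtonSum v) (n + 1) =
      v (n + 1) + ∑ i ∈ range n, (i + 1) * v (i + 2) * pathVal (newtonSum v) (n - 1 - i) := by
  let E := PowerSeries.mk v
  let T := PowerSeries.mk fun i => newtonSum v (i + 1)
  let P := PowerSeries.mk (pathVal (newtonSum v))
  have hP : P = 1 + PowerSeries.X * (T * P) := by
    ext n
    cases n with
    | zero => simp [P]
    | succ n =>
      rw [map_add, PowerSeries.coeff_succ_X_mul, PowerSeries.coeff_mul,
        Nat.sum_antidiagonal_eq_sum_range_succ_mk]
      simp [P, T, pathVal_succ, PowerSeries.coeff_one]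
  have hT : T * E = PowerSeries.derivative R E := by
    ext n
    rw [PowerSeries.coeff_mul, Nat.sum_antidiagonal_eq_sum_range_succ_mk]
    simp only [T, E, PowerSeries.coeff_mk, newton_identity hv, PowerSeries.coeff_derivative]
    ring
  have hE : P * E = E + PowerSeries.X * (PowerSeries.derivative R E * P) := by
    rw [← hT]
    linear_combination E * hP
  have h := congrArg (PowerSeries.coeff (n + 1)) hE
  rw [mul_comm P, map_add, PowerSeries.coeff_succ_X_mul, PowerSeries.coeff_mul,
    PowerSeries.coeff_mul, Nat.sum_antidiagonal_eq_sum_range_succ_mk,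
    Nat.sum_antidiagonal_eq_sum_range_succ_mk, sum_range_succ', sum_range_succ',
    sum_range_succ'] at h
  simp only [E, P, PowerSeries.coeff_mk, PowerSeries.coeff_derivative, hv] at h
  have e1 : ∀ i ∈ range n, v (i + 1 + 1) * (((i + 1 : ℕ) : R) + 1) * pathVal (newtonSum v) (n - (i + 1))
      = v (i + 1 + 1) * pathVal (newtonSum v) (n + 1 - (i + 1 + 1))
       + (i + 1) * v (i + 2) * pathVal (newtonSum v) (n - 1 - i) := by
    intro i hi
    rw [show n + 1 - (i + 1 + 1) = n - 1 - i by omega, show n - (i + 1) = n - 1 - i by omega]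
    push_cast
    ring
  rw [sum_congr rfl e1, sum_add_distrib] at h
  simp at h
  linear_combination h

end Algebra

section Colourings

variable {R ι : Type*} [CommRing R]

/-- `r` is a proper colouring of a path whose first vertex is joined to a vertex coloured `c`. -/
def IsRay {k : ℕ} (c : ι) (r : Fin k → ι) : Prop :=
  (∀ i : Fin k, (i : ℕ) = 0 → c ≠ r i) ∧ ∀ i j : Fin k, (j : ℕ) = i + 1 → r i ≠ r j

theorem isRay_cons {k : ℕ} (c c' : ι) (r : Fin k → ι) :
    IsRay c (Fin.cons c' r : Fin (k + 1) → ι) ↔ c ≠ c' ∧ IsRay c' r := by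
  simp only [IsRay, Fin.forall_fin_succ, Fin.cons_zero, Fin.cons_succ, Fin.val_zero, Fin.val_succ]
  simp

/-- For signed power sums `t`, this enumerates the colourings of `P_n` whose first vertex has
the colour with variable `x`. -/
def firstVal (t : ℕ → R) (x : R) (n : ℕ) : R :=
  -∑ j ∈ range n, (-x) ^ (j + 1) * pathVal t (n - 1 - j)

theorem firstVal_succ (t : ℕ → R) (x : R) (n : ℕ) :
    firstVal t x (n + 1) = x * (pathVal t n - firstVal t x n) := by
  have h : ∀ j ∈ range n, (-x) ^ (j + 1 + 1) * pathVal t (n + 1 - 1 - (j + 1)) =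
      -x * ((-x) ^ (j + 1) * pathVal t (n - 1 - j)) := fun j _ => by
    rw [show n + 1 - 1 - (j + 1) = n - 1 - j by omega]
    ring
  rw [firstVal, sum_range_succ', sum_congr rfl h, ← mul_sum, firstVal]
  simp
  ring

variable [Fintype ι]

theorem sum_pow_mul_firstVal {t : ℕ → R} {x : ι → R}
    (ht : ∀ j, t (j + 1) = -∑ c, (-x c) ^ (j + 1)) (m n : ℕ) :
    ∑ c, (-x c) ^ m * firstVal t (x c) n = tailVal t m n := by
  simp only [firstVal, mul_neg, mul_sum, sum_neg_distrib]
  rw [sum_comm, tailVal, ← sum_neg_distrib]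
  refine sum_congr rfl fun i _ => ?_
  rw [show i + 1 + m = (i + m) + 1 by ring, ht, neg_mul, sum_mul]
  congr 1
  exact sum_congr rfl fun c _ => by ring

theorem sum_firstVal_succ {t : ℕ → R} {x : ι → R}
    (ht : ∀ j, t (j + 1) = -∑ c, (-x c) ^ (j + 1)) (n : ℕ) :
    ∑ c, firstVal t (x c) (n + 1) = pathVal t (n + 1) := by
  simpa [tailVal_zero_succ] using sum_pow_mul_firstVal ht 0 (n + 1)

theorem sum_pow_mul_firstVal_mul_firstVal {t : ℕ → R} {x : ι → R}
    (ht : ∀ j, t (j + 1) = -∑ c, (-x c) ^ (j + 1)) (m A B : ℕ) :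
    ∑ c, (-x c) ^ m * (firstVal t (x c) A * firstVal t (x c) B) =
      -∑ j ∈ range B, tailVal t (j + 1 + m) A * pathVal t (B - 1 - j) := by
  have hB : ∀ y, firstVal t y B = -∑ j ∈ range B, (-y) ^ (j + 1) * pathVal t (B - 1 - j) :=
    fun _ => rfl
  simp_rw [hB, mul_neg, mul_sum, sum_neg_distrib]
  rw [sum_comm]
  congr 1
  refine sum_congr rfl fun j _ => ?_
  rw [← sum_pow_mul_firstVal ht, sum_mul]
  exact sum_congr rfl fun c _ => by ring

theorem sum_firstVal_mul_firstVal {t : ℕ → R} {x : ι → R}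
    (ht : ∀ j, t (j + 1) = -∑ c, (-x c) ^ (j + 1)) (A B : ℕ) :
    ∑ c, firstVal t (x c) A * firstVal t (x c) B = -pairVal t A B := by
  simpa [pairVal] using sum_pow_mul_firstVal_mul_firstVal ht 0 A B

theorem sum_firstVal_mul_firstVal_mul_firstVal {t : ℕ → R} {x : ι → R}
    (ht : ∀ j, t (j + 1) = -∑ c, (-x c) ^ (j + 1)) (A B C : ℕ) :
    ∑ c, firstVal t (x c) A * firstVal t (x c) B * firstVal t (x c) C = tripleVal t A B C := by
  have hC : ∀ y, firstVal t y C = -∑ k ∈ range C, (-y) ^ (k + 1) * pathVal t (C - 1 - k) :=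
    fun _ => rfl
  simp_rw [hC, mul_neg, mul_sum, sum_neg_distrib]
  rw [sum_comm, tripleVal, ← sum_neg_distrib]
  refine sum_congr rfl fun k _ => ?_
  rw [← neg_eq_iff_eq_neg.2 (sum_pow_mul_firstVal_mul_firstVal ht (k + 1) A B), neg_mul, sum_mul]
  congr 1
  exact sum_congr rfl fun c _ => by ring

variable [DecidableEq ι]

instance {k : ℕ} (c : ι) (r : Fin k → ι) : Decidable (IsRay c r) := by
  unfold IsRay; infer_instance

theorem sum_isRay {t : ℕ → R} {x : ι → R} (ht : ∀ j, t (j + 1) = -∑ c, (-x c) ^ (j + 1))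
    (k : ℕ) (c : ι) :
    ∑ r : Fin k → ι, (if IsRay c r then ∏ i, x (r i) else 0) =
      pathVal t k - firstVal t (x c) k := by
  induction k generalizing c with
  | zero => simp [IsRay, firstVal]
  | succ k ih =>
    have h (c' : ι) : ∑ r : Fin k → ι,
        (if IsRay c (Fin.cons c' r : Fin (k + 1) → ι) then
          ∏ i, x ((Fin.cons c' r : Fin (k + 1) → ι) i) else 0) =
        if c ≠ c' then firstVal t (x c') (k + 1) else 0 := by
      rw [firstVal_succ, ← ih]
      simp only [isRay_cons, Fin.prod_univ_succ, Fin.cons_zero, Fin.cons_succ]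
      by_cases hc : c = c' <;> simp [hc, mul_sum]
    rw [← (Fin.consEquiv fun _ => ι).sum_comp, Fintype.sum_prod_type]
    refine (Fintype.sum_congr _ _ h).trans ?_
    rw [← sum_firstVal_succ ht, eq_sub_iff_add_eq]
    have hc : firstVal t (x c) (k + 1) =
        ∑ c', if c = c' then firstVal t (x c') (k + 1) else 0 := by simp
    rw [hc, ← sum_add_distrib]
    exact sum_congr rfl fun c' _ => by by_cases h : c = c' <;> simp [h]

theorem sum_rays {α : Type*} [Fintype α] [DecidableEq α] {t : ℕ → R} {x : ι → R}
    (ht : ∀ j, t (j + 1) = -∑ c, (-x c) ^ (j + 1)) (lam : α → ℕ) (col : α → ι) :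
    ∑ r : (i : α) → Fin (lam i) → ι,
      (if ∀ i, IsRay (col i) (r i) then (∏ i, x (col i)) * ∏ i, ∏ j, x (r i j) else 0) =
      ∏ i, firstVal t (x (col i)) (lam i + 1) := by
  simp only [firstVal_succ, ← sum_isRay ht, prod_mul_distrib, prod_univ_sum, mul_sum,
    Fintype.piFinset_univ]
  refine sum_congr rfl fun r _ => ?_
  by_cases hr : ∀ i, IsRay (col i) (r i)
  · simp [hr]
  · rw [if_neg hr]
    push Not at hr
    obtain ⟨i, hi⟩ := hr
    exact (mul_eq_zero_of_right _ (prod_eq_zero (mem_univ i) (if_neg hi))).symm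

theorem sum_distinct (f g h : ι → R) :
    ∑ a, ∑ b, ∑ c, (if a ≠ b ∧ b ≠ c ∧ c ≠ a then f a * g b * h c else 0) =
      (∑ a, f a) * (∑ b, g b) * ∑ c, h c - (∑ a, f a * g a) * ∑ c, h c -
        (∑ a, f a * h a) * ∑ b, g b - (∑ b, g b * h b) * ∑ a, f a +
        2 * ∑ a, f a * g a * h a := by
  have key : ∀ a b c : ι, (if a ≠ b ∧ b ≠ c ∧ c ≠ a then f a * g b * h c else 0) =
      f a * g b * h c - (if a = b then f a * g b * h c else 0)
        - (if a = c then f a * g b * h c else 0) - (if b = c then f a * g b * h c else 0)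
        + 2 * (if a = b then if a = c then f a * g b * h c else 0 else 0) := by
    intro a b c
    by_cases h1 : a = b
    · subst h1
      by_cases h2 : a = c
      · subst h2; simp; ring
      · simp [h2]
    · by_cases h2 : a = c
      · subst h2; simp [h1, Ne.symm h1]
      · by_cases h3 : b = c
        · subst h3; simp [h1]
        · simp [h1, h2, h3, Ne.symm h2]
  have full : ∑ a, ∑ b, ∑ c, f a * g b * h c = (∑ a, f a) * (∑ b, g b) * ∑ c, h c := by
    simp only [← mul_sum, ← sum_mul]
  have hab : ∑ a, ∑ b, ∑ c, (if a = b then f a * g b * h c else 0) =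
      (∑ a, f a * g a) * ∑ c, h c := by
    rw [sum_mul]
    refine sum_congr rfl fun a _ => ?_
    rw [sum_comm]
    simp [mul_sum]
  have hac : ∑ a, ∑ b, ∑ c, (if a = c then f a * g b * h c else 0) =
      (∑ a, f a * h a) * ∑ b, g b := by
    simp only [sum_ite_eq, mem_univ, if_true, mul_right_comm _ (g _), ← mul_sum, ← sum_mul]
  have hbc : ∑ a, ∑ b, ∑ c, (if b = c then f a * g b * h c else 0) =
      (∑ b, g b * h b) * ∑ a, f a := by
    simp only [sum_ite_eq, mem_univ, if_true, mul_assoc, ← mul_sum, ← sum_mul]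
    rw [mul_comm]
  have habc : ∑ a, ∑ b, ∑ c, (if a = b then if a = c then f a * g b * h c else 0 else 0) =
      ∑ a, f a * g a * h a := by
    refine sum_congr rfl fun a _ => ?_
    rw [sum_comm]
    simp
  simp only [key, sum_add_distrib, sum_sub_distrib, ← mul_sum, hab, hac, hbc, habc]
  rw [← full]
  simp only [← mul_sum]

end Colourings

section FiniteVariables

open MvPolynomial

variable {V : Type} [Fintype V]

open Classical in
/-- The chromatic symmetric polynomial in `M` variables. -/
noncomputable def finCsf [DecidableEq V] (G : SimpleGraph V) (M : ℕ) : MvPolynomial (Fin M) ℚ :=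
  ∑ κ : V → Fin M, if ∀ u v, G.Adj u v → κ u ≠ κ v then ∏ v, X (κ v) else 0

theorem sum_single_apply {ι : Type*} (κ : V → ι) (i : ι) :
    (∑ v, Finsupp.single (κ v) 1 : ι →₀ ℕ) i = Nat.card {v // κ v = i} := by
  classical
  simp [Finsupp.finsetSum_apply, Finsupp.single_apply, Nat.card_eq_fintype_card,
    Fintype.card_subtype]

theorem killCompl_csf [DecidableEq V] (G : SimpleGraph V) (M : ℕ) :
    MvPowerSeries.killCompl Fin.valEmbedding (csf G) = (finCsf G M : MvPowerSeries (Fin M) ℚ) := by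
  classical
  ext d
  rw [MvPowerSeries.coeff_killCompl, MvPolynomial.coeff_coe, finCsf, coeff_sum]
  have h : ∀ κ : V → Fin M, coeff d (if ∀ u v, G.Adj u v → κ u ≠ κ v then
      ∏ v, (X (κ v) : MvPolynomial (Fin M) ℚ) else 0) =
      if (∀ u v, G.Adj u v → κ u ≠ κ v) ∧ ∀ i, Nat.card {v // κ v = i} = d i then 1 else 0 := by
    intro κ
    have hX : ∏ v, (X (κ v) : MvPolynomial (Fin M) ℚ) =
        monomial (∑ v, Finsupp.single (κ v) 1) 1 := by
      rw [monomial_sum_one]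
      rfl
    have hd : (∑ v, Finsupp.single (κ v) 1 = d) ↔ ∀ i, Nat.card {v // κ v = i} = d i := by
      rw [Finsupp.ext_iff]
      simp only [sum_single_apply]
    simp only [← hd, hX]
    split_ifs <;> simp_all [coeff_monomial]
  rw [sum_congr rfl fun κ _ => h κ, sum_boole, ← Fintype.card_subtype, ← Nat.card_eq_fintype_card]
  change (Nat.card _ : ℚ) = _
  congr 1
  symm
  refine Nat.card_congr (Equiv.ofBijective (fun κ => ⟨fun v => κ.1 v, ?_, ?_⟩) ⟨?_, ?_⟩)
  · exact fun u v huv => Fin.val_injective.ne (κ.2.1 u v huv)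
  · intro i
    by_cases hi : i < M
    · rw [show i = Fin.valEmbedding (⟨i, hi⟩ : Fin M) from rfl, Finsupp.embDomain_apply_self,
        ← κ.2.2]
      exact Nat.card_congr (Equiv.subtypeEquivRight fun v => by simp [Fin.ext_iff])
    · rw [Finsupp.embDomain_of_notMem_range]
      · rw [Nat.card_eq_zero]
        left
        exact ⟨fun v => hi (v.2 ▸ (κ.1 v.1).2)⟩
      · rintro ⟨j, rfl⟩
        exact hi j.2
  · intro κ κ' h
    ext v
    exact congrFun (Subtype.ext_iff.1 h) v
  · rintro ⟨κ, hκ, hd⟩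
    have hlt : ∀ v, κ v < M := by
      intro v
      by_contra hv
      have := hd (κ v)
      rw [Finsupp.embDomain_of_notMem_range, Nat.card_eq_zero] at this
      · rcases this with h | h
        · exact h.elim ⟨v, rfl⟩
        · exact h.not_finite inferInstance
      · rintro ⟨j, hj⟩
        exact hv (hj ▸ j.2)
    refine ⟨⟨fun v => ⟨κ v, hlt v⟩, fun u v huv => ?_, fun i => ?_⟩, rfl⟩
    · simpa [Fin.ext_iff] using hκ u v huv
    · have := hd (Fin.valEmbedding i)
      rw [Finsupp.embDomain_apply_self] at this
      rw [← this]
      exact Nat.card_congr (Equiv.subtypeEquivRight fun v => by simp [Fin.ext_iff])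

theorem killCompl_esym (M k : ℕ) :
    MvPowerSeries.killCompl Fin.valEmbedding (esym k) =
      (esymm (Fin M) ℚ k : MvPowerSeries (Fin M) ℚ) := by
  classical
  ext d
  rw [MvPowerSeries.coeff_killCompl, MvPolynomial.coeff_coe, esymm_eq_sum_monomial, coeff_sum]
  simp only [coeff_monomial]
  have hs : ∀ t : Finset (Fin M), (∑ i ∈ t, Finsupp.single i 1 = d) ↔
      t = d.support ∧ ∀ i ∈ d.support, d i = 1 := by
    intro t
    have ht : ∀ i, (∑ i ∈ t, Finsupp.single i 1 : Fin M →₀ ℕ) i = if i ∈ t then 1 else 0 := by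
      intro i
      simp [Finsupp.finsetSum_apply, Finsupp.single_apply]
    rw [Finsupp.ext_iff]
    simp only [ht]
    constructor
    · intro h
      have : t = d.support := by
        ext i
        rw [Finsupp.mem_support_iff, ← h i]
        simp
      refine ⟨this, fun i hi => ?_⟩
      rw [← h i, if_pos (this ▸ hi)]
    · rintro ⟨rfl, h⟩ i
      split_ifs with hi
      · exact (h i hi).symm
      · simpa [eq_comm] using hi
  change (if _ then (1 : ℚ) else 0) = _
  have hc : (∀ i ∈ (d.embDomain Fin.valEmbedding).support,
      d.embDomain Fin.valEmbedding i = 1) ↔ ∀ i ∈ d.support, d i = 1 := by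
    have (i : Fin M) : d.embDomain Fin.valEmbedding (i : ℕ) = d i :=
      Finsupp.embDomain_apply_self _ _ _
    simp [Finsupp.support_embDomain, this]
  have hsum : (d.embDomain Fin.valEmbedding).sum (fun _ v => v) = d.sum fun _ v => v :=
    Finsupp.sum_embDomain
  simp only [hc, hsum]
  by_cases h1 : ∀ i ∈ d.support, d i = 1
  · have hcard : d.sum (fun _ v => v) = #d.support := by
      rw [Finsupp.sum, sum_congr rfl h1]
      simp
    simp only [hs, eq_true h1, and_true, true_and, hcard, sum_ite_eq', mem_powersetCard_univ]
  · simp only [hs, eq_false h1, and_false, false_and, if_false, sum_const_zero]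

theorem newtonSum_esymm (M j : ℕ) :
    newtonSum (esymm (Fin M) ℚ) (j + 1) = -∑ c : Fin M, (-X c) ^ (j + 1) := by
  refine (eq_newtonSum (t := fun n => -∑ c : Fin M, (-X c) ^ n) (esymm_zero _ _) (N := j + 1)
    (fun n _ => ?_) j (Nat.lt_succ_self j)).symm
  have h := mul_esymm_eq_sum (Fin M) ℚ (n + 1)
  rw [sum_filter, Nat.sum_antidiagonal_eq_sum_range_succ_mk, sum_range_succ] at h
  push_cast at h
  rw [h, ← sum_range_reflect]
  simp only [lt_irrefl, if_false, add_zero, mul_sum]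
  refine sum_congr rfl fun i hi => ?_
  have hi : i ≤ n := Nat.lt_succ_iff.1 (mem_range.1 hi)
  obtain ⟨k, rfl⟩ := Nat.exists_eq_add_of_le hi
  rw [if_pos (by omega), show i + k + 1 - 1 - i = k by omega, show i + k + 1 - i = k + 1 by omega,
    show i + k - k = i by omega, psum]
  simp only [neg_pow (X _ : MvPolynomial (Fin M) ℚ) (k + 1), ← mul_sum]
  have : ((-1 : MvPolynomial (Fin M) ℚ)) ^ (i + i) = 1 := Even.neg_one_pow ⟨i, rfl⟩
  linear_combination ((-1) ^ (k + 1) * (∑ c, X c ^ (k + 1)) * esymm (Fin M) ℚ i) * this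

theorem sunGraph_proper_iff {ι : Type*} {lam : Fin 3 → ℕ}
    (κ : Fin 3 ⊕ ((i : Fin 3) × Fin (lam i)) → ι) :
    (∀ u v, (sunGraph 3 lam).Adj u v → κ u ≠ κ v) ↔
      (κ (.inl 0) ≠ κ (.inl 1) ∧ κ (.inl 1) ≠ κ (.inl 2) ∧ κ (.inl 2) ≠ κ (.inl 0)) ∧
        ∀ i, IsRay (κ (.inl i)) fun j => κ (.inr ⟨i, j⟩) := by
  simp only [sunGraph, SimpleGraph.fromRel_adj]
  constructor
  · intro h
    refine ⟨⟨h _ _ ⟨by simp, .inl ?_⟩, h _ _ ⟨by simp, .inl ?_⟩, h _ _ ⟨by simp, .inl ?_⟩⟩,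
      fun i => ⟨fun j hj => h _ _ ⟨by simp, .inl ?_⟩, fun j k hk => h _ _ ⟨?_, .inl ?_⟩⟩⟩
    · simp [sunRel]
    · simp [sunRel]
    · simp [sunRel]
    · exact ⟨rfl, hj⟩
    · simp [Fin.ext_iff, hk]
    · exact ⟨rfl, hk⟩
  · rintro ⟨⟨h01, h12, h20⟩, hr⟩
    have key : ∀ u v, sunRel 3 lam (fun i i' => (i' : ℕ) = ((i : ℕ) + 1) % 3) u v →
        κ u ≠ κ v := by
      rintro (i | ⟨i, j⟩) (i' | ⟨i', j'⟩) h
      · fin_cases i <;> fin_cases i' <;> simp_all [sunRel]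
      · obtain ⟨h1, h2⟩ := h
        dsimp at h1 h2
        subst h1
        exact (hr _).1 _ h2
      · exact h.elim
      · obtain ⟨h1, h2⟩ := h
        dsimp at h1 h2
        subst h1
        exact (hr _).2 _ _ h2
    rintro u v ⟨-, h | h⟩
    · exact key _ _ h
    · exact (key _ _ h).symm

theorem sum_fin_three {R ι : Type*} [AddCommMonoid R] [Fintype ι] (F : ι → ι → ι → R) :
    ∑ c : Fin 3 → ι, F (c 0) (c 1) (c 2) = ∑ a, ∑ b, ∑ c, F a b c := by
  rw [← (Fin.consEquiv fun _ => ι).sum_comp, Fintype.sum_prod_type]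
  refine sum_congr rfl fun a _ => ?_
  rw [← (Fin.consEquiv fun _ => ι).sum_comp, Fintype.sum_prod_type]
  refine sum_congr rfl fun b _ => ?_
  rw [← (Fin.consEquiv fun _ => ι).sum_comp, Fintype.sum_prod_type]
  exact sum_congr rfl fun c _ => Fintype.sum_unique _

theorem finCsf_sunGraph (lam : Fin 3 → ℕ) (M : ℕ) :
    finCsf (sunGraph 3 lam) M =
      sunVal (newtonSum (esymm (Fin M) ℚ)) (lam 0 + 1) (lam 1 + 1) (lam 2 + 1) := by
  classical
  set t := newtonSum (esymm (Fin M) ℚ)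
  let x : Fin M → MvPolynomial (Fin M) ℚ := X
  have ht : ∀ j, t (j + 1) = -∑ c : Fin M, (-x c) ^ (j + 1) := newtonSum_esymm M
  have hc (col : Fin 3 → Fin M) : ∑ r : (i : Fin 3) → Fin (lam i) → Fin M,
      (if (col 0 ≠ col 1 ∧ col 1 ≠ col 2 ∧ col 2 ≠ col 0) ∧ ∀ i, IsRay (col i) (r i) then
        (∏ i, x (col i)) * ∏ i, ∏ j, x (r i j) else 0) =
      if col 0 ≠ col 1 ∧ col 1 ≠ col 2 ∧ col 2 ≠ col 0 then
        firstVal t (x (col 0)) (lam 0 + 1) * firstVal t (x (col 1)) (lam 1 + 1) *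
          firstVal t (x (col 2)) (lam 2 + 1) else 0 := by
    have h := sum_rays ht lam col
    rw [Fin.prod_univ_three (fun i => firstVal t (x (col i)) (lam i + 1))] at h
    rw [← h]
    split_ifs with hd
    · refine sum_congr rfl fun r _ => ?_
      by_cases hr : ∀ i, IsRay (col i) (r i)
      · rw [if_pos ⟨hd, hr⟩, if_pos hr]
      · rw [if_neg fun h => hr h.2, if_neg hr]
    · simp [hd]
  have e : finCsf (sunGraph 3 lam) M = ∑ col : Fin 3 → Fin M,
      ∑ r : (i : Fin 3) → Fin (lam i) → Fin M,
      (if (col 0 ≠ col 1 ∧ col 1 ≠ col 2 ∧ col 2 ≠ col 0) ∧ ∀ i, IsRay (col i) (r i) then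
        (∏ i, x (col i)) * ∏ i, ∏ j, x (r i j) else 0) := by
    rw [← Fintype.sum_prod_type']
    refine Fintype.sum_equiv ((Equiv.sumArrowEquivProdArrow _ _ _).trans
      ((Equiv.refl _).prodCongr (Equiv.piCurry fun _ _ => Fin M))) _ _ fun κ => ?_
    simp only [sunGraph_proper_iff]
    rw [Fintype.prod_sum_type, Fintype.prod_sigma]
    rfl
  rw [e, Fintype.sum_congr _ _ hc, sum_fin_three fun i j k =>
    if i ≠ j ∧ j ≠ k ∧ k ≠ i then firstVal t (x i) (lam 0 + 1) * firstVal t (x j) (lam 1 + 1) *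
          firstVal t (x k) (lam 2 + 1) else 0, sum_distinct]
  simp only [sum_firstVal_succ ht, sum_firstVal_mul_firstVal ht,
    sum_firstVal_mul_firstVal_mul_firstVal ht, x, sunVal]
  ring

end FiniteVariables

section Specialization

open MvPolynomial

/-- A symmetric function identity holds as soon as it holds in finitely many variables. -/
theorem csf_sunGraph (lam : Fin 3 → ℕ) :
    csf (sunGraph 3 lam) = sunVal (newtonSum esym) (lam 0 + 1) (lam 1 + 1) (lam 2 + 1) := by
  ext d
  obtain ⟨M, hM⟩ := d.support.exists_nat_subset_range
  have hd : (d.comapDomain (Fin.valEmbedding : Fin M ↪ ℕ)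
      Fin.val_injective.injOn).embDomain Fin.valEmbedding = d := by
    rw [Finsupp.embDomain_eq_mapDomain]
    refine Finsupp.mapDomain_comapDomain _ Fin.val_injective _ fun i hi => ?_
    exact ⟨⟨i, mem_range.1 (hM hi)⟩, rfl⟩
  have h : MvPowerSeries.killCompl (Fin.valEmbedding : Fin M ↪ ℕ) (csf (sunGraph 3 lam)) =
      MvPowerSeries.killCompl (Fin.valEmbedding : Fin M ↪ ℕ)
        (sunVal (newtonSum esym) (lam 0 + 1) (lam 1 + 1) (lam 2 + 1)) := by
    rw [killCompl_csf, finCsf_sunGraph, ← coeToMvPowerSeries.ringHom_apply,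
      map_sunVal_newtonSum, map_sunVal_newtonSum]
    simp only [killCompl_esym, coeToMvPowerSeries.ringHom_apply]
  rw [← hd, ← MvPowerSeries.coeff_killCompl, h, MvPowerSeries.coeff_killCompl]

theorem sunVal_mem_of_ePositive {lam : Fin 3 → ℕ} (h : EPositive (csf (sunGraph 3 lam)))
    {R : Type*} [CommRing R] [Algebra ℚ R] {v : ℕ → R} (hv0 : v 0 = 1) {M : ℕ}
    (hvM : ∀ k, M < k → v k = 0) (S : Subsemiring R)
    (hS : ∀ q : ℚ, 0 ≤ q → algebraMap ℚ R q ∈ S) (hv : ∀ k, v k ∈ S) :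
    sunVal (newtonSum v) (lam 0 + 1) (lam 1 + 1) (lam 2 + 1) ∈ S := by
  obtain ⟨c, hc, -, hf⟩ := h
  let w : ℕ → MvPolynomial (Fin M) ℚ := fun k =>
    if k = 0 then 1 else if hk : k - 1 < M then X ⟨k - 1, hk⟩ else 0
  let φ := aeval (R := ℚ) fun i : Fin M => esymm (Fin M) ℚ (i + 1)
  have hφ : Function.Injective φ := fun p q hpq =>
    esymmAlgHom_fin_injective ℚ le_rfl <| Subtype.ext <| by
      simpa only [esymmAlgHom_apply] using hpq
  have hw : ∀ k, φ (w k) = esymm (Fin M) ℚ k := by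
    intro k
    by_cases h0 : k = 0
    · simp [w, h0]
    · by_cases hk : k - 1 < M
      · simp only [w, h0, hk, if_false, dif_pos, φ, aeval_X]
        rw [Nat.sub_add_cancel (Nat.pos_of_ne_zero h0)]
      · simp only [w, h0, hk, if_false, dif_neg, not_false_eq_true, map_zero]
        rw [esymm, powersetCard_eq_empty.2, sum_empty]
        simp
        omega
  have key : sunVal (newtonSum w) (lam 0 + 1) (lam 1 + 1) (lam 2 + 1) =
      c.sum fun μ a => a • (μ.map w).prod := by
    apply hφ
    apply MvPolynomial.coe_injective (Fin M) ℚ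
    have h1 := congrArg (MvPowerSeries.killCompl (Fin.valEmbedding : Fin M ↪ ℕ)) hf
    rw [killCompl_csf, finCsf_sunGraph] at h1
    have h2 : φ (sunVal (newtonSum w) (lam 0 + 1) (lam 1 + 1) (lam 2 + 1)) =
        sunVal (newtonSum (esymm (Fin M) ℚ)) (lam 0 + 1) (lam 1 + 1) (lam 2 + 1) := by
      simp only [map_sunVal_newtonSum, hw]
    rw [h2, h1]
    simp only [Finsupp.sum, map_sum, map_smul, map_multiset_prod, Multiset.map_map, esymM,
      Function.comp_def, hw, killCompl_esym]
    rw [← coeToMvPowerSeries.ringHom_apply, map_sum]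
    refine sum_congr rfl fun μ _ => ?_
    rw [coeToMvPowerSeries.ringHom_apply, MvPolynomial.coe_smul,
      ← coeToMvPowerSeries.ringHom_apply, map_multiset_prod, Multiset.map_map]
    rfl
  have hwv : ∀ k, aeval (R := ℚ) (fun i : Fin M => v (i + 1)) (w k) = v k := by
    intro k
    by_cases h0 : k = 0
    · simp [w, h0, hv0]
    · by_cases hk : k - 1 < M
      · simp only [w, h0, hk, if_false, dif_pos, aeval_X]
        rw [Nat.sub_add_cancel (Nat.pos_of_ne_zero h0)]
      · simp only [w, h0, hk, if_false, dif_neg, not_false_eq_true, map_zero]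
        rw [hvM k (by omega)]
  have h := congrArg (aeval (R := ℚ) fun i : Fin M => v (i + 1)) key
  simp only [map_sunVal_newtonSum, Finsupp.sum, map_sum, map_smul, map_multiset_prod,
    Multiset.map_map, Function.comp_def, hwv] at h
  rw [h]
  simp only [Algebra.smul_def]
  refine S.sum_mem fun μ _ => S.mul_mem (hS _ (hc μ)) (S.multiset_prod_mem _ fun x hx => ?_)
  obtain ⟨k, -, rfl⟩ := Multiset.mem_map.1 hx
  exact hv k

end Specialization

section Positivity

theorem ePositive_zero : EPositive 0 := ⟨0, by simp, by simp, by simp⟩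

theorem EPositive.add {f g : MvPowerSeries ℕ ℚ} (hf : EPositive f) (hg : EPositive g) :
    EPositive (f + g) := by
  classical
  obtain ⟨c, hc, hc0, rfl⟩ := hf
  obtain ⟨d, hd, hd0, rfl⟩ := hg
  refine ⟨c + d, fun μ => add_nonneg (hc μ) (hd μ), fun μ hμ => ?_, ?_⟩
  · exact (mem_union.1 (Finsupp.support_add hμ)).elim (hc0 μ) (hd0 μ)
  · rw [Finsupp.sum_add_index] <;> simp [add_smul]

theorem ePositive_smul_esymM {a : ℚ} (ha : 0 ≤ a) {μ : Multiset ℕ} (hμ : 0 ∉ μ) :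
    EPositive (a • esymM μ) := by
  refine ⟨Finsupp.single μ a, fun ν => ?_, fun ν hν => ?_, by simp⟩
  · classical
    rw [Finsupp.single_apply]
    split_ifs <;> simp [ha]
  · rwa [mem_singleton.1 (Finsupp.support_single_subset hν)]

theorem ePositive_sum {α : Type*} {s : Finset α} {f : α → MvPowerSeries ℕ ℚ}
    (h : ∀ i ∈ s, EPositive (f i)) : EPositive (∑ i ∈ s, f i) :=
  sum_induction f EPositive (fun _ _ => EPositive.add) ePositive_zero h

theorem EPositive.mul {f g : MvPowerSeries ℕ ℚ} (hf : EPositive f) (hg : EPositive g) :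
    EPositive (f * g) := by
  obtain ⟨c, hc, hc0, rfl⟩ := hf
  obtain ⟨d, hd, hd0, rfl⟩ := hg
  rw [Finsupp.sum, Finsupp.sum, sum_mul_sum]
  refine ePositive_sum fun μ hμ => ePositive_sum fun ν hν => ?_
  have : c μ • esymM μ * d ν • esymM ν = (c μ * d ν) • esymM (μ + ν) := by
    rw [smul_mul_smul_comm, esymM, esymM, esymM, Multiset.map_add, Multiset.prod_add]
  rw [this]
  exact ePositive_smul_esymM (mul_nonneg (hc μ) (hd ν)) fun h =>
    (Multiset.mem_add.1 h).elim (hc0 μ hμ) (hd0 ν hν)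

theorem ePositive_one : EPositive 1 := by
  simpa [esymM] using ePositive_smul_esymM zero_le_one (Multiset.notMem_zero 0)

/-- The `e`-positive symmetric functions form a subsemiring. -/
def ePositiveSubsemiring : Subsemiring (MvPowerSeries ℕ ℚ) where
  carrier := {f | EPositive f}
  zero_mem' := ePositive_zero
  one_mem' := ePositive_one
  add_mem' := EPositive.add
  mul_mem' := EPositive.mul

theorem esym_mem_ePositiveSubsemiring (k : ℕ) : esym (k + 1) ∈ ePositiveSubsemiring := by
  have := ePositive_smul_esymM (zero_le_one' ℚ) (μ := {k + 1}) (by simp)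
  simpa [esymM] using! this

theorem esym_zero : esym 0 = 1 := by
  classical
  ext d
  rw [MvPowerSeries.coeff_one]
  change (if _ then (1 : ℚ) else 0) = _
  refine if_congr ⟨fun h => ?_, ?_⟩ rfl rfl
  · ext i
    by_contra hi
    have h1 := h.1 i (Finsupp.mem_support_iff.2 hi)
    have h2 := sum_eq_zero_iff.1 h.2 i (Finsupp.mem_support_iff.2 hi)
    exact hi h2
  · rintro rfl
    simp

theorem sunVal_five_three_three {R : Type*} [CommRing R] {v : ℕ → R} (hv : v 0 = 1) :
    sunVal (newtonSum v) 5 3 3 =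
      12 * v 1 ^ 2 * v 2 ^ 2 * v 5 + 12 * v 1 ^ 2 * v 2 * v 3 * v 4 + 24 * v 1 ^ 2 * v 2 * v 7 +
      20 * v 1 ^ 2 * v 3 * v 6 + 12 * v 1 ^ 2 * v 4 * v 5 + 16 * v 1 ^ 2 * v 9 +
      24 * v 1 * v 2 ^ 3 * v 4 + 18 * v 1 * v 2 ^ 2 * v 3 ^ 2 + 84 * v 1 * v 2 ^ 2 * v 6 +
      116 * v 1 * v 2 * v 3 * v 5 + 36 * v 1 * v 2 * v 4 ^ 2 + 100 * v 1 * v 2 * v 8 +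
      22 * v 1 * v 3 ^ 2 * v 4 + 84 * v 1 * v 3 * v 7 + 42 * v 1 * v 4 * v 6 +
      12 * v 1 * v 5 ^ 2 + 38 * v 1 * v 10 + 12 * v 2 ^ 4 * v 3 + 60 * v 2 ^ 3 * v 5 +
      112 * v 2 ^ 2 * v 3 * v 4 + 110 * v 2 ^ 2 * v 7 + 26 * v 2 * v 3 ^ 3 +
      170 * v 2 * v 3 * v 6 + 90 * v 2 * v 4 * v 5 + 86 * v 2 * v 9 + 46 * v 3 ^ 2 * v 5 +
      14 * v 3 * v 4 ^ 2 + 74 * v 3 * v 8 + 34 * v 4 * v 7 + 8 * v 5 * v 6 + 22 * v 11 := by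
  have t1 := newtonSum_succ v 0
  have t2 := newtonSum_succ v 1
  have t3 := newtonSum_succ v 2
  have t4 := newtonSum_succ v 3
  have t5 := newtonSum_succ v 4
  have t6 := newtonSum_succ v 5
  have t7 := newtonSum_succ v 6
  have t8 := newtonSum_succ v 7
  have t9 := newtonSum_succ v 8
  have t10 := newtonSum_succ v 9
  have t11 := newtonSum_succ v 10
  have p1 := pathVal_newtonSum_succ hv 0
  have p2 := pathVal_newtonSum_succ hv 1
  have p3 := pathVal_newtonSum_succ hv 2
  have p4 := pathVal_newtonSum_succ hv 3
  have p5 := pathVal_newtonSum_succ hv 4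
  simp only [sum_range_succ, sum_range_zero, Nat.reduceAdd, Nat.reduceSub, pathVal_zero]
    at t1 t2 t3 t4 t5 t6 t7 t8 t9 t10 t11 p1 p2 p3 p4 p5
  push_cast at t1 t2 t3 t4 t5 t6 t7 t8 t9 t10 t11 p1 p2 p3 p4 p5
  ring_nf at t1
  rw [t1] at t2
  ring_nf at t2
  rw [t1, t2] at t3
  ring_nf at t3
  rw [t1, t2, t3] at t4
  ring_nf at t4
  rw [t1, t2, t3, t4] at t5
  ring_nf at t5
  rw [t1, t2, t3, t4, t5] at t6
  ring_nf at t6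
  rw [t1, t2, t3, t4, t5, t6] at t7
  ring_nf at t7
  rw [t1, t2, t3, t4, t5, t6, t7] at t8
  ring_nf at t8
  rw [t1, t2, t3, t4, t5, t6, t7, t8] at t9
  ring_nf at t9
  rw [t1, t2, t3, t4, t5, t6, t7, t8, t9] at t10
  ring_nf at t10
  rw [t1, t2, t3, t4, t5, t6, t7, t8, t9, t10] at t11
  ring_nf at t11
  rw [p1] at p3
  rw [p1, p2] at p4
  rw [p1, p2, p3] at p5
  simp only [sunVal, pairVal, tripleVal, tailVal, sum_range_succ, sum_range_zero, Nat.reduceAdd,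
    Nat.reduceSub, pathVal_zero]
  simp only [t2, t3, t4, t5, t6, t7, t8, t9, t10, t11, p1, p2, p3, p4, p5]
  ring

theorem sunVal_five_three_three_mem {R : Type*} [CommRing R] {v : ℕ → R} (hv : v 0 = 1)
    {S : Subsemiring R} (hS : ∀ k, v (k + 1) ∈ S) : sunVal (newtonSum v) 5 3 3 ∈ S := by
  rw [sunVal_five_three_three hv]
  have hn (n : ℕ) [n.AtLeastTwo] : (OfNat.ofNat n : R) ∈ S := ofNat_mem S n
  repeat' first
    | exact hS _
    | exact hn _
    | refine S.add_mem ?_ ?_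
    | refine S.mul_mem ?_ ?_
    | refine S.pow_mem ?_ _

theorem ePositive_csf_sunGraph_four_two_two : EPositive (csf (sunGraph 3 ![4, 2, 2])) := by
  rw [csf_sunGraph]
  exact sunVal_five_three_three_mem esym_zero esym_mem_ePositiveSubsemiring

end Positivity

section LongRays

variable {R : Type*} [CommRing R]

theorem pathVal_eq_zero {t : ℕ → R} {B : ℕ} (ht : ∀ j, 0 < j → j ≤ B → t j = 0) :
    ∀ j, 0 < j → j ≤ B → pathVal t j = 0 := by
  rintro (_ | n) h0 hn
  · exact absurd h0 (lt_irrefl 0)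
  · rw [pathVal_succ]
    refine sum_eq_zero fun i hi => ?_
    rw [ht _ i.succ_pos (by have := mem_range.1 hi; omega), zero_mul]

theorem sum_range_mul_pathVal_of_eq_zero {t : ℕ → R} {n : ℕ}
    (ht : ∀ j, 0 < j → j ≤ n → t j = 0) (f : ℕ → R) :
    ∑ j ∈ range (n + 1), f j * pathVal t (n - j) = f n := by
  rw [sum_range_succ, sum_eq_zero fun j hj => ?_]
  · simp
  · have := mem_range.1 hj
    rw [pathVal_eq_zero ht _ (by omega) (by omega), mul_zero]

theorem sunVal_of_eq_zero {t : ℕ → R} {A B : ℕ} (h1 : ∀ j, 0 < j → j ≤ B + 1 → t j = 0)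
    (h2 : ∀ j, 2 * (B + 1) ≤ j → j < A + 1 + 2 * (B + 1) → t j = 0) :
    sunVal t (A + 1) (B + 1) (B + 1) = 2 * t (A + 1 + 2 * (B + 1)) := by
  have hB (f : ℕ → R) : ∑ j ∈ range (B + 1), f j * pathVal t (B - j) = f B :=
    sum_range_mul_pathVal_of_eq_zero (fun j h0 hj => h1 j h0 (by omega)) f
  have hP : pathVal t (B + 1) = 0 := pathVal_eq_zero h1 _ B.succ_pos le_rfl
  have hpair : pairVal t (B + 1) (B + 1) = 0 := by
    simp only [pairVal, tailVal, Nat.add_sub_cancel, hB]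
    exact h2 _ (by omega) (by omega)
  have htriple : tripleVal t (A + 1) (B + 1) (B + 1) = t (A + 1 + 2 * (B + 1)) := by
    simp only [tripleVal, tailVal, Nat.add_sub_cancel, hB]
    rw [sum_range_succ, sum_eq_zero fun i hi => ?_]
    · simp only [Nat.sub_self, pathVal_zero, mul_one, zero_add]
      congr 1
      omega
    · have := mem_range.1 hi
      rw [h2 _ (by omega) (by omega), zero_mul]
  rw [sunVal, hP, hpair, htriple]
  ring

/-- The sequence `h` with `h_0 = 1` whose signed power sums, in the sense of Newton's
identities, are `t`. -/
def ofNewtonSum (t : ℕ → ℚ) : ℕ → ℚ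
  | 0 => 1
  | n + 1 => (∑ i : Fin (n + 1), t (i + 1) * ofNewtonSum t (n - i)) / (n + 1)

theorem ofNewtonSum_identity (t : ℕ → ℚ) (n : ℕ) :
    ∑ i ∈ range (n + 1), t (i + 1) * ofNewtonSum t (n - i) =
      (n + 1) * ofNewtonSum t (n + 1) := by
  rw [ofNewtonSum, Fin.sum_univ_eq_sum_range (fun i => t (i + 1) * ofNewtonSum t (n - i)),
    mul_div_cancel₀ _ (by positivity)]

theorem ofNewtonSum_nonneg {t : ℕ → ℚ} (ht : ∀ j, 0 ≤ t j) (n : ℕ) : 0 ≤ ofNewtonSum t n := by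
  induction n using Nat.strong_induction_on with
  | _ n ih =>
    cases n with
    | zero => simp [ofNewtonSum]
    | succ n =>
      rw [ofNewtonSum]
      exact div_nonneg (sum_nonneg fun i _ => mul_nonneg (ht _) (ih _ (by omega))) (by positivity)

theorem ofNewtonSum_pos {t : ℕ → ℚ} (ht : ∀ j, 0 ≤ t j) {j m : ℕ} (hj : 0 < t (j + 1))
    (hm : 0 < ofNewtonSum t m) : 0 < ofNewtonSum t (j + 1 + m) := by
  have h := ofNewtonSum_identity t (j + m)
  have hpos : 0 < ∑ i ∈ range (j + m + 1), t (i + 1) * ofNewtonSum t (j + m - i) := by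
    refine sum_pos' (fun i _ => mul_nonneg (ht _) (ofNewtonSum_nonneg ht _))
      ⟨j, by simp, mul_pos hj ?_⟩
    rwa [Nat.add_sub_cancel_left]
  rw [h] at hpos
  rw [show j + 1 + m = j + m + 1 by omega]
  exact pos_of_mul_pos_right hpos (by positivity)

/-- The indicator sequence of `[B + 1, 2 B - 1]`. -/
def middleIndicator (B j : ℕ) : ℚ := if B + 1 ≤ j ∧ j + 1 ≤ 2 * B then 1 else 0

theorem middleIndicator_nonneg (B j : ℕ) : 0 ≤ middleIndicator B j := by
  unfold middleIndicator
  split_ifs <;> norm_num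

theorem ofNewtonSum_middleIndicator_pos {B : ℕ} (hB : 3 ≤ B) (n : ℕ) (hn : 2 * B + 2 ≤ n)
    (h : ¬(B = 3 ∧ n = 11)) : 0 < ofNewtonSum (middleIndicator B) n := by
  have step : ∀ j m, B + 1 ≤ j → j + 1 ≤ 2 * B → 0 < ofNewtonSum (middleIndicator B) m →
      0 < ofNewtonSum (middleIndicator B) (j + m) := by
    rintro (_ | j) m h1 h2 hm
    · omega
    · exact ofNewtonSum_pos (middleIndicator_nonneg B) (by simp [middleIndicator, h1, h2]) hm
  have one : ∀ j, B + 1 ≤ j → j + 1 ≤ 2 * B → 0 < ofNewtonSum (middleIndicator B) j :=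
    fun j h1 h2 => step j 0 h1 h2 (by simp [ofNewtonSum])
  induction n using Nat.strong_induction_on with
  | _ n ih =>
    have split : ∀ j ≤ n, B + 1 ≤ j → j + 1 ≤ 2 * B →
        0 < ofNewtonSum (middleIndicator B) (n - j) → 0 < ofNewtonSum (middleIndicator B) n :=
      fun j hj h1 h2 hm => by simpa [Nat.add_sub_cancel' hj] using step j _ h1 h2 hm
    by_cases h1 : n ≤ 3 * B
    · exact split (B + 1) (by omega) le_rfl (by omega) (one _ (by omega) (by omega))
    by_cases h2 : n + 2 ≤ 4 * B
    · exact split (2 * B - 1) (by omega) (by omega) (by omega) (one _ (by omega) (by omega))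
    by_cases h3 : B = 3 ∧ n = 15
    · exact split 5 (by omega) (by omega) (by omega) (ih _ (by omega) (by omega) (by omega))
    · exact split (B + 1) (by omega) le_rfl (by omega) (ih _ (by omega) (by omega) (by omega))

theorem not_ePositive_of_two_le {a b : ℕ} (ha : 0 < a) (hb : 2 ≤ b) (h : ¬(a = 4 ∧ b = 2)) :
    ¬EPositive (csf (sunGraph 3 ![a, b, b])) := by
  intro hpos
  let N := a + 1 + 2 * (b + 1)
  let t := middleIndicator (b + 1)
  let v : ℕ → ℚ := fun k => if k < N then ofNewtonSum t k else 0
  have hv0 : v 0 = 1 := by simp [v, N, ofNewtonSum]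
  have hnonneg : ∀ k, 0 ≤ v k := fun k => by
    simp only [v]
    split_ifs
    exacts [ofNewtonSum_nonneg (middleIndicator_nonneg _) k, le_rfl]
  have hmem := sunVal_mem_of_ePositive hpos hv0 (M := N) (fun k hk => if_neg (by omega))
    (Subsemiring.nonneg ℚ) (fun q hq => hq) hnonneg
  have ht : ∀ n < N - 1, t (n + 1) = newtonSum v (n + 1) := by
    refine eq_newtonSum hv0 fun n hn => ?_
    simp only [v]
    rw [if_pos (by omega), ← ofNewtonSum_identity]
    exact sum_congr rfl fun i _ => by rw [if_pos (by omega)]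
  have ht' : ∀ j, 0 < j → j < N → newtonSum v j = t j := by
    rintro (_ | j) h0 hj
    · exact absurd h0 (lt_irrefl 0)
    · exact (ht j (by omega)).symm
  have hN : newtonSum v N = -(N * ofNewtonSum t N) := by
    obtain ⟨n, hn⟩ : ∃ n, N = n + 1 := ⟨a + 2 * (b + 1), by omega⟩
    have hid := ofNewtonSum_identity t n
    rw [sum_range_succ] at hid
    have htn : t (n + 1) = 0 := if_neg (by omega)
    rw [hn, newtonSum_succ, show v (n + 1) = 0 from if_neg (by omega)]
    push_cast
    rw [← hid, htn, sum_congr rfl fun i hi => ?_]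
    · ring
    · have := mem_range.1 hi
      rw [ht' _ (by omega) (by omega)]
      simp only [v]
      rw [if_pos (by omega)]
  have hval : sunVal (newtonSum v) (a + 1) (b + 1) (b + 1) = 2 * newtonSum v N := by
    refine sunVal_of_eq_zero (fun j h0 hj => ?_) fun j h0 hj => ?_
    · rw [ht' j h0 (by omega)]
      exact if_neg (by omega)
    · rw [ht' j (by omega) hj]
      exact if_neg (by omega)
  have hpos := ofNewtonSum_middleIndicator_pos (B := b + 1) (by omega) N (by omega) (by omega)
  have hle : 0 ≤ sunVal (newtonSum v) (a + 1) (b + 1) (b + 1) := hmem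
  rw [hval, hN] at hle
  have : 0 < (N : ℚ) * ofNewtonSum t N := mul_pos (by positivity) hpos
  linarith

end LongRays

section ShortRays

theorem sunVal_two_two {R : Type*} [CommRing R] {t : ℕ → R} (h1 : t 1 = 0) (A : ℕ) :
    sunVal t A 2 2 = 2 * pathVal t (A + 4) - 2 * t 3 * pathVal t (A + 1) -
      (t 2 ^ 2 + t 4) * pathVal t A := by
  have p1 : pathVal t 1 = 0 := by simp [pathVal_succ, h1]
  have p2 : pathVal t 2 = t 2 := by simp [pathVal_succ, sum_range_succ, h1]
  have s1 (A) : tailVal t 1 A = pathVal t (A + 1) := by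
    have := tailVal_succ t 0 A
    rw [tailVal_zero_succ, h1] at this
    simpa using this.symm
  have s2 (A) := tailVal_succ t 1 A
  have s3 (A) := tailVal_succ t 2 A
  have s4 (A) := tailVal_succ t 3 A
  have hp : pairVal t 2 2 = t 4 := by
    simp [pairVal, tailVal, sum_range_succ, p1]
  simp only [s1, Nat.reduceAdd] at s2 s3 s4
  rw [sunVal, hp, p2]
  simp only [pairVal, tripleVal, sum_range_succ, sum_range_zero, p1, Nat.reduceAdd,
    Nat.reduceSub, pathVal_zero]
  linear_combination (-2 * t 2) * s2 A - 2 * s4 A - 2 * s3 (A + 1) - 2 * s2 (A + 2)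

/-- A first order deformation of the specialization `e_3 = 1`, `e_k = 0` for `k ≠ 0, 3`. -/
def dualVal (k : ℕ) : DualNumber ℚ :=
  if k = 0 ∨ k = 3 then 1 else if k = 2 ∨ k = 4 then DualNumber.eps else 0

theorem pathVal_dualVal_add_five (m : ℕ) :
    pathVal (newtonSum dualVal) (m + 5) = 2 * pathVal (newtonSum dualVal) (m + 2) +
      DualNumber.eps * (pathVal (newtonSum dualVal) (m + 3) +
        3 * pathVal (newtonSum dualVal) (m + 1)) := by
  rw [pathVal_newtonSum_succ (by simp [dualVal]), sum_range_succ', sum_range_succ',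
    sum_range_succ', sum_eq_zero fun i _ => by simp [dualVal]]
  simp [dualVal]
  ring

/-- The dual numbers with nonnegative components form a subsemiring. -/
def dualNonneg : Subsemiring (DualNumber ℚ) where
  carrier := {x | 0 ≤ x.fst ∧ 0 ≤ x.snd}
  zero_mem' := by simp
  one_mem' := by simp
  add_mem' hx hy := ⟨add_nonneg hx.1 hy.1, add_nonneg hx.2 hy.2⟩
  mul_mem' {x y} hx hy := by
    refine ⟨mul_nonneg hx.1 hy.1, ?_⟩
    rw [DualNumber.snd_mul]
    exact add_nonneg (mul_nonneg hx.1 hy.2) (mul_nonneg hx.2 hy.1)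

theorem pathVal_dualVal_one : pathVal (newtonSum dualVal) 1 = 0 := by
  simp [pathVal_newtonSum_succ, dualVal]

theorem pathVal_dualVal_two : pathVal (newtonSum dualVal) 2 = 2 * DualNumber.eps := by
  rw [pathVal_newtonSum_succ (by simp [dualVal])]
  simp [dualVal]
  ring

theorem pathVal_dualVal_three : pathVal (newtonSum dualVal) 3 = 3 := by
  rw [pathVal_newtonSum_succ (by simp [dualVal])]
  simp [sum_range_succ, dualVal, pathVal_dualVal_one]
  ring

theorem pathVal_dualVal_four : pathVal (newtonSum dualVal) 4 = 4 * DualNumber.eps := by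
  rw [pathVal_newtonSum_succ (by simp [dualVal])]
  simp [sum_range_succ, dualVal, pathVal_dualVal_one, pathVal_dualVal_two]
  linear_combination 2 * DualNumber.eps_mul_eps (R := ℚ)

theorem fst_ofNat (n : ℕ) [n.AtLeastTwo] :
    (ofNat(n) : DualNumber ℚ).fst = ofNat(n) := rfl

theorem snd_ofNat (n : ℕ) [n.AtLeastTwo] : (ofNat(n) : DualNumber ℚ).snd = 0 :=
  TrivSqZeroExt.snd_natCast n

theorem fst_pathVal_dualVal_add_four (m : ℕ) :
    (pathVal (newtonSum dualVal) (m + 4)).fst = 2 * (pathVal (newtonSum dualVal) (m + 1)).fst := by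
  cases m with
  | zero => simp [pathVal_dualVal_one, pathVal_dualVal_four]
  | succ m => simp [fst_ofNat, pathVal_dualVal_add_five m]

theorem snd_pathVal_dualVal_add_five (m : ℕ) :
    (pathVal (newtonSum dualVal) (m + 5)).snd = 2 * (pathVal (newtonSum dualVal) (m + 2)).snd +
      (pathVal (newtonSum dualVal) (m + 3)).fst +
        3 * (pathVal (newtonSum dualVal) (m + 1)).fst := by
  simp [pathVal_dualVal_add_five m, fst_ofNat, snd_ofNat]
  ring

theorem fst_pathVal_dualVal (k : ℕ) :
    (pathVal (newtonSum dualVal) (3 * k + 1)).fst = 0 ∧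
      (pathVal (newtonSum dualVal) (3 * k + 2)).fst = 0 ∧
      (pathVal (newtonSum dualVal) (3 * k + 3)).fst = 3 * 2 ^ k := by
  induction k with
  | zero => simp [pathVal_dualVal_one, pathVal_dualVal_two, pathVal_dualVal_three, fst_ofNat]
  | succ k ih =>
    have h (m : ℕ) := fst_pathVal_dualVal_add_four (3 * k + m)
    refine ⟨(h 0).trans ?_, (h 1).trans ?_, (h 2).trans ?_⟩
    · simp [ih.1]
    · simp [ih.2.1]
    · rw [ih.2.2]
      ring

theorem snd_pathVal_dualVal (k : ℕ) :
    (pathVal (newtonSum dualVal) (3 * k + 2)).snd = 2 ^ k * (3 * k + 4) / 2 ∧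
      (pathVal (newtonSum dualVal) (3 * k + 4)).snd = 2 ^ k * (9 * k + 8) / 2 := by
  induction k with
  | zero =>
    simp [pathVal_dualVal_two, pathVal_dualVal_four, fst_ofNat]
    norm_num
  | succ k ih =>
    have h (m : ℕ) := snd_pathVal_dualVal_add_five (3 * k + m)
    have hk := fst_pathVal_dualVal k
    have hk' := fst_pathVal_dualVal (k + 1)
    refine ⟨(h 0).trans ?_, (h 2).trans ?_⟩
    · simp only [add_zero]
      rw [ih.1, hk.1, hk.2.2]
      push_cast
      ring
    · rw [show 3 * k + 2 + 3 = 3 * (k + 1) + 2 by ring, ih.2, hk'.2.1, hk.2.2]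
      push_cast
      ring

theorem not_ePositive_one_one {a : ℕ} (ha : 0 < a) :
    ¬EPositive (csf (sunGraph 3 ![a, 1, 1])) := by
  intro hpos
  have t1 : newtonSum dualVal 1 = 0 := by
    rw [newtonSum_succ]
    simp [dualVal]
  have t2 : newtonSum dualVal 2 = 2 * DualNumber.eps := by
    rw [newtonSum_succ]
    simp [dualVal, one_add_one_eq_two]
  have t3 : newtonSum dualVal 3 = 3 := by
    rw [newtonSum_succ]
    simp [sum_range_succ, t1, dualVal]
    norm_num
  have t4 : newtonSum dualVal 4 = 4 * DualNumber.eps := by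
    rw [newtonSum_succ]
    simp [sum_range_succ, t1, t2, dualVal]
    linear_combination -2 * DualNumber.eps_mul_eps (R := ℚ)
  have hmem := sunVal_mem_of_ePositive hpos (v := dualVal) (by simp [dualVal]) (M := 4)
    (fun k hk => by
      rw [dualVal, if_neg (by omega), if_neg (by omega)]) dualNonneg
    (fun q hq => ⟨hq, le_rfl⟩) fun k => by
      unfold dualVal
      split_ifs
      exacts [dualNonneg.one_mem, ⟨by simp, by simp⟩, dualNonneg.zero_mem]
  change sunVal _ (a + 1) 2 2 ∈ _ at hmem
  rw [sunVal_two_two t1, t2, t3, t4] at hmem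
  obtain ⟨h1, h2⟩ := hmem
  simp [fst_ofNat, snd_ofNat, pow_two] at h1 h2
  obtain ⟨k, rfl | rfl | rfl⟩ : ∃ k, a = 3 * k + 1 ∨ a = 3 * k + 2 ∨ a = 3 * k + 3 :=
    ⟨(a - 1) / 3, by omega⟩
  · have e1 := (fst_pathVal_dualVal k).2.2
    have e2 := (fst_pathVal_dualVal (k + 1)).2.2
    rw [pow_succ] at e2
    have : 0 < (2 : ℚ) ^ k := by positivity
    rw [show 3 * k + 1 + 1 + 4 = 3 * (k + 1) + 3 by ring, e2, e1] at h1
    linarith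
  · have e1 := (snd_pathVal_dualVal k).2
    have e2 := (snd_pathVal_dualVal (k + 1)).2
    have e3 := (fst_pathVal_dualVal k).2.2
    rw [pow_succ] at e2
    have : 0 < (2 : ℚ) ^ k * (9 * k + 2) := by positivity
    rw [show 3 * k + 2 + 1 + 4 = 3 * (k + 1) + 4 by ring, e2, e1, e3] at h2
    push_cast at h2
    linarith
  · have e1 := (snd_pathVal_dualVal (k + 1)).1
    have e2 := (snd_pathVal_dualVal (k + 2)).1
    have e3 := (fst_pathVal_dualVal (k + 1)).1
    rw [pow_succ] at e1
    rw [pow_add] at e2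
    have : 0 < (2 : ℚ) ^ k * (3 * k + 1) := by positivity
    rw [show 3 * k + 3 + 1 + 4 = 3 * (k + 2) + 2 by ring, e2,
      show 3 * k + 3 + 1 + 1 = 3 * (k + 1) + 2 by ring, e1,
      show 3 * k + 3 + 1 = 3 * (k + 1) + 1 by ring, e3] at h2
    push_cast at h2
    linarith

end ShortRays

end ChromaticSun

/-- The sun `S(3; a, b, b)` is `e`-positive iff `a = 4` and `b = 2`. -/
theorem sun3_ePositive_iff (a b : ℕ) (ha : 0 < a) (hb : 0 < b) :
    EPositive (csf (sunGraph 3 ![a, b, b])) ↔ a = 4 ∧ b = 2 := by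
  constructor
  · intro h
    by_contra hab
    obtain rfl | hb2 := Nat.eq_or_lt_of_le hb
    · exact ChromaticSun.not_ePositive_one_one ha h
    · exact ChromaticSun.not_ePositive_of_two_le ha hb2 hab h
  · rintro ⟨rfl, rfl⟩
    exact ChromaticSun.ePositive_csf_sunGraph_four_two_two
end

section
/- If D(m, l, n) and D(m', l', n') are non-isomorphic dumbbell graphs (with m, n, m', n' ≥ 3 and l, l' ≥ −1), then X_{D(m, l, n)} ≠ X_{D(m', l', n')}. (Indeed their chromatic polynomials already differ: χ_{D(m,l,n)}(x) = (1/x)·(x−1)^{l+3}·((x−1)^{m−1} + (−1)^m)·((x−1)^{n−1} + (−1)^n), and this polynomial determines m, l, n up to swapping m and n.) -/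
/-- The proper colourings of `G` with values in `ℕ`. -/
abbrev IsProper {V : Type} (G : SimpleGraph V) (κ : V → ℕ) : Prop :=
  ∀ u v : V, G.Adj u v → κ u ≠ κ v

/-- The proper colourings of `G` in which colour `i` is used exactly `d i` times. -/
abbrev ColoringsOfType {V : Type} (G : SimpleGraph V) (d : ℕ →₀ ℕ) : Type :=
  {κ : V → ℕ // (∀ u v : V, G.Adj u v → κ u ≠ κ v) ∧ ∀ i : ℕ, Nat.card {v : V // κ v = i} = d i}

theorem finite_coloringsOfType {V : Type} [Fintype V] (G : SimpleGraph V) (d : ℕ →₀ ℕ) :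
    Finite (ColoringsOfType G d) := by
  have hmem (κ : ColoringsOfType G d) (v : V) : κ.1 v ∈ d.support := by
    rw [Finsupp.mem_support_iff, ← κ.2.2]
    have : Nonempty {w : V // κ.1 w = κ.1 v} := ⟨⟨v, rfl⟩⟩
    exact Nat.card_pos.ne'
  refine Finite.of_injective
    (fun κ : ColoringsOfType G d => fun v => (⟨κ.1 v, hmem κ v⟩ : d.support)) ?_
  intro κ κ' h
  ext v
  exact congrArg Subtype.val (congrFun h v)

/-- The type of a colouring of a finite set: how often each colour is used. -/
noncomputable def coloringType {V : Type} [Fintype V] (κ : V → ℕ) : ℕ →₀ ℕ :=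
  Finsupp.ofSupportFinite (fun i => Nat.card {v : V // κ v = i}) <| by
    refine (Set.finite_range κ).subset fun i hi => ?_
    rw [Function.mem_support] at hi
    obtain ⟨v, hv⟩ := (Nat.card_ne_zero.mp hi).1
    exact ⟨v, hv⟩

theorem coloringType_apply {V : Type} [Fintype V] (κ : V → ℕ) (i : ℕ) :
    coloringType κ i = Nat.card {v : V // κ v = i} := rfl

theorem coloringType_eq_zero_iff {V : Type} [Fintype V] (κ : V → ℕ) (i : ℕ) :
    coloringType κ i = 0 ↔ ∀ v, κ v ≠ i := by
  rw [coloringType_apply, Finite.card_eq_zero_iff, isEmpty_subtype]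

/-- Proper colourings with colours below `k`, grouped by their type. -/
noncomputable def boundedColoringsEquivSigma {V : Type} [Fintype V] (G : SimpleGraph V) (k : ℕ) :
    {κ : V → ℕ // IsProper G κ ∧ ∀ v, κ v < k} ≃
      Σ d : {d : ℕ →₀ ℕ // ∀ i, k ≤ i → d i = 0}, ColoringsOfType G d.1 where
  toFun κ := ⟨⟨coloringType κ.1, fun i hi => (coloringType_eq_zero_iff _ _).2 fun v hv => by
    have := κ.2.2 v
    omega⟩, ⟨κ.1, κ.2.1, fun _ => rfl⟩⟩
  invFun p := ⟨p.2.1, p.2.2.1, fun v => by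
    by_contra! hv
    refine (coloringType_eq_zero_iff p.2.1 (p.2.1 v)).1 ?_ v rfl
    rw [coloringType_apply, p.2.2.2]
    exact p.1.2 _ hv⟩
  left_inv _ := rfl
  right_inv := by
    rintro ⟨⟨d, hd⟩, ⟨κ, hκ, hc⟩⟩
    obtain rfl : coloringType κ = d := Finsupp.ext hc
    rfl

/-- The chromatic symmetric function determines the number of proper `k`-colourings. -/
theorem card_boundedColorings_eq_of_csf_eq {V W : Type} [Fintype V] [Fintype W]
    {G : SimpleGraph V} {H : SimpleGraph W} (h : csf G = csf H) (k : ℕ) :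
    Nat.card {κ : V → ℕ // IsProper G κ ∧ ∀ v, κ v < k} =
      Nat.card {κ : W → ℕ // IsProper H κ ∧ ∀ v, κ v < k} := by
  have hcard (d : ℕ →₀ ℕ) : Nat.card (ColoringsOfType G d) = Nat.card (ColoringsOfType H d) := by
    have := congrFun h d
    simp only [csf] at this
    exact_mod_cast this
  have e (d : ℕ →₀ ℕ) : ColoringsOfType G d ≃ ColoringsOfType H d :=
    haveI := finite_coloringsOfType G d
    haveI := finite_coloringsOfType H d
    Classical.choice ((Finite.card_eq).1 (hcard d))
  exact Nat.card_congr ((boundedColoringsEquivSigma G k).trans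
    ((Equiv.sigmaCongrRight
      fun d : {d : ℕ →₀ ℕ // ∀ i, k ≤ i → d i = 0} => e d.1).trans (boundedColoringsEquivSigma H k).symm))

/-- Extend a word of length `L` by zeros to an infinite sequence. -/
def extendWord {L : ℕ} (u : Fin L → Fin 4) (i : ℕ) : Fin 4 :=
  if h : i < L then u ⟨i, h⟩ else 0

theorem extendWord_val {L : ℕ} (u : Fin L → Fin 4) (i : Fin L) : extendWord u i = u i := by
  simp [extendWord]

theorem extendWord_snoc {L : ℕ} (u : Fin L → Fin 4) (x : Fin 4) :
    extendWord (Fin.snoc u x : Fin (L + 1) → Fin 4) = Function.update (extendWord u) L x := by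
  funext i
  rcases lt_trichotomy i L with h | rfl | h
  · simp [extendWord, Fin.snoc, h, h.ne, h.trans (Nat.lt_succ_self L)]
  · simp [extendWord, Fin.snoc]
  · have h1 : ¬ i < L := by omega
    have h2 : ¬ i < L + 1 := by omega
    simp [extendWord, h.ne', h1, h2]

open Classical in
/-- The number of words of length `L` over a four letter alphabet satisfying `P`. -/
noncomputable def wordCount (L : ℕ) (P : (ℕ → Fin 4) → Prop) : ℕ :=
  (Finset.univ.filter fun u : Fin L → Fin 4 => P (extendWord u)).card

open Classical in
theorem wordCount_succ {L c : ℕ} {P Q : (ℕ → Fin 4) → Prop}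
    (h : ∀ w, (Finset.univ.filter fun x => P (Function.update w L x)).card =
      if Q w then c else 0) :
    wordCount (L + 1) P = c * wordCount L Q := by
  have h1 : wordCount (L + 1) P = ∑ u : Fin L → Fin 4, ∑ x : Fin 4,
      if P (Function.update (extendWord u) L x) then 1 else 0 := by
    rw [wordCount, Finset.card_filter, ← (Fin.snocEquiv fun _ => Fin 4).sum_comp,
      Fintype.sum_prod_type, Finset.sum_comm]
    refine Finset.sum_congr rfl fun u _ => Finset.sum_congr rfl fun x _ => ?_
    rw [← extendWord_snoc]
    rfl
  rw [h1, wordCount, Finset.card_filter, Finset.mul_sum]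
  refine Finset.sum_congr rfl fun u _ => ?_
  rw [← Finset.card_filter, h]
  simp

theorem wordCount_and_add_wordCount_and_not (L : ℕ) (P Q : (ℕ → Fin 4) → Prop) :
    wordCount L (fun w => P w ∧ Q w) + wordCount L (fun w => P w ∧ ¬ Q w) = wordCount L P := by
  classical
  simp only [wordCount, ← Finset.filter_filter]
  exact Finset.card_filter_add_card_filter_not _

/-- `Q` depends only on the first `L` letters. -/
def IsLocal (L : ℕ) (Q : (ℕ → Fin 4) → Prop) : Prop :=
  ∀ w w' : ℕ → Fin 4, (∀ i < L, w i = w' i) → Q w → Q w'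

theorem IsLocal.update_iff {L : ℕ} {Q : (ℕ → Fin 4) → Prop} (hQ : IsLocal L Q)
    (w : ℕ → Fin 4) {j : ℕ} (hj : L ≤ j) (x : Fin 4) : Q (Function.update w j x) ↔ Q w := by
  have h (i : ℕ) (hi : i < L) : Function.update w j x i = w i :=
    Function.update_of_ne (by omega) _ _
  exact ⟨hQ _ _ h, hQ _ _ fun i hi => (h i hi).symm⟩

/-- Consecutive letters of `w` at positions `r, …, r + b` are distinct. -/
def IsPathWord (r b : ℕ) (w : ℕ → Fin 4) : Prop :=
  ∀ i < b, w (r + i) ≠ w (r + i + 1)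

theorem isPathWord_succ (r b : ℕ) (w : ℕ → Fin 4) :
    IsPathWord r (b + 1) w ↔ IsPathWord r b w ∧ w (r + b) ≠ w (r + b + 1) := by
  simp only [IsPathWord, Nat.forall_lt_succ_right]

theorem isLocal_and_isPathWord {r : ℕ} {Q : (ℕ → Fin 4) → Prop} (hQ : IsLocal (r + 1) Q) (b : ℕ) :
    IsLocal (r + b + 1) fun w => Q w ∧ IsPathWord r b w := by
  rintro w w' h ⟨h1, h2⟩
  refine ⟨hQ w w' (fun i hi => h i (by omega)) h1, fun i hi => ?_⟩
  rw [← h _ (by omega), ← h _ (by omega)]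
  exact h2 i hi

theorem isLocal_and_isCycleWord {r : ℕ} {Q : (ℕ → Fin 4) → Prop} (hQ : IsLocal (r + 1) Q)
    (b : ℕ) :
    IsLocal (r + b + 1) fun w => (Q w ∧ IsPathWord r b w) ∧ w r ≠ w (r + b) := by
  rintro w w' h ⟨h1, h2⟩
  refine ⟨isLocal_and_isPathWord hQ b w w' h h1, ?_⟩
  rwa [← h _ (by omega), ← h _ (by omega)]

/-- Appending a path with `b` edges multiplies the number of words by `3 ^ b`. -/
theorem wordCount_path {r : ℕ} {Q : (ℕ → Fin 4) → Prop} (hQ : IsLocal (r + 1) Q) (b : ℕ) :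
    wordCount (r + b + 1) (fun w => Q w ∧ IsPathWord r b w) = 3 ^ b * wordCount (r + 1) Q := by
  classical
  induction b with
  | zero => simp [IsPathWord]
  | succ b ih =>
    rw [pow_succ', mul_assoc, ← ih]
    refine wordCount_succ fun w => ?_
    have h (x : Fin 4) : (Q (Function.update w (r + b + 1) x) ∧
        IsPathWord r (b + 1) (Function.update w (r + b + 1) x)) ↔
        (Q w ∧ IsPathWord r b w) ∧ w (r + b) ≠ x := by
      rw [isPathWord_succ, ← and_assoc, (isLocal_and_isPathWord hQ b).update_iff w le_rfl]
      simp
    simp only [← add_assoc, h]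
    split_ifs with hw
    · simp only [hw, true_and]
      generalize w (r + b) = y
      revert y
      decide
    · simp [hw]

/-- Appending a path with `b + 1` edges and closing it up to a cycle. -/
theorem wordCount_cycle_succ {r : ℕ} {Q : (ℕ → Fin 4) → Prop} (hQ : IsLocal (r + 1) Q) (b : ℕ) :
    wordCount (r + (b + 1) + 1)
        (fun w => (Q w ∧ IsPathWord r (b + 1) w) ∧ w r ≠ w (r + (b + 1))) +
      wordCount (r + b + 1) (fun w => (Q w ∧ IsPathWord r b w) ∧ w r ≠ w (r + b)) =
      3 ^ (b + 1) * wordCount (r + 1) Q := by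
  classical
  rw [← wordCount_path hQ, ← wordCount_and_add_wordCount_and_not (r + (b + 1) + 1)
    (fun w => Q w ∧ IsPathWord r (b + 1) w) fun w => w r = w (r + (b + 1)), add_comm]
  congr 1
  rw [← one_mul (wordCount (r + b + 1) _)]
  symm
  refine wordCount_succ fun w => ?_
  have h (x : Fin 4) : ((Q (Function.update w (r + b + 1) x) ∧
      IsPathWord r (b + 1) (Function.update w (r + b + 1) x)) ∧
      Function.update w (r + b + 1) x r = Function.update w (r + b + 1) x (r + b + 1)) ↔
      ((Q w ∧ IsPathWord r b w) ∧ w r ≠ w (r + b)) ∧ w r = x := by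
    rw [isPathWord_succ, ← and_assoc, (isLocal_and_isPathWord hQ b).update_iff w le_rfl,
      Function.update_self, Function.update_of_ne (by omega), Function.update_of_ne (by omega)]
    grind
  simp only [← add_assoc, h]
  split_ifs with hw
  · simp only [eq_true hw, true_and]
    generalize w r = y
    revert y
    decide
  · simp [hw]

theorem four_mul_wordCount_cycle {r : ℕ} {Q : (ℕ → Fin 4) → Prop} (hQ : IsLocal (r + 1) Q)
    (b : ℕ) :
    4 * (wordCount (r + b + 1)
      (fun w => (Q w ∧ IsPathWord r b w) ∧ w r ≠ w (r + b)) : ℤ) =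
      3 * (3 ^ b - (-1) ^ b) * wordCount (r + 1) Q := by
  induction b with
  | zero => simp [wordCount]
  | succ b ih =>
    have h := wordCount_cycle_succ hQ b
    zify at h
    rw [pow_succ, pow_succ] at *
    linarith

theorem wordCount_one_true : wordCount 1 (fun _ => True) = 4 := by
  simp [wordCount]

/-- The words that properly colour the dumbbell with cycles of lengths `a + 1`, `b + 1` and a
connecting path with `t` edges. -/
def IsDumbbellWord (a t b : ℕ) (w : ℕ → Fin 4) : Prop :=
  (((((True ∧ IsPathWord 0 a w) ∧ w 0 ≠ w (0 + a)) ∧ IsPathWord (0 + a) t w) ∧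
    IsPathWord (0 + a + t) b w) ∧ w (0 + a + t) ≠ w (0 + a + t + b))

theorem four_mul_wordCount_isDumbbellWord (a t b : ℕ) :
    4 * (wordCount (a + t + b + 1) (IsDumbbellWord a t b) : ℤ) =
      3 ^ (t + 2) * ((3 ^ a - (-1) ^ a) * (3 ^ b - (-1) ^ b)) := by
  have h0 : IsLocal (0 + 1) fun _ => True := fun _ _ _ _ => trivial
  have h1 := isLocal_and_isCycleWord h0 a
  have h2 := isLocal_and_isPathWord h1 t
  have e0 := four_mul_wordCount_cycle h0 a
  have e1 := wordCount_path h1 t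
  have e2 := four_mul_wordCount_cycle h2 b
  rw [zero_add, wordCount_one_true] at e0
  rw [e1] at e2
  have e3 : a + t + b + 1 = 0 + a + t + b + 1 := by omega
  rw [e3]
  unfold IsDumbbellWord
  rw [e2]
  push_cast at e0 ⊢
  rw [zero_add] at *
  have e4 : (wordCount (a + 1) (fun w => (True ∧ IsPathWord 0 a w) ∧ w 0 ≠ w a) : ℤ) =
    3 * (3 ^ a - (-1) ^ a) := by linarith
  rw [e4]
  ring

theorem isProper_dumbbellAux_iff {a t b : ℕ} (ha : 2 ≤ a) (hb : 2 ≤ b)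
    (u : Fin (a + 1 + (b + 1) + t - 1) → Fin 4) :
    IsProper (dumbbellAux (a + 1) (b + 1) t) (fun v => (u v : ℕ)) ↔
      IsDumbbellWord a t b (extendWord u) := by
  have hadj (i j : ℕ) (hi : i < a + 1 + (b + 1) + t - 1) (hj : j < a + 1 + (b + 1) + t - 1) :
      (dumbbellAux (a + 1) (b + 1) t).Adj ⟨i, hi⟩ ⟨j, hj⟩ ↔
        ((j = i + 1 ∨ i = 0 ∧ j = a ∨ i = a + t ∧ j = a + t + b) ∨
        (i = j + 1 ∨ j = 0 ∧ i = a ∨ j = a + t ∧ i = a + t + b)) := by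
    simp only [dumbbellAux, SimpleGraph.fromRel_adj, ne_eq, Fin.mk.injEq]
    omega
  have hext (i : ℕ) (hi : i < a + 1 + (b + 1) + t - 1) : extendWord u i = u ⟨i, hi⟩ :=
    extendWord_val u ⟨i, hi⟩
  constructor
  · intro h
    have key (i j : ℕ) (hj : j ≤ a + t + b)
        (hij : j = i + 1 ∨ i = 0 ∧ j = a ∨ i = a + t ∧ j = a + t + b) :
        extendWord u i ≠ extendWord u j := by
      rw [hext i (by omega), hext j (by omega)]
      exact fun he => h _ _ ((hadj _ _ _ _).2 (Or.inl hij)) (congrArg Fin.val he)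
    refine ⟨⟨⟨⟨⟨trivial, fun i hi => ?_⟩, ?_⟩, fun i hi => ?_⟩, fun i hi => ?_⟩, ?_⟩ <;>
      exact key _ _ (by omega) (by omega)
  · rintro ⟨⟨⟨⟨⟨-, h1⟩, h2⟩, h3⟩, h4⟩, h5⟩
    have key (i j : ℕ) (hj : j ≤ a + t + b)
        (hij : j = i + 1 ∨ i = 0 ∧ j = a ∨ i = a + t ∧ j = a + t + b) :
        extendWord u i ≠ extendWord u j := by
      rcases hij with rfl | ⟨rfl, rfl⟩ | ⟨rfl, rfl⟩
      · rcases lt_or_ge i a with hi | hi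
        · simpa using h1 i hi
        · obtain ⟨s, rfl⟩ := Nat.exists_eq_add_of_le hi
          rcases lt_or_ge s t with hs | hs
          · simpa using h3 s hs
          · obtain ⟨s, rfl⟩ := Nat.exists_eq_add_of_le hs
            simpa [add_assoc] using h4 s (by omega)
      · simpa using h2
      · simpa using h5
    rintro ⟨i, hi⟩ ⟨j, hj⟩ hij he
    rw [hadj] at hij
    have he' := Fin.ext he
    rw [← hext, ← hext] at he'
    rcases hij with hij | hij
    · exact key i j (by omega) hij he'
    · exact key j i (by omega) hij he'.symm

theorem card_boundedColorings_dumbbellAux {a t b : ℕ} (ha : 2 ≤ a) (hb : 2 ≤ b) :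
    Nat.card {κ : Fin (a + 1 + (b + 1) + t - 1) → ℕ //
      IsProper (dumbbellAux (a + 1) (b + 1) t) κ ∧ ∀ v, κ v < 4} =
      wordCount (a + t + b + 1) (IsDumbbellWord a t b) := by
  classical
  rw [show a + t + b + 1 = a + 1 + (b + 1) + t - 1 by omega, wordCount, ← Fintype.card_subtype,
    ← Nat.card_eq_fintype_card]
  refine Nat.card_congr
    { toFun := fun κ => ⟨fun v => ⟨κ.1 v, κ.2.2 v⟩, (isProper_dumbbellAux_iff ha hb _).1 κ.2.1⟩
      invFun := fun u => ⟨fun v => (u.1 v : ℕ), (isProper_dumbbellAux_iff ha hb _).2 u.2,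
        fun v => (u.1 v).2⟩
      left_inv := fun _ => rfl
      right_inv := fun _ => rfl }

theorem not_three_dvd_three_pow_sub {a : ℕ} (ha : 1 ≤ a) : ¬ (3 : ℤ) ∣ 3 ^ a - (-1) ^ a := by
  have h : (3 : ℤ) ∣ 3 ^ a := dvd_pow_self 3 (by omega)
  rcases neg_one_pow_eq_or ℤ a with h' | h' <;> rw [h'] <;> omega

theorem three_pow_sub_injective {a b : ℕ} (ha : 1 ≤ a) (hb : 1 ≤ b)
    (h : (3 : ℤ) ^ a - (-1) ^ a = 3 ^ b - (-1) ^ b) : a = b := by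
  have h1 : (3 : ℤ) ∣ 3 ^ a := dvd_pow_self 3 (by omega)
  have h2 : (3 : ℤ) ∣ 3 ^ b := dvd_pow_self 3 (by omega)
  have h3 : (3 : ℤ) ^ a = 3 ^ b := by
    rcases neg_one_pow_eq_or ℤ a with ha' | ha' <;>
      rcases neg_one_pow_eq_or ℤ b with hb' | hb' <;> rw [ha', hb'] at h <;> omega
  exact Nat.pow_right_injective (show 2 ≤ 3 by norm_num) (by exact_mod_cast h3)

theorem le_of_three_pow_sub_mul_eq {a b a' b' : ℕ} (ha : 1 ≤ a) (hab : a ≤ b) (hab' : a' ≤ b')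
    (h : ((3 : ℤ) ^ a - (-1) ^ a) * (3 ^ b - (-1) ^ b) =
      (3 ^ a' - (-1) ^ a') * (3 ^ b' - (-1) ^ b')) : a' ≤ a := by
  by_contra! hlt
  obtain ⟨c, rfl⟩ := Nat.exists_eq_add_of_le hab
  obtain ⟨d, rfl⟩ := Nat.exists_eq_add_of_lt hlt
  obtain ⟨e, rfl⟩ := Nat.exists_eq_add_of_le hab'
  have h1 : (3 : ℤ) ∣ 3 ^ a := dvd_pow_self 3 (by omega)
  have hpos : (3 : ℤ) ^ a ≠ 0 := by positivity
  have hc : c = 0 ∨ (3 : ℤ) ∣ 3 ^ c := by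
    rcases Nat.eq_zero_or_pos c with hc | hc
    · exact Or.inl hc
    · exact Or.inr (dvd_pow_self 3 (by omega))
  set s : ℤ := (-1) ^ a * (-1) ^ (a + c) with hs
  set s' : ℤ := (-1) ^ (a + d + 1) * (-1) ^ (a + d + 1 + e) with hs'
  have hs1 : s = 1 ∨ s = -1 := by
    rw [hs, ← pow_add]
    exact neg_one_pow_eq_or ℤ _
  have hs1' : s' = 1 ∨ s' = -1 := by
    rw [hs', ← pow_add]
    exact neg_one_pow_eq_or ℤ _
  have h2 : s + 3 ^ a * (3 ^ (a + c) - (-1) ^ a * 3 ^ c - (-1) ^ (a + c)) =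
      s' + 3 ^ a * (3 * (3 ^ d * 3 ^ (a + d + 1 + e) - (-1) ^ (a + d + 1) * (3 ^ d * 3 ^ e)
        - 3 ^ d * (-1) ^ (a + d + 1 + e))) := by
    rw [hs, hs']
    linear_combination h
  have hss : s = s' := by
    obtain ⟨y, hy⟩ := h1
    rw [hy, mul_assoc, mul_assoc] at h2
    omega
  rw [hss, add_right_inj] at h2
  have h3 := mul_left_cancel₀ hpos h2
  have h4 : (3 : ℤ) ∣ 3 ^ (a + c) := dvd_pow_self 3 (by omega)
  have h5 : (3 : ℤ) ∣ 3 ^ (a + c) - (-1) ^ a * 3 ^ c - (-1) ^ (a + c) := Dvd.intro _ h3.symm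
  rcases hc with rfl | hc
  · rw [add_zero] at *
    rcases neg_one_pow_eq_or ℤ a with h' | h' <;> rw [h'] at h5 <;> omega
  · have h6 := hc.mul_left ((-1) ^ a)
    rcases neg_one_pow_eq_or ℤ (a + c) with h' | h' <;> rw [h'] at h5 <;> omega

theorem eq_and_eq_of_three_pow_sub_mul_eq {a b a' b' : ℕ} (ha : 1 ≤ a) (ha' : 1 ≤ a')
    (hab : a ≤ b) (hab' : a' ≤ b')
    (h : ((3 : ℤ) ^ a - (-1) ^ a) * (3 ^ b - (-1) ^ b) =
      (3 ^ a' - (-1) ^ a') * (3 ^ b' - (-1) ^ b')) : a = a' ∧ b = b' := by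
  obtain rfl : a = a' := le_antisymm (le_of_three_pow_sub_mul_eq ha' hab' hab h.symm)
    (le_of_three_pow_sub_mul_eq ha hab hab' h)
  refine ⟨rfl, three_pow_sub_injective (by omega) (by omega) (mul_left_cancel₀ ?_ h)⟩
  intro h0
  exact not_three_dvd_three_pow_sub ha (h0 ▸ dvd_zero 3)

theorem le_of_three_pow_mul_eq {s s' : ℕ} {x y : ℤ} (hx : ¬ 3 ∣ x)
    (h : 3 ^ s * x = 3 ^ s' * y) : s' ≤ s := by
  by_contra! hlt
  obtain ⟨d, rfl⟩ := Nat.exists_eq_add_of_lt hlt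
  refine hx ⟨3 ^ d * y, mul_left_cancel₀ (pow_ne_zero s three_ne_zero) (h.trans ?_)⟩
  ring

theorem dumbbell_parameters_unique {a t b a' t' b' : ℕ} (ha : 1 ≤ a) (hb : 1 ≤ b) (ha' : 1 ≤ a')
    (hb' : 1 ≤ b')
    (h : (3 : ℤ) ^ (t + 2) * ((3 ^ a - (-1) ^ a) * (3 ^ b - (-1) ^ b)) =
      3 ^ (t' + 2) * ((3 ^ a' - (-1) ^ a') * (3 ^ b' - (-1) ^ b'))) :
    t = t' ∧ (a = a' ∧ b = b' ∨ a = b' ∧ b = a') := by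
  have hprod {c d : ℕ} (hc : 1 ≤ c) (hd : 1 ≤ d) :
      ¬ (3 : ℤ) ∣ (3 ^ c - (-1) ^ c) * (3 ^ d - (-1) ^ d) := fun h3 =>
    (Int.prime_three.dvd_or_dvd h3).elim (not_three_dvd_three_pow_sub hc)
      (not_three_dvd_three_pow_sub hd)
  have h1 := le_of_three_pow_mul_eq (hprod ha hb) h
  have h2 := le_of_three_pow_mul_eq (hprod ha' hb') h.symm
  obtain rfl : t = t' := by omega
  refine ⟨rfl, ?_⟩
  have h3 := mul_left_cancel₀ (pow_ne_zero _ three_ne_zero) h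
  rcases le_total a b with hab | hab <;> rcases le_total a' b' with hab' | hab'
  · exact Or.inl (eq_and_eq_of_three_pow_sub_mul_eq ha ha' hab hab' h3)
  · exact Or.inr (eq_and_eq_of_three_pow_sub_mul_eq ha hb' hab hab' (by rw [h3, mul_comm]))
  · exact Or.inr (eq_and_eq_of_three_pow_sub_mul_eq hb ha' hab hab' (by rw [← h3, mul_comm])).symm
  · exact Or.inl (eq_and_eq_of_three_pow_sub_mul_eq hb hb' hab hab'
      (by rw [mul_comm, h3, mul_comm])).symm

/-- Reversing the vertex order swaps the two cycles of a dumbbell. -/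
def dumbbellAuxSwap (m n t : ℕ) (hm : 1 ≤ m) (hn : 1 ≤ n) :
    dumbbellAux m n t ≃g dumbbellAux n m t where
  toEquiv := Fin.revPerm.trans (finCongr (by omega))
  map_rel_iff' := by
    have key (i j : ℕ) (hi : i < m + n + t - 1) (hj : j < m + n + t - 1) :
        (m + n + t - 1 - (j + 1) = m + n + t - 1 - (i + 1) + 1
          ∨ (m + n + t - 1 - (i + 1) = 0 ∧ m + n + t - 1 - (j + 1) = n - 1)
          ∨ (m + n + t - 1 - (i + 1) = n + t - 1 ∧ m + n + t - 1 - (j + 1) = n + m + t - 2)) ↔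
        (i = j + 1 ∨ (j = 0 ∧ i = m - 1) ∨ (j = m + t - 1 ∧ i = m + n + t - 2)) := by
      refine or_congr (by omega) (Iff.trans or_comm (or_congr ?_ ?_)) <;>
        constructor <;> rintro ⟨h, h'⟩ <;> constructor <;> omega
    intro i j
    simp only [dumbbellAux, SimpleGraph.fromRel_adj, Fin.cast_inj, Fin.rev_inj, ne_eq,
      Equiv.trans_apply, finCongr_apply, Fin.val_cast, Fin.revPerm_apply, Fin.val_rev,
      key i j i.2 j.2, key j i j.2 i.2]
    exact and_congr_right fun _ => or_comm

/-- Non-isomorphic dumbbell graphs (with `m, n, m', n' ≥ 3`, `l, l' ≥ -1`)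
have different chromatic symmetric functions. -/
theorem dumbbell_csf_distinguishes (m n m' n' : ℕ) (l l' : ℤ)
    (hm : 3 ≤ m) (hn : 3 ≤ n) (hm' : 3 ≤ m') (hn' : 3 ≤ n')
    (hl : -1 ≤ l) (hl' : -1 ≤ l')
    (hiso : IsEmpty (dumbbell m n l ≃g dumbbell m' n' l')) :
    csf (dumbbell m n l) ≠ csf (dumbbell m' n' l') := by
  intro h
  obtain ⟨a, rfl⟩ : ∃ a, m = a + 1 := ⟨m - 1, by omega⟩
  obtain ⟨b, rfl⟩ : ∃ a, n = a + 1 := ⟨n - 1, by omega⟩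
  obtain ⟨a', rfl⟩ : ∃ a, m' = a + 1 := ⟨m' - 1, by omega⟩
  obtain ⟨b', rfl⟩ : ∃ a, n' = a + 1 := ⟨n' - 1, by omega⟩
  have hcard := card_boundedColorings_eq_of_csf_eq h 4
  unfold dumbbell at hcard hiso
  generalize (l + 1).toNat = t at hcard hiso
  generalize (l' + 1).toNat = t' at hcard hiso
  rw [card_boundedColorings_dumbbellAux (by omega) (by omega),
    card_boundedColorings_dumbbellAux (by omega) (by omega)] at hcard
  have heq := four_mul_wordCount_isDumbbellWord a t b
  rw [hcard, four_mul_wordCount_isDumbbellWord] at heq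
  obtain ⟨rfl, ⟨rfl, rfl⟩ | ⟨rfl, rfl⟩⟩ := dumbbell_parameters_unique (by omega) (by omega)
    (by omega) (by omega) heq.symm
  · exact hiso.false SimpleGraph.Iso.refl
  · exact hiso.false (dumbbellAuxSwap _ _ _ (by omega) (by omega))
end

section
/- For every m > 3, n ≥ 3 and l ≥ −1, the chromatic symmetric functions satisfy X_{D(m, l, n)} = X_{D(m−1, l+1, n)} + X_{T_{n, m+l}} − X_{T_{n, l+1}}·X_{C_{m−1}}. -/
section

open SimpleGraph

/-- The exponent vector of the monomial attached to a colouring. -/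
noncomputable def colorContent {V : Type} [Fintype V] (κ : V → ℕ) : ℕ →₀ ℕ :=
  ∑ v, Finsupp.single (κ v) 1

theorem colorContent_apply {V : Type} [Fintype V] (κ : V → ℕ) (i : ℕ) :
    colorContent κ i = Nat.card {v : V // κ v = i} := by
  classical
  simp [colorContent, Finsupp.finsetSum_apply, Finsupp.single_apply, Fintype.card_subtype]

theorem colorContent_comp_equiv {V W : Type} [Fintype V] [Fintype W] (e : V ≃ W) (κ : W → ℕ) :
    colorContent (κ ∘ e) = colorContent κ :=
  Equiv.sum_comp e fun w => Finsupp.single (κ w) 1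

theorem colorContent_sum {V W : Type} [Fintype V] [Fintype W] (κ : V ⊕ W → ℕ) :
    colorContent κ = colorContent (κ ∘ Sum.inl) + colorContent (κ ∘ Sum.inr) := by
  simp [colorContent, Fintype.sum_sum_type]

/-- Proper colourings with a prescribed content. -/
def properColorings {V : Type} [Fintype V] (G : SimpleGraph V) (d : ℕ →₀ ℕ) : Set (V → ℕ) :=
  {κ | (∀ u v : V, G.Adj u v → κ u ≠ κ v) ∧ colorContent κ = d}

theorem csf_apply {V : Type} [Fintype V] (G : SimpleGraph V) (d : ℕ →₀ ℕ) :
    csf G d = ((properColorings G d).ncard : ℚ) := by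
  simp only [csf, properColorings, ← Nat.card_coe_set_eq, Set.coe_ofPred, Finsupp.ext_iff,
    colorContent_apply]

theorem finite_colorContent_eq {V : Type} [Fintype V] (d : ℕ →₀ ℕ) :
    {κ : V → ℕ | colorContent κ = d}.Finite := by
  refine (Set.Finite.pi' fun _ : V => d.support.finite_toSet).subset fun κ hκ v => ?_
  have h : colorContent κ = d := hκ
  have : Nonempty {u : V // κ u = κ v} := ⟨⟨v, rfl⟩⟩
  simp only [← h, Finset.mem_coe, Finsupp.mem_support_iff, colorContent_apply]
  exact Nat.card_pos.ne'

theorem finite_properColorings {V : Type} [Fintype V] (G : SimpleGraph V) (d : ℕ →₀ ℕ) :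
    (properColorings G d).Finite :=
  (finite_colorContent_eq d).subset fun _ h => h.2

/-- Isomorphic graphs have the same chromatic symmetric function. -/
theorem csf_congr {V W : Type} [Fintype V] [Fintype W] {G : SimpleGraph V} {H : SimpleGraph W}
    (e : G ≃g H) : csf G = csf H := by
  funext d
  rw [csf_apply, csf_apply, ← Nat.card_coe_set_eq, ← Nat.card_coe_set_eq]
  congr 1
  refine Nat.card_congr
    ((Equiv.arrowCongr e.toEquiv (Equiv.refl ℕ)).subtypeEquiv fun κ => and_congr ?_ ?_)
  · constructor
    · intro h u v huv
      exact h _ _ (e.symm.map_adj_iff.2 huv)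
    · intro h u v huv
      have := h _ _ (e.map_adj_iff.2 huv)
      change κ (e.symm (e u)) ≠ κ (e.symm (e v)) at this
      rwa [e.symm_apply_apply, e.symm_apply_apply] at this
  · change _ ↔ colorContent (κ ∘ e.toEquiv.symm) = d
    rw [colorContent_comp_equiv]

/-- The chromatic symmetric function is multiplicative on disjoint unions. -/
theorem csf_sum {V W : Type} [Fintype V] [Fintype W] (G : SimpleGraph V) (H : SimpleGraph W) :
    csf (G ⊕g H) = csf G * csf H := by
  classical
  funext d
  change csf (G ⊕g H) d = MvPowerSeries.coeff d (csf G * csf H)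
  rw [MvPowerSeries.coeff_mul]
  change _ = ∑ p ∈ Finset.HasAntidiagonal.antidiagonal d, csf G p.1 * csf H p.2
  simp only [csf_apply, ← Nat.card_coe_set_eq]
  have (p : Finset.HasAntidiagonal.antidiagonal d) :
      Finite (properColorings G p.1.1 × properColorings H p.1.2) :=
    have := (finite_properColorings G p.1.1).to_subtype
    have := (finite_properColorings H p.1.2).to_subtype
    inferInstance
  let e : properColorings (G ⊕g H) d ≃
      (p : Finset.HasAntidiagonal.antidiagonal d) × (properColorings G p.1.1 × properColorings H p.1.2) :=
    { toFun := fun κ => ⟨⟨(colorContent (κ.1 ∘ Sum.inl), colorContent (κ.1 ∘ Sum.inr)), by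
          rw [Finset.HasAntidiagonal.mem_antidiagonal, ← colorContent_sum]; exact κ.2.2⟩,
        ⟨κ.1 ∘ Sum.inl, fun u v h => κ.2.1 (Sum.inl u) (Sum.inl v) h, rfl⟩,
        ⟨κ.1 ∘ Sum.inr, fun u v h => κ.2.1 (Sum.inr u) (Sum.inr v) h, rfl⟩⟩
      invFun := fun x => ⟨Sum.elim x.2.1.1 x.2.2.1, by
        refine ⟨?_, ?_⟩
        · rintro (u | u) (v | v) h
          · exact x.2.1.2.1 u v h
          · exact absurd h (by simp)
          · exact absurd h (by simp)
          · exact x.2.2.2.1 u v h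
        · rw [colorContent_sum, Sum.elim_comp_inl, Sum.elim_comp_inr, x.2.1.2.2, x.2.2.2.2]
          exact Finset.HasAntidiagonal.mem_antidiagonal.1 x.1.2⟩
      left_inv := fun κ => Subtype.ext (Sum.elim_comp_inl_inr κ.1)
      right_inv := by
        rintro ⟨⟨⟨p, q⟩, hpq⟩, ⟨κ, hκ, hp⟩, ⟨μ, hμ, hq⟩⟩
        change colorContent κ = p at hp
        change colorContent μ = q at hq
        subst hp hq
        rfl }
  rw [Nat.card_congr e, Nat.card_sigma]
  simp only [Nat.card_prod]
  push_cast
  exact Finset.sum_coe_sort (Finset.HasAntidiagonal.antidiagonal d) fun p =>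
    (Nat.card (properColorings G p.1) : ℚ) * Nat.card (properColorings H p.2)

/-- Adding an edge keeps exactly the proper colourings separating its ends. -/
theorem mem_properColorings_sup_edge {V : Type} [Fintype V] {G : SimpleGraph V} {d : ℕ →₀ ℕ}
    {a b : V} (hab : a ≠ b) {κ : V → ℕ} :
    κ ∈ properColorings (G ⊔ edge a b) d ↔ κ ∈ properColorings G d ∧ κ a ≠ κ b := by
  simp only [properColorings, Set.mem_ofPred_eq, sup_adj, edge_adj]
  constructor
  · rintro ⟨h, hd⟩
    exact ⟨⟨fun u v huv => h u v (Or.inl huv), hd⟩, h a b (Or.inr ⟨Or.inl ⟨rfl, rfl⟩, hab⟩)⟩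
  · rintro ⟨⟨h, hd⟩, hne⟩
    refine ⟨?_, hd⟩
    rintro u v (huv | ⟨⟨rfl, rfl⟩ | ⟨rfl, rfl⟩, -⟩)
    · exact h u v huv
    · exact hne
    · exact hne.symm

/-- The triple-deletion rule for the edges among three distinct vertices. -/
theorem csf_triple_deletion {V : Type} [Fintype V] (G : SimpleGraph V) {a b c : V}
    (hab : a ≠ b) (hac : a ≠ c) (hbc : b ≠ c) :
    csf (G ⊔ edge a c ⊔ edge b c) + csf (G ⊔ edge a b) =
      csf (G ⊔ edge a b ⊔ edge b c) + csf (G ⊔ edge a c) := by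
  funext d
  change csf _ d + csf _ d = csf _ d + csf _ d
  simp only [csf_apply]
  have split (H : SimpleGraph V) : (properColorings H d).ncard =
      (properColorings (H ⊔ edge b c) d).ncard +
        {κ ∈ properColorings H d | κ b = κ c}.ncard := by
    rw [← Set.ncard_union_eq _ ((finite_properColorings _ d))
      ((finite_properColorings H d).subset fun _ h => h.1)]
    · congr 1
      ext κ
      simp only [Set.mem_union, mem_properColorings_sup_edge hbc, Set.mem_ofPred_eq]
      tauto
    · rw [Set.disjoint_left]
      intro κ h h'
      exact ((mem_properColorings_sup_edge hbc).1 h).2 h'.2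
  have key : {κ ∈ properColorings (G ⊔ edge a b) d | κ b = κ c} =
      {κ ∈ properColorings (G ⊔ edge a c) d | κ b = κ c} := by
    ext κ
    simp only [Set.mem_ofPred_eq, mem_properColorings_sup_edge hab,
      mem_properColorings_sup_edge hac]
    constructor <;> rintro ⟨⟨h, hne⟩, he⟩ <;> simp_all
  rw [split (G ⊔ edge a b), split (G ⊔ edge a c), key]
  push_cast
  ring

theorem cycleG_eq_pathG_sup_edge {p : ℕ} (hp : 3 ≤ p) :
    cycleG p = pathG p ⊔ edge ⟨0, by omega⟩ ⟨p - 1, by omega⟩ := by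
  ext i j
  have mod_succ (k : Fin p) : ((k : ℕ) + 1) % p = if (k : ℕ) + 1 = p then 0 else (k : ℕ) + 1 := by
    split_ifs with h
    · rw [h, Nat.mod_self]
    · exact Nat.mod_eq_of_lt (by omega)
  simp only [cycleG, pathG, sup_adj, edge_adj, fromRel_adj, Fin.ext_iff, ne_eq, mod_succ]
  have := i.2
  have := j.2
  split_ifs <;> omega

theorem sum_sup_edge_inl {V W : Type} (G : SimpleGraph V) (H : SimpleGraph W) (a b : V) :
    (G ⊕g H) ⊔ edge (Sum.inl a) (Sum.inl b) = (G ⊔ edge a b) ⊕g H := by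
  ext (u | u) (v | v) <;> simp [edge_adj]

/-- The vertices of two consecutive segments of lengths `p` and `q`, the second one reversed. -/
def segmentEquiv {p q N : ℕ} (h : p + q = N) : Fin p ⊕ Fin q ≃ Fin N :=
  (Equiv.sumCongr (Equiv.refl _) Fin.revPerm).trans (finSumFinEquiv.trans (finCongr h))

@[simp]
theorem segmentEquiv_inl {p q N : ℕ} (h : p + q = N) (i : Fin p) :
    (segmentEquiv h (Sum.inl i) : ℕ) = i := by
  simp [segmentEquiv]

@[simp]
theorem segmentEquiv_inr {p q N : ℕ} (h : p + q = N) (j : Fin q) :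
    (segmentEquiv h (Sum.inr j) : ℕ) = p + (q - (j + 1)) := by
  simp [segmentEquiv]

set_option maxHeartbeats 2000000 in
/-- The dumbbell recursion with path parameter `t = l + 1` and `p = m - 1`. -/
theorem csf_dumbbellAux (p n t : ℕ) (hp : 3 ≤ p) (hn : 3 ≤ n) :
    csf (dumbbellAux (p + 1) n t) + csf (tadpole n t) * csf (cycleG p) =
      csf (dumbbellAux p n (t + 1)) + csf (tadpole n (p + t)) := by
  let a : Fin p ⊕ Fin (n + t) := Sum.inl ⟨0, by omega⟩
  let b : Fin p ⊕ Fin (n + t) := Sum.inl ⟨p - 1, by omega⟩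
  let c : Fin p ⊕ Fin (n + t) := Sum.inr ⟨n + t - 1, by omega⟩
  let S := pathG p ⊕g tadpole n t
  have hD : csf (S ⊔ edge a c ⊔ edge b c) = csf (dumbbellAux (p + 1) n t) := by
    refine csf_congr ⟨segmentEquiv (by omega), ?_⟩
    rintro (⟨i, hi⟩ | ⟨i, hi⟩) (⟨j, hj⟩ | ⟨j, hj⟩) <;>
      simp [S, a, b, c, dumbbellAux, pathG, tadpole, edge_adj, Fin.ext_iff] <;> omega
  have hD' : csf (S ⊔ edge a b ⊔ edge b c) = csf (dumbbellAux p n (t + 1)) := by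
    refine csf_congr ⟨segmentEquiv (by omega), ?_⟩
    rintro (⟨i, hi⟩ | ⟨i, hi⟩) (⟨j, hj⟩ | ⟨j, hj⟩) <;>
      simp [S, a, b, c, dumbbellAux, pathG, tadpole, edge_adj, Fin.ext_iff] <;> omega
  have hT : csf (S ⊔ edge b c) = csf (tadpole n (p + t)) := by
    refine csf_congr ⟨(segmentEquiv (by omega)).trans Fin.revPerm, ?_⟩
    rintro (⟨i, hi⟩ | ⟨i, hi⟩) (⟨j, hj⟩ | ⟨j, hj⟩) <;>
      simp [S, b, c, pathG, tadpole, edge_adj, Fin.ext_iff] <;> omega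
  have hflip : csf (S ⊔ edge a c) = csf (S ⊔ edge b c) := by
    refine csf_congr ⟨Equiv.sumCongr Fin.revPerm (Equiv.refl _), ?_⟩
    rintro (⟨i, hi⟩ | ⟨i, hi⟩) (⟨j, hj⟩ | ⟨j, hj⟩) <;>
      simp [S, a, b, c, pathG, tadpole, edge_adj, Fin.ext_iff] <;> omega
  have hC : csf (S ⊔ edge a b) = csf (tadpole n t) * csf (cycleG p) := by
    rw [sum_sup_edge_inl, csf_sum, cycleG_eq_pathG_sup_edge hp, mul_comm]
  have hab : a ≠ b := by simp [a, b]; omega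
  have := csf_triple_deletion S hab (Sum.inl_ne_inr : a ≠ c) (Sum.inl_ne_inr : b ≠ c)
  rwa [hD, hC, hD', hflip, hT] at this

end

/-- For `m > 3`, `n ≥ 3`, `l ≥ -1`:
`X_{D(m,l,n)} = X_{D(m-1,l+1,n)} + X_{T_{n,m+l}} - X_{T_{n,l+1}}·X_{C_{m-1}}`. -/
theorem dumbbell_recursion (m n : ℕ) (l : ℤ) (hm : 3 < m) (hn : 3 ≤ n) (hl : -1 ≤ l) :
    csf (dumbbell m n l) =
      csf (dumbbell (m - 1) n (l + 1)) + csf (tadpole n ((m : ℤ) + l).toNat)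
        - csf (tadpole n (l + 1).toNat) * csf (cycleG (m - 1)) := by
  obtain ⟨t, rfl⟩ : ∃ t : ℕ, l = (t : ℤ) - 1 := ⟨(l + 1).toNat, by omega⟩
  obtain ⟨p, rfl⟩ : ∃ p : ℕ, m = p + 1 := ⟨m - 1, by omega⟩
  have h₁ : ((t : ℤ) - 1 + 1).toNat = t := by omega
  have h₂ : ((t : ℤ) - 1 + 1 + 1).toNat = t + 1 := by omega
  have h₃ : (((p + 1 : ℕ) : ℤ) + ((t : ℤ) - 1)).toNat = p + t := by omega
  rw [dumbbell, dumbbell, h₁, h₂, h₃, Nat.add_sub_cancel, eq_sub_iff_add_eq]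
  exact csf_dumbbellAux p n t (by omega) hn
end
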